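/- Let F : V ∪ J → ℝ×ℝ_{≥0} be a C^∞-lifted strongly billiard-like map. Then there exist a domain U ⊆ V adjacent to J and C^∞-smooth functions τ(s,y) and h̃(s,y) on U ∪ J such that: h̃ is F-invariant, h̃ vanishes identically on J, and ∂h̃/∂y > 0; the map (s,y) ↦ (τ(s,y), h̃(s,y)) is a C^∞-smooth diffeomorphism of U ∪ J onto its image which preserves the standard area form (its Jacobian determinant is identically 1), so that (τ, h̃) are symplectic coordinates on U ∪ J; and in these coordinates F takes the normal form (τ, h̃) ↦ (τ + √h̃, h̃), i.e. τ(F(x)) = τ(x) + √(h̃(x)) and h̃(F(x)) = h̃(x) whenever x and F(x) lie in U ∪ J. -/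

import Mathlib

open Set

/-- `J = (a,b) × {0} ⊂ ℝ²`. -/
def Jset (a b : ℝ) : Set (ℝ × ℝ) := Set.Ioo a b ×ˢ ({0} : Set ℝ)

/-- A domain (connected open set) in the upper half-plane adjacent to the
interval `J = (a,b) × {0}`. -/
def IsAdjDomain (a b : ℝ) (V : Set (ℝ × ℝ)) : Prop :=
  IsOpen V ∧ IsConnected V ∧ (∀ p ∈ V, 0 < p.2) ∧
    ∀ s ∈ Set.Ioo a b, ∃ ε > 0, Set.Ioo (s - ε) (s + ε) ×ˢ Set.Ioo (0 : ℝ) ε ⊆ V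

/-- A function `f` on `S` (typically `S = V ∪ J`) is `y`-flat: it vanishes on `J`,
and it tends to `0` together with each of its partial derivatives of every order,
as the second coordinate tends to `0`, uniformly on compact subsets of `(a,b)`. -/
def FlatOn (a b : ℝ) (S : Set (ℝ × ℝ)) (f : ℝ × ℝ → ℝ) : Prop :=
  (∀ s ∈ Set.Ioo a b, f (s, 0) = 0) ∧
  ∀ (n : ℕ) (K : Set ℝ), IsCompact K → K ⊆ Set.Ioo a b →
    ∀ ε > 0, ∃ δ > 0, ∀ p ∈ S, p.1 ∈ K → p.2 < δ →
      ‖iteratedFDerivWithin ℝ n f S p‖ < ε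

/-- A `C^∞`-lifted strongly billiard-like map `F` on `V ∪ J`, `J = (a,b) × {0}`,
with asymptotic coefficient `w`:
(i) `F` is a homeomorphism onto its image fixing the points of `J`;
(ii) `F|_V` is a `C^∞` diffeomorphism preserving the standard area form `ds ∧ dy`;
(iii) `F(s,y) = (s + w(s)√y + O(y), y + O(y^{3/2}))` as `y → 0`, uniformly on compact
subsets of `(a,b)`, with `w` continuous and positive;
(iv) in the coordinates `(s,z)`, `z = √y > 0`, the map `F` lifts to `F̃ = I ∘ β`,
where `I(s,z) = (s,−z)` and `β` is a `C^∞`-smooth involution on a neighborhood `N` of `J`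
fixing the points of `{z = 0}`, of the form `β(s,z) = (s + w(s)z + O(z²), −z + O(z²))`. -/
structure IsBilliardLike (a b : ℝ) (w : ℝ → ℝ) (V : Set (ℝ × ℝ))
    (F : ℝ × ℝ → ℝ × ℝ) : Prop where
  adj : IsAdjDomain a b V
  wCont : ContinuousOn w (Set.Ioo a b)
  wPos : ∀ s ∈ Set.Ioo a b, 0 < w s
  -- (i): homeomorphism onto the image, fixing the points of `J`
  fixJ : ∀ s ∈ Set.Ioo a b, F (s, 0) = (s, 0)
  mapsUpper : ∀ p ∈ V ∪ Jset a b, 0 ≤ (F p).2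
  contF : ContinuousOn F (V ∪ Jset a b)
  injF : Set.InjOn F (V ∪ Jset a b)
  contInv : ∃ G : ℝ × ℝ → ℝ × ℝ, ContinuousOn G (F '' (V ∪ Jset a b)) ∧
      ∀ p ∈ V ∪ Jset a b, G (F p) = p
  -- (ii): `F|_V` is a `C^∞` diffeomorphism preserving the area form
  smoothV : ContDiffOn ℝ (⊤ : ℕ∞) F V
  openImage : IsOpen (F '' V)
  smoothInv : ∃ G : ℝ × ℝ → ℝ × ℝ, ContDiffOn ℝ (⊤ : ℕ∞) G (F '' V) ∧
      ∀ p ∈ V, G (F p) = p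
  areaPres : ∀ p ∈ V, (fderiv ℝ F p).det = 1
  -- (iii): asymptotics `F(s,y) = (s + w(s)√y + O(y), y + O(y^{3/2}))`
  asymp : ∀ K : Set ℝ, IsCompact K → K ⊆ Set.Ioo a b →
      ∃ C > 0, ∃ δ > 0, ∀ p ∈ V, p.1 ∈ K → p.2 < δ →
        |(F p).1 - p.1 - w p.1 * Real.sqrt p.2| ≤ C * p.2 ∧
        |(F p).2 - p.2| ≤ C * p.2 ^ ((3:ℝ)/2)
  -- (iv): `C^∞`-smooth lifting `F̃ = I ∘ β` in the coordinates `(s, z)`, `z = √y`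
  lifted : ∃ N : Set (ℝ × ℝ), IsOpen N ∧ Jset a b ⊆ N ∧
      ∃ β : ℝ × ℝ → ℝ × ℝ, ContDiffOn ℝ (⊤ : ℕ∞) β N ∧
        (∀ p ∈ N, β p ∈ N ∧ β (β p) = p) ∧
        (∀ s ∈ Set.Ioo a b, β (s, 0) = (s, 0)) ∧
        (∀ K : Set ℝ, IsCompact K → K ⊆ Set.Ioo a b →
          ∃ C > 0, ∃ δ > 0, ∀ p ∈ N, p.1 ∈ K → |p.2| < δ →
            |(β p).1 - p.1 - w p.1 * p.2| ≤ C * p.2 ^ 2 ∧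
            |(β p).2 + p.2| ≤ C * p.2 ^ 2) ∧
        (∀ p ∈ N, 0 < p.2 → (p.1, p.2 ^ 2) ∈ V →
          (F (p.1, p.2 ^ 2)).1 = (β p).1 ∧
          Real.sqrt (F (p.1, p.2 ^ 2)).2 = -(β p).2)

section NormalFormConstruction

open Filter Topology Metric

/-- Infinite differentiability on a set. -/
abbrev SmoothOn {E G : Type*} [NormedAddCommGroup E] [NormedSpace ℝ E]
    [NormedAddCommGroup G] [NormedSpace ℝ G] (f : E → G) (s : Set E) : Prop :=
  ContDiffOn ℝ (⊤ : ℕ∞) f s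

theorem isOpen_forall_compact {X Y : Type*} [TopologicalSpace X] [TopologicalSpace Y]
    {K : Set Y} (hK : IsCompact K) {Ω : Set (X × Y)} (hΩ : IsOpen Ω) :
    IsOpen {x : X | ∀ t ∈ K, (x, t) ∈ Ω} := by
  rw [isOpen_iff_mem_nhds]
  intro x hx
  refine hK.eventually_forall_of_forall_eventually fun t ht => ?_
  exact hΩ.mem_nhds (hx t ht)

section ParametricIntegral

variable {E : Type} [NormedAddCommGroup E] [NormedSpace ℝ E] [ProperSpace E]

theorem hasFDerivAt_integral_unitInterval {G : Type} [NormedAddCommGroup G] [NormedSpace ℝ G]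
    {g : E × ℝ → G} {Ω : Set (E × ℝ)} (hΩ : IsOpen Ω) (hg : SmoothOn g Ω) {x₀ : E}
    (hx₀ : ∀ t ∈ Icc (0 : ℝ) 1, (x₀, t) ∈ Ω) :
    HasFDerivAt (fun x => ∫ t in (0 : ℝ)..1, g (x, t))
      (∫ t in (0 : ℝ)..1, (fderiv ℝ g (x₀, t)).comp (ContinuousLinearMap.inl ℝ E ℝ)) x₀ := by
  have hO : IsOpen {x : E | ∀ t ∈ Icc (0 : ℝ) 1, (x, t) ∈ Ω} := isOpen_forall_compact isCompact_Icc hΩ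
  obtain ⟨δ, hδ, hball⟩ := Metric.nhds_basis_closedBall.mem_iff.1 (hO.mem_nhds hx₀)
  have hsub : Metric.closedBall x₀ δ ×ˢ Icc (0 : ℝ) 1 ⊆ Ω := by
    rintro ⟨x, t⟩ ⟨hx, ht⟩
    exact hball hx t ht
  have hcomp : IsCompact (Metric.closedBall x₀ δ ×ˢ Icc (0 : ℝ) 1) :=
    (isCompact_closedBall x₀ δ).prod isCompact_Icc
  have hd : ContinuousOn (fun p => (fderiv ℝ g p).comp (ContinuousLinearMap.inl ℝ E ℝ)) Ω := by
    have := hg.continuousOn_fderiv_of_isOpen hΩ (by simp)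
    exact this.clm_comp continuousOn_const
  obtain ⟨C, hC⟩ := hcomp.exists_bound_of_continuousOn (hd.mono hsub)
  have h01 : Set.uIoc (0 : ℝ) 1 = Ioc 0 1 := Set.uIoc_of_le zero_le_one
  have hcont : ∀ x ∈ Metric.closedBall x₀ δ, ContinuousOn (fun t : ℝ => g (x, t)) (Icc 0 1) := by
    intro x hx
    exact hg.continuousOn.comp (by fun_prop) (fun t ht => hsub ⟨hx, ht⟩)
  refine intervalIntegral.hasFDerivAt_integral_of_dominated_of_fderiv_le
    (F := fun x t => g (x, t))
    (F' := fun x t => (fderiv ℝ g (x, t)).comp (ContinuousLinearMap.inl ℝ E ℝ))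
    (s := Metric.closedBall x₀ δ) (bound := fun _ => C)
    (Metric.closedBall_mem_nhds x₀ hδ) ?_ ?_ ?_ ?_ ?_ ?_
  · filter_upwards [Metric.closedBall_mem_nhds x₀ hδ] with x hx
    rw [h01]
    exact ((hcont x hx).mono Ioc_subset_Icc_self).aestronglyMeasurable measurableSet_Ioc
  · exact (hcont x₀ (Metric.mem_closedBall_self hδ.le)).intervalIntegrable_of_Icc zero_le_one
  · rw [h01]
    refine ContinuousOn.aestronglyMeasurable ?_ measurableSet_Ioc
    exact hd.comp (by fun_prop) (fun t ht => hx₀ t (Ioc_subset_Icc_self ht))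
  · refine Filter.Eventually.of_forall fun t ht x hx => ?_
    rw [h01] at ht
    exact hC (x, t) ⟨hx, Ioc_subset_Icc_self ht⟩
  · exact intervalIntegrable_const
  · refine Filter.Eventually.of_forall fun t ht x hx => ?_
    rw [h01] at ht
    have hp : (x, t) ∈ Ω := hsub ⟨hx, Ioc_subset_Icc_self ht⟩
    have h1 : HasFDerivAt g (fderiv ℝ g (x, t)) (x, t) :=
      ((hg.contDiffAt (hΩ.mem_nhds hp)).differentiableAt (by simp)).hasFDerivAt
    exact h1.comp x (hasFDerivAt_prodMk_left x t)

theorem contDiffOn_integral_unitInterval (n : ℕ) : ∀ {G : Type} [NormedAddCommGroup G]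
    [NormedSpace ℝ G] {g : E × ℝ → G} {Ω : Set (E × ℝ)}, IsOpen Ω → SmoothOn g Ω →
    ∀ {O : Set E}, IsOpen O → (∀ x ∈ O, ∀ t ∈ Icc (0 : ℝ) 1, (x, t) ∈ Ω) →
    ContDiffOn ℝ n (fun x => ∫ t in (0 : ℝ)..1, g (x, t)) O := by
  induction n with
  | zero =>
    intro G _ _ g Ω hΩ hg O hO hOΩ
    rw [Nat.cast_zero, contDiffOn_zero]
    exact fun x hx => (hasFDerivAt_integral_unitInterval hΩ hg
      (hOΩ x hx)).continuousAt.continuousWithinAt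
  | succ n ih =>
    intro G _ _ g Ω hΩ hg O hO hOΩ
    have hd : ∀ x ∈ O, _ := fun x hx => hasFDerivAt_integral_unitInterval hΩ hg (hOΩ x hx)
    rw [Nat.cast_succ, contDiffOn_succ_iff_fderiv_of_isOpen hO]
    refine ⟨fun x hx => (hd x hx).differentiableAt.differentiableWithinAt, by simp, ?_⟩
    have hg' : SmoothOn (fun p => (fderiv ℝ g p).comp (ContinuousLinearMap.inl ℝ E ℝ)) Ω :=
      (hg.fderiv_of_isOpen hΩ (by simp)).clm_comp contDiffOn_const
    exact (ih hΩ hg' hO hOΩ).congr fun x hx => (hd x hx).fderiv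

theorem smoothOn_integral_unitInterval {G : Type} [NormedAddCommGroup G] [NormedSpace ℝ G]
    {g : E × ℝ → G} {Ω : Set (E × ℝ)} (hΩ : IsOpen Ω) (hg : SmoothOn g Ω) {O : Set E}
    (hO : IsOpen O) (hOΩ : ∀ x ∈ O, ∀ t ∈ Icc (0 : ℝ) 1, (x, t) ∈ Ω) :
    SmoothOn (fun x => ∫ t in (0 : ℝ)..1, g (x, t)) O :=
  contDiffOn_infty.2 fun n => contDiffOn_integral_unitInterval n hΩ hg hO hOΩ

end ParametricIntegral

section BoxHull

/-- The largest subset of `O` that is stable under `(x, z) ↦ (x₀ + t (x - x₀), r z)` for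
`t ∈ [0, 1]` and `r ∈ [-1, 1]`. -/
def boxHull (x₀ : ℝ) (O : Set (ℝ × ℝ)) : Set (ℝ × ℝ) :=
  {p | ∀ q ∈ Icc (0 : ℝ) 1 ×ˢ Icc (-1 : ℝ) 1, (x₀ + q.1 * (p.1 - x₀), q.2 * p.2) ∈ O}

/-- Stability under the maps `(x, z) ↦ (x₀ + t (x - x₀), r z)`, `t ∈ [0, 1]`, `r ∈ [-1, 1]`. -/
def BoxStar (x₀ : ℝ) (D : Set (ℝ × ℝ)) : Prop :=
  ∀ p ∈ D, ∀ t ∈ Icc (0 : ℝ) 1, ∀ r ∈ Icc (-1 : ℝ) 1, (x₀ + t * (p.1 - x₀), r * p.2) ∈ D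

theorem isOpen_boxHull (x₀ : ℝ) {O : Set (ℝ × ℝ)} (hO : IsOpen O) : IsOpen (boxHull x₀ O) := by
  have := isOpen_forall_compact (X := ℝ × ℝ) (K := Icc (0 : ℝ) 1 ×ˢ Icc (-1 : ℝ) 1)
    (isCompact_Icc.prod isCompact_Icc)
    (Ω := (fun x : (ℝ × ℝ) × (ℝ × ℝ) => (x₀ + x.2.1 * (x.1.1 - x₀), x.2.2 * x.1.2)) ⁻¹' O)
    (hO.preimage (by fun_prop))
  exact this

theorem boxHull_subset (x₀ : ℝ) (O : Set (ℝ × ℝ)) : boxHull x₀ O ⊆ O := by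
  intro p hp
  have := hp (1, 1) (by simp)
  simpa using this

theorem boxStar_boxHull (x₀ : ℝ) (O : Set (ℝ × ℝ)) : BoxStar x₀ (boxHull x₀ O) := by
  rintro p hp t ⟨ht0, ht1⟩ r ⟨hr0, hr1⟩ ⟨t', r'⟩ ⟨⟨ht0', ht1'⟩, ⟨hr0', hr1'⟩⟩
  have := hp (t' * t, r' * r) ⟨⟨by positivity, by nlinarith⟩, by
    rw [mem_Icc, ← abs_le, abs_mul]
    have h1 : |r'| ≤ 1 := abs_le.2 ⟨hr0', hr1'⟩
    have h2 : |r| ≤ 1 := abs_le.2 ⟨hr0, hr1⟩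
    exact mul_le_one₀ h1 (abs_nonneg _) h2⟩
  simp only at this ⊢
  convert this using 2 <;> ring

theorem mem_boxHull_of_axis {x₀ x : ℝ} {O : Set (ℝ × ℝ)}
    (h : ∀ t ∈ Icc (0 : ℝ) 1, (x₀ + t * (x - x₀), (0 : ℝ)) ∈ O) : (x, (0 : ℝ)) ∈ boxHull x₀ O := by
  rintro ⟨t, r⟩ ⟨ht, -⟩
  simpa using h t ht

theorem convexCombination_mem_Ioo {a b x₀ x t : ℝ} (hx₀ : x₀ ∈ Ioo a b) (hx : x ∈ Ioo a b)
    (ht : t ∈ Icc (0 : ℝ) 1) : x₀ + t * (x - x₀) ∈ Ioo a b := by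
  have := (convex_Ioo a b).add_smul_sub_mem hx₀ hx ht
  simpa using this

theorem mem_Jset {a b s : ℝ} (hs : s ∈ Ioo a b) : (s, (0 : ℝ)) ∈ Jset a b := ⟨hs, rfl⟩

theorem Jset_subset_boxHull {a b x₀ : ℝ} (hx₀ : x₀ ∈ Ioo a b) {O : Set (ℝ × ℝ)}
    (hO : Jset a b ⊆ O) : Jset a b ⊆ boxHull x₀ O := by
  rintro ⟨s, z⟩ ⟨hs, hz⟩
  obtain rfl : z = 0 := hz
  exact mem_boxHull_of_axis fun t ht => hO (mem_Jset (convexCombination_mem_Ioo hx₀ hs ht))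

theorem BoxStar.scale {x₀ : ℝ} {D : Set (ℝ × ℝ)} (h : BoxStar x₀ D) {p : ℝ × ℝ} (hp : p ∈ D)
    {r : ℝ} (hr : r ∈ Icc (-1 : ℝ) 1) : (p.1, r * p.2) ∈ D := by
  have := h p hp 1 (by simp) r hr
  simpa using this

theorem BoxStar.neg {x₀ : ℝ} {D : Set (ℝ × ℝ)} (h : BoxStar x₀ D) {p : ℝ × ℝ} (hp : p ∈ D) :
    (p.1, -p.2) ∈ D := by
  simpa using h.scale hp (r := -1) (by simp)

end BoxHull

section Division

variable {G : Type} [NormedAddCommGroup G] [NormedSpace ℝ G]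

theorem SmoothOn.differentiableAt' {E H : Type*} [NormedAddCommGroup E] [NormedSpace ℝ E]
    [NormedAddCommGroup H] [NormedSpace ℝ H] {f : E → H} {D : Set E} (hf : SmoothOn f D)
    (hD : IsOpen D) {p : E} (hp : p ∈ D) : DifferentiableAt ℝ f p :=
  (hf.contDiffAt (hD.mem_nhds hp)).differentiableAt (by simp)

/-- Hadamard's lemma: division by the second coordinate. -/
theorem exists_smooth_quotient [CompleteSpace G] {f : ℝ × ℝ → G} {D : Set (ℝ × ℝ)} (hD : IsOpen D)
    (hstar : ∀ p ∈ D, ∀ t ∈ Icc (0 : ℝ) 1, (p.1, t * p.2) ∈ D) (hf : SmoothOn f D) :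
    ∃ g : ℝ × ℝ → G, SmoothOn g D ∧ (∀ p ∈ D, f p = f (p.1, 0) + p.2 • g p) ∧
      ∀ p ∈ D, g (p.1, 0) = fderiv ℝ f (p.1, 0) (0, 1) := by
  refine ⟨fun p => ∫ t in (0 : ℝ)..1, fderiv ℝ f (p.1, t * p.2) (0, 1), ?_, ?_, ?_⟩
  · refine smoothOn_integral_unitInterval
      (g := fun x : (ℝ × ℝ) × ℝ => fderiv ℝ f (x.1.1, x.2 * x.1.2) (0, 1))
      (Ω := (fun x : (ℝ × ℝ) × ℝ => (x.1.1, x.2 * x.1.2)) ⁻¹' D)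
      (hD.preimage (by fun_prop)) ?_ hD hstar
    have h1 : SmoothOn (fun p => fderiv ℝ f p (0, 1)) D :=
      (hf.fderiv_of_isOpen hD (by simp)).clm_apply contDiffOn_const
    exact h1.comp (t := D) (f := fun x : (ℝ × ℝ) × ℝ => (x.1.1, x.2 * x.1.2))
      (ContDiff.contDiffOn (by fun_prop)) (fun x hx => hx)
  · intro p hp
    have hderiv : ∀ t ∈ uIcc (0 : ℝ) 1, HasDerivAt (fun t : ℝ => f (p.1, t * p.2))
        (p.2 • fderiv ℝ f (p.1, t * p.2) (0, 1)) t := by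
      intro t ht
      rw [uIcc_of_le zero_le_one] at ht
      have h1 := (hf.differentiableAt' hD (hstar p hp t ht)).hasFDerivAt
      have h2 : HasDerivAt (fun t : ℝ => (p.1, t * p.2)) (0, p.2) t := by
        have := (hasDerivAt_const t p.1).prodMk ((hasDerivAt_id t).mul_const p.2)
        simpa using this
      have h3 := h1.comp_hasDerivAt t h2
      have h4 : p.2 • fderiv ℝ f (p.1, t * p.2) (0, 1) = fderiv ℝ f (p.1, t * p.2) (0, p.2) := by
        rw [← map_smul]
        simp
      rw [h4]
      exact h3
    have hcont : ContinuousOn (fun t : ℝ => p.2 • fderiv ℝ f (p.1, t * p.2) (0, 1))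
        (uIcc (0 : ℝ) 1) := by
      have h1 : ContinuousOn (fun p => fderiv ℝ f p (0, 1)) D :=
        (hf.continuousOn_fderiv_of_isOpen hD (by simp)).clm_apply continuousOn_const
      refine ContinuousOn.const_smul (h1.comp (f := fun t : ℝ => (p.1, t * p.2)) (by fun_prop) ?_) _
      intro t ht
      rw [uIcc_of_le zero_le_one] at ht
      exact hstar p hp t ht
    have := intervalIntegral.integral_eq_sub_of_hasDerivAt hderiv hcont.intervalIntegrable
    rw [intervalIntegral.integral_smul] at this
    rw [this]
    simp
  · intro p hp
    simp

/-- Invariance under reflection of the second coordinate. -/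
def EvenOn (f : ℝ × ℝ → G) (D : Set (ℝ × ℝ)) : Prop := ∀ p ∈ D, f (p.1, -p.2) = f p

theorem EvenOn.fderiv_neg {f : ℝ × ℝ → G} {D : Set (ℝ × ℝ)} (hD : IsOpen D)
    (hneg : ∀ p ∈ D, (p.1, -p.2) ∈ D) (hf : SmoothOn f D) (he : EvenOn f D) {p : ℝ × ℝ}
    (hp : p ∈ D) (v : ℝ × ℝ) : fderiv ℝ f (p.1, -p.2) v = fderiv ℝ f p (v.1, -v.2) := by
  have h1 := (hf.differentiableAt' hD (hneg p hp)).hasFDerivAt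
  have h2 : HasFDerivAt (fun q : ℝ × ℝ => (q.1, -q.2))
      ((ContinuousLinearMap.fst ℝ ℝ ℝ).prod (-ContinuousLinearMap.snd ℝ ℝ ℝ)) p :=
    hasFDerivAt_fst.prodMk hasFDerivAt_snd.neg
  have h3 := h1.comp p h2
  have h4 : f =ᶠ[𝓝 p] f ∘ fun q : ℝ × ℝ => (q.1, -q.2) := by
    filter_upwards [hD.mem_nhds hp] with q hq
    exact (he q hq).symm
  rw [(h3.congr_of_eventuallyEq h4).fderiv]
  simp

theorem EvenOn.fderiv_axis {f : ℝ × ℝ → G} {D : Set (ℝ × ℝ)} (hD : IsOpen D)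
    (hneg : ∀ p ∈ D, (p.1, -p.2) ∈ D) (hf : SmoothOn f D) (he : EvenOn f D) {s : ℝ}
    (hp : (s, (0 : ℝ)) ∈ D) : fderiv ℝ f (s, 0) (0, 1) = 0 := by
  have h := he.fderiv_neg hD hneg hf hp (0, 1)
  have h' : ((0 : ℝ), (-1 : ℝ)) = -(0, 1) := by simp
  simp only [neg_zero, h', map_neg] at h
  have h2 : (2 : ℝ) • fderiv ℝ f (s, 0) (0, 1) = 0 := by
    rw [two_smul]
    nth_rewrite 2 [h]
    simp
  simpa using h2

theorem EvenOn.exists_quotient [CompleteSpace G] {f : ℝ × ℝ → G} {D : Set (ℝ × ℝ)} (hD : IsOpen D)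
    (hstar : ∀ p ∈ D, ∀ r ∈ Icc (-1 : ℝ) 1, (p.1, r * p.2) ∈ D) (hf : SmoothOn f D)
    (he : EvenOn f D) :
    ∃ m : ℝ × ℝ → G, SmoothOn m D ∧ EvenOn m D ∧
      ∀ p ∈ D, f p = f (p.1, 0) + (p.2 ^ 2) • m p := by
  have hstar' : ∀ p ∈ D, ∀ t ∈ Icc (0 : ℝ) 1, (p.1, t * p.2) ∈ D := fun p hp t ht =>
    hstar p hp t ⟨by linarith [ht.1], ht.2⟩
  have hneg : ∀ p ∈ D, (p.1, -p.2) ∈ D := fun p hp => by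
    simpa using hstar p hp (-1) (by simp)
  have haxis : ∀ p ∈ D, (p.1, (0 : ℝ)) ∈ D := fun p hp => by
    simpa using hstar p hp 0 (by simp)
  obtain ⟨g, hg, hfg, hg0⟩ := exists_smooth_quotient hD hstar' hf
  obtain ⟨m, hm, hgm, -⟩ := exists_smooth_quotient hD hstar' hg
  have key : ∀ p ∈ D, f p = f (p.1, 0) + (p.2 ^ 2) • m p := by
    intro p hp
    rw [hfg p hp, hgm p hp, hg0 p hp, he.fderiv_axis hD hneg hf (haxis p hp), zero_add, smul_smul,
      sq]
  refine ⟨m, hm, ?_, key⟩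
  intro p hp
  by_cases h0 : p.2 = 0
  · simp only [h0, neg_zero]
    rw [← h0]
  · have h1 := key p hp
    have h2 := key _ (hneg p hp)
    rw [he p hp, h1] at h2
    simp only [neg_sq, add_right_inj] at h2
    exact (smul_right_injective G (pow_ne_zero 2 h0) h2).symm

theorem hasFDerivWithinAt_snd_smul {k : ℝ × ℝ → G} {T : Set (ℝ × ℝ)} {s : ℝ}
    (hk : ContinuousWithinAt k T (s, 0)) :
    HasFDerivWithinAt (fun q => q.2 • k q)
      ((ContinuousLinearMap.snd ℝ ℝ ℝ).smulRight (k (s, 0))) T (s, 0) := by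
  refine HasFDerivWithinAt.of_isLittleO ?_
  have h1 : (fun q : ℝ × ℝ => q.2) =O[𝓝[T] (s, 0)] fun q => q - (s, 0) :=
    Asymptotics.IsBigO.of_bound 1 (Eventually.of_forall fun q => by
      simpa using norm_snd_le (q - (s, (0 : ℝ))))
  have h2 : (fun q => k q - k (s, 0)) =o[𝓝[T] (s, 0)] fun _ => (1 : ℝ) := by
    rw [Asymptotics.isLittleO_one_iff]
    exact tendsto_sub_nhds_zero_iff.2 hk
  have h3 := h1.norm_right.smul_isLittleO h2
  refine (h3.congr_left (f₂ := fun q => q.2 • k q - (s, (0 : ℝ)).2 • k (s, 0) -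
    ((ContinuousLinearMap.snd ℝ ℝ ℝ).smulRight (k (s, 0))) (q - (s, 0))) fun q => ?_).trans_isBigO ?_
  · simp [smul_sub]
  · refine Asymptotics.IsBigO.of_bound 1 (Eventually.of_forall fun q => ?_)
    simp

theorem EvenOn.contDiffOn_comp_sqrt (n : ℕ) : ∀ {G : Type} [NormedAddCommGroup G] [NormedSpace ℝ G]
    [CompleteSpace G] {f : ℝ × ℝ → G} {D : Set (ℝ × ℝ)}, IsOpen D →
    (∀ p ∈ D, ∀ r ∈ Icc (-1 : ℝ) 1, (p.1, r * p.2) ∈ D) → SmoothOn f D → EvenOn f D →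
    ContDiffOn ℝ n (fun p => f (p.1, √p.2)) {p : ℝ × ℝ | 0 ≤ p.2 ∧ (p.1, √p.2) ∈ D} := by
  induction n with
  | zero =>
    intro G _ _ _ f D hD hstar hf he
    rw [Nat.cast_zero, contDiffOn_zero]
    exact hf.continuousOn.comp (by fun_prop) fun p hp => hp.2
  | succ n ih =>
    intro G _ _ _ f D hD hstar hf he
    have hneg : ∀ p ∈ D, (p.1, -p.2) ∈ D := fun p hp => by
      simpa using hstar p hp (-1) (by simp)
    have haxis : ∀ p ∈ D, (p.1, (0 : ℝ)) ∈ D := fun p hp => by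
      simpa using hstar p hp 0 (by simp)
    obtain ⟨m, hm, hme, hfm⟩ := he.exists_quotient hD hstar hf
    set Φ : ℝ × ℝ → (ℝ × ℝ →L[ℝ] G) := fun p =>
      (ContinuousLinearMap.fst ℝ ℝ ℝ).smulRight (fderiv ℝ f p (1, 0)) +
      (ContinuousLinearMap.snd ℝ ℝ ℝ).smulRight (m p + (p.2 / 2) • fderiv ℝ m p (0, 1)) with hΦ
    have hΦs : SmoothOn Φ D := by
      have h1 : SmoothOn (fun p => fderiv ℝ f p (1, 0)) D :=
        (hf.fderiv_of_isOpen hD (by simp)).clm_apply contDiffOn_const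
      have h2 : SmoothOn (fun p => fderiv ℝ m p (0, 1)) D :=
        (hm.fderiv_of_isOpen hD (by simp)).clm_apply contDiffOn_const
      have h3 : SmoothOn (fun p : ℝ × ℝ => p.2 / 2) D := ContDiff.contDiffOn (by fun_prop)
      exact (contDiffOn_const.smulRight h1).add (contDiffOn_const.smulRight (hm.add (h3.smul h2)))
    have hΦe : EvenOn Φ D := by
      intro p hp
      simp only [hΦ]
      rw [he.fderiv_neg hD hneg hf hp, hme.fderiv_neg hD hneg hm hp, hme p hp]
      have h' : ((0 : ℝ), (-1 : ℝ)) = -(0, 1) := by simp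
      simp only [neg_zero, h', map_neg, smul_neg, neg_div, neg_smul, neg_neg]
    rw [Nat.cast_succ, contDiffOn_succ_iff_hasFDerivWithinAt (by exact_mod_cast ENat.natCast_ne_top n)]
    intro p hp
    refine ⟨_, by rw [insert_eq_of_mem hp]; exact self_mem_nhdsWithin,
      by simp, fun p => Φ (p.1, √p.2), ?_, ih hD hstar hΦs hΦe⟩
    clear p hp
    rintro ⟨s, y⟩ ⟨hy, hsy⟩
    simp only at hy hsy ⊢
    rcases hy.eq_or_lt with rfl | hy
    · simp only [Real.sqrt_zero] at hsy ⊢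
      have h1 : HasFDerivAt (fun q : ℝ × ℝ => f (q.1, 0))
          ((ContinuousLinearMap.fst ℝ ℝ ℝ).smulRight (fderiv ℝ f (s, 0) (1, 0))) (s, 0) := by
        have h1 := (hf.differentiableAt' hD hsy).hasFDerivAt
        have h2 : HasFDerivAt (fun q : ℝ × ℝ => (q.1, (0 : ℝ)))
            ((ContinuousLinearMap.fst ℝ ℝ ℝ).prod 0) (s, 0) :=
          hasFDerivAt_fst.prodMk (hasFDerivAt_const _ _)
        refine (h1.comp (s, (0 : ℝ)) h2).congr_fderiv ?_
        have h0 : fderiv ℝ f (s, 0) (0, 0) = 0 := map_zero _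
        ext <;> simp [h0]
      have h2 : ContinuousWithinAt (fun p : ℝ × ℝ => m (p.1, √p.2))
          {p : ℝ × ℝ | 0 ≤ p.2 ∧ (p.1, √p.2) ∈ D} (s, 0) := by
        have : ContinuousOn (fun p : ℝ × ℝ => m (p.1, √p.2)) {p : ℝ × ℝ | 0 ≤ p.2 ∧ (p.1, √p.2) ∈ D} :=
          hm.continuousOn.comp (by fun_prop) fun p hp => hp.2
        exact this _ ⟨le_rfl, by simpa using hsy⟩
      have h3 := h1.hasFDerivWithinAt.add (hasFDerivWithinAt_snd_smul h2)
      simp only [Real.sqrt_zero] at h3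
      have h4 := HasFDerivWithinAt.congr' (f₁ := fun p : ℝ × ℝ => f (p.1, √p.2)) h3 (by
        rintro q ⟨hq, hqD⟩
        simp [hfm _ hqD, Real.sq_sqrt hq]) ⟨le_rfl, by simpa using hsy⟩
      refine h4.congr_fderiv ?_
      simp [hΦ]
    · have hz : 0 < √y := Real.sqrt_pos.2 hy
      have h1 := (hf.differentiableAt' hD hsy).hasFDerivAt
      have h2 : HasFDerivAt (fun q : ℝ × ℝ => (q.1, √q.2))
          ((ContinuousLinearMap.fst ℝ ℝ ℝ).prod
            ((1 / (2 * √y)) • ContinuousLinearMap.snd ℝ ℝ ℝ)) (s, y) :=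
        hasFDerivAt_fst.prodMk ((hasFDerivAt_snd (p := (s, y))).sqrt hy.ne')
      have h3 := (h1.comp (s, y) h2).hasFDerivWithinAt (s := {p : ℝ × ℝ | 0 ≤ p.2 ∧ (p.1, √p.2) ∈ D})
      refine h3.congr_fderiv ?_
      have hfz : fderiv ℝ f (s, √y) (0, 1) =
          (2 * √y) • m (s, √y) + (√y ^ 2) • fderiv ℝ m (s, √y) (0, 1) := by
        have e1 : HasDerivAt (fun z : ℝ => (s, z)) (0, 1) (√y) :=
          (hasDerivAt_const _ _).prodMk (hasDerivAt_id _)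
        have e2 := h1.comp_hasDerivAt (√y) e1
        have e3 := ((hm.differentiableAt' hD hsy).hasFDerivAt).comp_hasDerivAt (√y) e1
        have e4 := ((hasDerivAt_pow 2 (√y)).smul e3).const_add (f (s, 0))
        have e5 : (f ∘ fun z : ℝ => (s, z)) =ᶠ[𝓝 (√y)]
            fun z => f (s, 0) + (z ^ 2) • (m ∘ fun z : ℝ => (s, z)) z := by
          have : ∀ᶠ z in 𝓝 (√y), (s, z) ∈ D :=
            (Continuous.continuousAt (by fun_prop : Continuous fun z : ℝ => (s, z))).preimage_mem_nhds
              (hD.mem_nhds hsy)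
          filter_upwards [this] with z hz
          exact hfm _ hz
        have := e2.unique (e4.congr_of_eventuallyEq e5)
        rw [this]
        simp [add_comm]
      have key : (1 / (2 * √y)) • fderiv ℝ f (s, √y) (0, 1) =
          m (s, √y) + (√y / 2) • fderiv ℝ m (s, √y) (0, 1) := by
        rw [hfz, smul_add, smul_smul, smul_smul]
        congr 1
        · rw [one_div_mul_cancel (by positivity), one_smul]
        · congr 1
          field_simp
      ext
      · simp [hΦ]
      · have h5 : fderiv ℝ f (s, √y) (0, (√y)⁻¹ * 2⁻¹) =
            ((√y)⁻¹ * 2⁻¹) • fderiv ℝ f (s, √y) (0, 1) := by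
          rw [← map_smul]
          simp
        simp only [hΦ]
        simp [← key, h5]

/-- A smooth even function of `(s, z)` is a smooth function of `(s, z ^ 2)`. -/
theorem EvenOn.smoothOn_comp_sqrt [CompleteSpace G] {f : ℝ × ℝ → G} {D : Set (ℝ × ℝ)}
    (hD : IsOpen D) (hf : SmoothOn f D) (he : EvenOn f D) :
    SmoothOn (fun p => f (p.1, √p.2)) {p : ℝ × ℝ | 0 ≤ p.2 ∧ (p.1, √p.2) ∈ D} := by
  rintro ⟨s, y⟩ ⟨hy, hsy⟩
  simp only at hy hsy
  rcases hy.eq_or_lt with rfl | hy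
  · rw [Real.sqrt_zero] at hsy
    obtain ⟨δ, hδ, hball⟩ := Metric.isOpen_iff.1 hD _ hsy
    have hbD : ball (s, (0 : ℝ)) δ ⊆ D := hball
    have hstar : ∀ p ∈ ball (s, (0 : ℝ)) δ, ∀ r ∈ Icc (-1 : ℝ) 1,
        (p.1, r * p.2) ∈ ball (s, (0 : ℝ)) δ := by
      rintro ⟨x, z⟩ hp r hr
      rw [mem_ball, Prod.dist_eq, max_lt_iff] at hp ⊢
      refine ⟨hp.1, ?_⟩
      have h1 : |r| ≤ 1 := abs_le.2 hr
      have h2 : |z| < δ := by simpa using hp.2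
      have h3 : |r * z| ≤ |z| := by
        rw [abs_mul]
        exact mul_le_of_le_one_left (abs_nonneg _) h1
      simpa using h3.trans_lt h2
    have h1 : SmoothOn (fun p => f (p.1, √p.2))
        {p : ℝ × ℝ | 0 ≤ p.2 ∧ (p.1, √p.2) ∈ ball (s, (0 : ℝ)) δ} :=
      contDiffOn_infty.2 fun n => EvenOn.contDiffOn_comp_sqrt n isOpen_ball hstar (hf.mono hbD)
        fun p hp => he p (hbD hp)
    refine (h1 (s, 0) ⟨le_rfl, by simpa using hδ⟩).mono_of_mem_nhdsWithin ?_
    have hc : ∀ᶠ p in 𝓝 (s, (0 : ℝ)), (p.1, √p.2) ∈ ball (s, (0 : ℝ)) δ := by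
      have : Continuous fun p : ℝ × ℝ => (p.1, √p.2) := by fun_prop
      refine this.continuousAt.preimage_mem_nhds (isOpen_ball.mem_nhds ?_)
      simpa using hδ
    filter_upwards [self_mem_nhdsWithin, nhdsWithin_le_nhds hc] with p hp hp'
    exact ⟨hp.1, hp'⟩
  · have h1 : ContDiffAt ℝ (⊤ : ℕ∞) f (s, √y) := hf.contDiffAt (hD.mem_nhds hsy)
    have h2 : ContDiffAt ℝ (⊤ : ℕ∞) (fun p : ℝ × ℝ => (p.1, √p.2)) (s, y) :=
      contDiffAt_fst.prodMk (contDiffAt_snd.sqrt hy.ne')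
    exact (h1.comp (s, y) h2).contDiffWithinAt

end Division

section JetNorm

variable {E G H L : Type} [NormedAddCommGroup E] [NormedSpace ℝ E] [NormedAddCommGroup G]
  [NormedSpace ℝ G] [NormedAddCommGroup H] [NormedSpace ℝ H] [NormedAddCommGroup L]
  [NormedSpace ℝ L]

/-- The sum of the norms of the derivatives of `f` at `p` of order at most `k`. -/
noncomputable def jetNorm (k : ℕ) (f : E → G) (p : E) : ℝ :=
  ∑ i ∈ Finset.range (k + 1), ‖iteratedFDeriv ℝ i f p‖

theorem jetNorm_nonneg (k : ℕ) (f : E → G) (p : E) : 0 ≤ jetNorm k f p :=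
  Finset.sum_nonneg fun _ _ => norm_nonneg _

theorem jetNorm_zero (f : E → G) (p : E) : jetNorm 0 f p = ‖f p‖ := by
  simp [jetNorm]

theorem jetNorm_succ (k : ℕ) (f : E → G) (p : E) :
    jetNorm (k + 1) f p = ‖f p‖ + jetNorm k (fderiv ℝ f) p := by
  rw [jetNorm, Finset.sum_range_succ', add_comm, jetNorm]
  simp [norm_iteratedFDeriv_fderiv]

theorem jetNorm_le_succ (k : ℕ) (f : E → G) (p : E) : jetNorm k f p ≤ jetNorm (k + 1) f p := by
  rw [jetNorm, jetNorm, Finset.sum_range_succ _ (k + 1)]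
  linarith [norm_nonneg (iteratedFDeriv ℝ (k + 1) f p)]

theorem norm_le_jetNorm (k : ℕ) (f : E → G) (p : E) : ‖f p‖ ≤ jetNorm k f p := by
  induction k with
  | zero => rw [jetNorm_zero]
  | succ k ih => exact ih.trans (jetNorm_le_succ k f p)

theorem norm_iteratedFDeriv_le_jetNorm {i k : ℕ} (h : i ≤ k) (f : E → G) (p : E) :
    ‖iteratedFDeriv ℝ i f p‖ ≤ jetNorm k f p :=
  Finset.single_le_sum (f := fun i => ‖iteratedFDeriv ℝ i f p‖) (fun _ _ => norm_nonneg _)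
    (Finset.mem_range.2 (Nat.lt_succ_of_le h))

theorem jetNorm_congr {f g : E → G} {p : E} (h : f =ᶠ[𝓝 p] g) (k : ℕ) :
    jetNorm k f p = jetNorm k g p :=
  Finset.sum_congr rfl fun i _ => by rw [(h.iteratedFDeriv ℝ i).eq_of_nhds]

theorem jetNorm_of_eventually_zero {f : E → G} {p : E} (h : ∀ᶠ q in 𝓝 p, f q = 0) (k : ℕ) :
    jetNorm k f p = 0 := by
  rw [jetNorm_congr (g := fun _ => 0) h k]
  refine Finset.sum_eq_zero fun i _ => ?_
  have := iteratedFDeriv_fun_zero (𝕜 := ℝ) (E := E) (F := G) (n := i)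
  simp [this]

theorem jetNorm_add_le {f g : E → G} {Ω : Set E} (hΩ : IsOpen Ω) (hf : SmoothOn f Ω)
    (hg : SmoothOn g Ω) {p : E} (hp : p ∈ Ω) (k : ℕ) :
    jetNorm k (fun q => f q + g q) p ≤ jetNorm k f p + jetNorm k g p := by
  rw [jetNorm, jetNorm, jetNorm, ← Finset.sum_add_distrib]
  refine Finset.sum_le_sum fun i _ => ?_
  have h1 := (hf.contDiffAt (hΩ.mem_nhds hp)).of_le (m := i) (by exact_mod_cast le_top)
  have h2 := (hg.contDiffAt (hΩ.mem_nhds hp)).of_le (m := i) (by exact_mod_cast le_top)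
  have := iteratedFDeriv_add_apply (𝕜 := ℝ) (i := i) h1 h2
  have e : (fun q => f q + g q) = f + g := rfl
  rw [e, this]
  exact norm_add_le _ _

theorem jetNorm_bilinear_le (B : G →L[ℝ] H →L[ℝ] L) (hB : ‖B‖ ≤ 1) {f : E → G} {g : E → H}
    {Ω : Set E} (hΩ : IsOpen Ω) (hf : SmoothOn f Ω) (hg : SmoothOn g Ω) {p : E} (hp : p ∈ Ω)
    (k : ℕ) :
    jetNorm k (fun q => B (f q) (g q)) p ≤ 2 ^ (k + 1) * (jetNorm k f p * jetNorm k g p) := by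
  have key : ∀ n ∈ Finset.range (k + 1), ‖iteratedFDeriv ℝ n (fun q => B (f q) (g q)) p‖ ≤
      2 ^ n * (jetNorm k f p * jetNorm k g p) := by
    intro n hn
    have hn' : n ≤ k := Nat.lt_succ_iff.1 (Finset.mem_range.1 hn)
    have h := B.norm_iteratedFDerivWithin_le_of_bilinear_of_le_one hf hg hΩ.uniqueDiffOn hp
      (n := n) (by exact_mod_cast le_top) hB
    simp only [iteratedFDerivWithin_of_isOpen _ hΩ hp] at h
    refine h.trans ?_
    have h2 : ((2 : ℝ) ^ n) = ∑ i ∈ Finset.range (n + 1), (n.choose i : ℝ) := by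
      exact_mod_cast (Nat.sum_range_choose n).symm
    rw [h2, Finset.sum_mul]
    refine Finset.sum_le_sum fun i hi => ?_
    have hi' : i ≤ n := Nat.lt_succ_iff.1 (Finset.mem_range.1 hi)
    rw [mul_assoc]
    gcongr
    · exact jetNorm_nonneg _ _ _
    · exact norm_iteratedFDeriv_le_jetNorm (hi'.trans hn') f p
    · exact norm_iteratedFDeriv_le_jetNorm ((Nat.sub_le _ _).trans hn') g p
  refine (Finset.sum_le_sum key).trans ?_
  rw [← Finset.sum_mul]
  refine mul_le_mul_of_nonneg_right ?_ (mul_nonneg (jetNorm_nonneg _ _ _) (jetNorm_nonneg _ _ _))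
  have := geom_sum_eq (x := (2 : ℝ)) (by norm_num) (k + 1)
  rw [this]
  norm_num

end JetNorm

section JetEstimates

theorem jetNorm_comp_le {E : Type} [NormedAddCommGroup E] [NormedSpace ℝ E] (k : ℕ) :
    ∃ c : ℝ, 0 ≤ c ∧ ∀ {G : Type} [NormedAddCommGroup G] [NormedSpace ℝ G] {Ω Ω' : Set E}
      {T v : E → E} {R : E → G}, IsOpen Ω → IsOpen Ω' → (∀ p ∈ Ω', T p ∈ Ω) →
      (∀ p ∈ Ω', T p = p + v p) → SmoothOn v Ω' → SmoothOn R Ω → ∀ {p : E}, p ∈ Ω' →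
      ∀ {δ : ℝ}, δ ≤ 1 → jetNorm k (fderiv ℝ v) p ≤ δ →
      jetNorm k (R ∘ T) p ≤ (1 + c * δ) * jetNorm k R (T p) := by
  induction k with
  | zero =>
    refine ⟨0, le_rfl, ?_⟩
    intro G _ _ Ω Ω' T v R _ _ _ _ _ _ p _ δ _ _
    simp [jetNorm_zero]
  | succ k ih =>
    obtain ⟨c, hc, ih⟩ := ih
    refine ⟨c + 2 ^ (k + 1) + c * 2 ^ (k + 1), by positivity, ?_⟩
    intro G _ _ Ω Ω' T v R hΩ hΩ' hT hTv hv hR p hp δ hδ1 hδ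
    have hδ0 : 0 ≤ δ := (jetNorm_nonneg _ _ _).trans hδ
    have hδk : jetNorm k (fderiv ℝ v) p ≤ δ := (jetNorm_le_succ k _ p).trans hδ
    have hDR : SmoothOn (fderiv ℝ R) Ω := hR.fderiv_of_isOpen hΩ (by simp)
    have hDv : SmoothOn (fderiv ℝ v) Ω' := hv.fderiv_of_isOpen hΩ' (by simp)
    have hTs : SmoothOn T Ω' := (contDiffOn_id.add hv).congr hTv
    have hDRT : SmoothOn (fderiv ℝ R ∘ T) Ω' := hDR.comp hTs hT
    have hfd : fderiv ℝ (R ∘ T) =ᶠ[𝓝 p] fun q => (fderiv ℝ R ∘ T) q +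
        ContinuousLinearMap.compL ℝ E E G ((fderiv ℝ R ∘ T) q) (fderiv ℝ v q) := by
      filter_upwards [hΩ'.mem_nhds hp] with q hq
      have h1 := (hR.differentiableAt' hΩ (hT q hq)).hasFDerivAt
      have h2 : HasFDerivAt T (ContinuousLinearMap.id ℝ E + fderiv ℝ v q) q := by
        have := (hasFDerivAt_id q).add (hv.differentiableAt' hΩ' hq).hasFDerivAt
        refine this.congr_of_eventuallyEq ?_
        filter_upwards [hΩ'.mem_nhds hq] with x hx
        exact hTv x hx
      rw [(h1.comp q h2).fderiv]
      simp [ContinuousLinearMap.comp_add]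
    rw [jetNorm_succ, jetNorm_succ, jetNorm_congr hfd]
    have h1 := ih hΩ hΩ' hT hTv hv hDR hp hδ1 hδk
    have hcomp : SmoothOn (fun q => ContinuousLinearMap.compL ℝ E E G ((fderiv ℝ R ∘ T) q)
        (fderiv ℝ v q)) Ω' := hDRT.clm_comp hDv
    have h2 := jetNorm_add_le hΩ' hDRT hcomp hp k
    have h3 := jetNorm_bilinear_le (ContinuousLinearMap.compL ℝ E E G)
      (ContinuousLinearMap.norm_compL_le ℝ E E G) hΩ' hDRT hDv hp k
    have hX := jetNorm_nonneg k (fderiv ℝ R) (T p)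
    have hY := jetNorm_nonneg k (fderiv ℝ R ∘ T) p
    have hR0 := norm_nonneg (R (T p))
    set X := jetNorm k (fderiv ℝ R) (T p)
    set Y := jetNorm k (fderiv ℝ R ∘ T) p
    set a : ℝ := 2 ^ (k + 1)
    have ha : 0 ≤ a := by positivity
    have h4 : a * (Y * jetNorm k (fderiv ℝ v) p) ≤ a * (Y * δ) := by gcongr
    have h5 : Y + a * (Y * δ) ≤ (1 + a * δ) * ((1 + c * δ) * X) := by
      have : Y + a * (Y * δ) = (1 + a * δ) * Y := by ring
      rw [this]
      gcongr
    have h6 : (1 + a * δ) * (1 + c * δ) ≤ 1 + (c + a + c * a) * δ := by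
      have : a * c * δ * δ ≤ a * c * δ * 1 := by gcongr
      nlinarith
    have h7 : (1 + a * δ) * ((1 + c * δ) * X) ≤ (1 + (c + a + c * a) * δ) * X := by
      rw [← mul_assoc]
      gcongr
    have h8 : ‖R (T p)‖ ≤ (1 + (c + a + c * a) * δ) * ‖R (T p)‖ := by
      have : 0 ≤ (c + a + c * a) * δ := by positivity
      nlinarith
    calc ‖(R ∘ T) p‖ + _ ≤ ‖R (T p)‖ + (Y + a * (Y * δ)) := by
          have : (R ∘ T) p = R (T p) := rfl
          rw [this]
          linarith
      _ ≤ _ := by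
          rw [mul_add]
          linarith

theorem exists_jetNorm_exp_smul_le (k : ℕ) : ∀ {G : Type} [NormedAddCommGroup G] [NormedSpace ℝ G]
    {f : ℝ × ℝ → G} {D : Set (ℝ × ℝ)}, IsOpen D → SmoothOn f D → ∀ {K : Set ℝ} {z₀ : ℝ},
    IsCompact K → K ×ˢ Icc 0 z₀ ⊆ D → ∀ N : ℝ, ∃ C : ℝ, 0 ≤ C ∧ ∀ p : ℝ × ℝ, p.1 ∈ K →
    Real.exp p.2 ≤ z₀ → jetNorm k (fun q : ℝ × ℝ => Real.exp (N * q.2) • f (q.1, Real.exp q.2)) p ≤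
      C * Real.exp (N * p.2) := by
  induction k with
  | zero =>
    intro G _ _ f D hD hf K z₀ hK hKD N
    obtain ⟨C, hC⟩ := (hK.prod isCompact_Icc).exists_bound_of_continuousOn (hf.continuousOn.mono hKD)
    refine ⟨max C 0, le_max_right _ _, fun p hp1 hp2 => ?_⟩
    have h1 := hC (p.1, Real.exp p.2) ⟨hp1, (Real.exp_pos _).le, hp2⟩
    rw [jetNorm_zero, norm_smul, Real.norm_eq_abs, Real.abs_exp, mul_comm]
    gcongr
    exact h1.trans (le_max_left _ _)
  | succ k ih =>
    intro G _ _ f D hD hf K z₀ hK hKD N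
    set f₁ : ℝ × ℝ → (ℝ × ℝ →L[ℝ] G) := fun p => (fderiv ℝ f p).comp
      ((ContinuousLinearMap.fst ℝ ℝ ℝ).prod (p.2 • ContinuousLinearMap.snd ℝ ℝ ℝ)) +
      N • (ContinuousLinearMap.snd ℝ ℝ ℝ).smulRight (f p) with hf₁
    have hf₁s : SmoothOn f₁ D := by
      have h1 : SmoothOn (fderiv ℝ f) D := hf.fderiv_of_isOpen hD (by simp)
      have h2 : SmoothOn (fun p : ℝ × ℝ => (ContinuousLinearMap.fst ℝ ℝ ℝ).prod
          (p.2 • ContinuousLinearMap.snd ℝ ℝ ℝ)) D := by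
        have e : (fun p : ℝ × ℝ => (ContinuousLinearMap.fst ℝ ℝ ℝ).prod
          (p.2 • ContinuousLinearMap.snd ℝ ℝ ℝ)) = fun p : ℝ × ℝ =>
            (ContinuousLinearMap.inl ℝ ℝ ℝ).comp (ContinuousLinearMap.fst ℝ ℝ ℝ) +
            p.2 • (ContinuousLinearMap.inr ℝ ℝ ℝ).comp (ContinuousLinearMap.snd ℝ ℝ ℝ) := by
          funext p
          ext <;> simp
        rw [e]
        exact contDiffOn_const.add (contDiffOn_snd.smul contDiffOn_const)
      exact (h1.clm_comp h2).add ((contDiffOn_const.smulRight hf).const_smul N)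
    obtain ⟨C₀, hC₀, h0⟩ := ih hD hf hK hKD N
    obtain ⟨C₁, hC₁, h1⟩ := ih hD hf₁s hK hKD N
    refine ⟨C₀ + C₁, by positivity, fun p hp1 hp2 => ?_⟩
    rw [jetNorm_succ, add_mul]
    refine add_le_add ((norm_le_jetNorm k _ p).trans (h0 p hp1 hp2)) ?_
    rw [jetNorm_congr (g := fun q : ℝ × ℝ => Real.exp (N * q.2) • f₁ (q.1, Real.exp q.2))]
    · exact h1 p hp1 hp2
    have hmem : ∀ᶠ q : ℝ × ℝ in 𝓝 p, (q.1, Real.exp q.2) ∈ D :=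
      (Continuous.continuousAt (by fun_prop : Continuous fun q : ℝ × ℝ =>
        (q.1, Real.exp q.2))).preimage_mem_nhds
        (hD.mem_nhds (hKD ⟨hp1, (Real.exp_pos _).le, hp2⟩))
    filter_upwards [hmem] with q hq
    have e1 : HasFDerivAt (fun q : ℝ × ℝ => (q.1, Real.exp q.2))
        ((ContinuousLinearMap.fst ℝ ℝ ℝ).prod
          (Real.exp q.2 • ContinuousLinearMap.snd ℝ ℝ ℝ)) q :=
      hasFDerivAt_fst.prodMk hasFDerivAt_snd.exp
    have e2 := (hf.differentiableAt' hD hq).hasFDerivAt.comp q e1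
    have e3 : HasFDerivAt (fun q : ℝ × ℝ => Real.exp (N * q.2))
        (Real.exp (N * q.2) • (N • ContinuousLinearMap.snd ℝ ℝ ℝ)) q :=
      (hasFDerivAt_snd.const_mul N).exp
    have e4 := e3.smul e2
    rw [show (fun q : ℝ × ℝ => Real.exp (N * q.2) • f (q.1, Real.exp q.2)) =
      (fun q : ℝ × ℝ => Real.exp (N * q.2)) • (f ∘ fun q : ℝ × ℝ => (q.1, Real.exp q.2)) from rfl,
      e4.fderiv]
    ext <;> simp [hf₁, smul_smul, smul_add]

/-- The function `(s, z) ↦ r (s, log z)`, extended by zero to `z ≤ 0`. -/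
noncomputable def logExtension {G : Type} [Zero G] (r : ℝ × ℝ → G) (q : ℝ × ℝ) : G :=
  if 0 < q.2 then r (q.1, Real.log q.2) else 0

theorem logExtension_of_pos {G : Type} [Zero G] (r : ℝ × ℝ → G) {q : ℝ × ℝ} (h : 0 < q.2) :
    logExtension r q = r (q.1, Real.log q.2) := if_pos h

theorem logExtension_of_nonpos {G : Type} [Zero G] (r : ℝ × ℝ → G) {q : ℝ × ℝ} (h : q.2 ≤ 0) :
    logExtension r q = 0 := if_neg h.not_gt

/-- The derivative of `(s, log z)` expressed in the variables `(s, log z)`. -/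
noncomputable def logDiag (p : ℝ × ℝ) : ℝ × ℝ →L[ℝ] ℝ × ℝ :=
  (ContinuousLinearMap.inl ℝ ℝ ℝ).comp (ContinuousLinearMap.fst ℝ ℝ ℝ) +
    Real.exp (-p.2) • (ContinuousLinearMap.inr ℝ ℝ ℝ).comp (ContinuousLinearMap.snd ℝ ℝ ℝ)

theorem contDiff_logDiag : ContDiff ℝ (⊤ : ℕ∞) logDiag :=
  contDiff_const.add ((Real.contDiff_exp.comp contDiff_snd.neg).smul contDiff_const)

theorem hasFDerivAt_logExtension {G : Type} [NormedAddCommGroup G] [NormedSpace ℝ G]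
    {r : ℝ × ℝ → G} {x₁ x₂ ζ₀ C : ℝ} (hr : SmoothOn r (Ioo x₁ x₂ ×ˢ Iio ζ₀))
    (hC : ∀ p ∈ Ioo x₁ x₂ ×ˢ Iio ζ₀, ‖r p‖ ≤ C * Real.exp (2 * p.2)) {q : ℝ × ℝ}
    (hq : q ∈ Ioo x₁ x₂ ×ˢ Iio (Real.exp ζ₀)) :
    HasFDerivAt (logExtension r) (logExtension (fun p => (fderiv ℝ r p).comp (logDiag p)) q) q := by
  have hB : IsOpen (Ioo x₁ x₂ ×ˢ Iio ζ₀) := isOpen_Ioo.prod isOpen_Iio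
  have hO : IsOpen (Ioo x₁ x₂ ×ˢ Iio (Real.exp ζ₀)) := isOpen_Ioo.prod isOpen_Iio
  have hmem : ∀ x ∈ Ioo x₁ x₂ ×ˢ Iio (Real.exp ζ₀), 0 < x.2 →
      (x.1, Real.log x.2) ∈ Ioo x₁ x₂ ×ˢ Iio ζ₀ := fun x hx h =>
    ⟨hx.1, (Real.log_lt_iff_lt_exp h).2 hx.2⟩
  rcases lt_trichotomy q.2 0 with h | h | h
  · rw [logExtension_of_nonpos _ h.le]
    refine (hasFDerivAt_const (0 : G) q).congr_of_eventuallyEq ?_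
    filter_upwards [(isOpen_Iio.preimage continuous_snd).mem_nhds h] with x hx
    exact logExtension_of_nonpos r (le_of_lt hx)
  · rw [logExtension_of_nonpos _ h.le]
    rw [hasFDerivAt_iff_isLittleO]
    have hq0 : logExtension r q = 0 := logExtension_of_nonpos _ h.le
    have h1 : (fun x => logExtension r x - logExtension r q - (0 : ℝ × ℝ →L[ℝ] G) (x - q))
        =O[𝓝 q] fun x => ‖x - q‖ ^ 2 := by
      refine Asymptotics.IsBigO.of_bound |C| ?_
      filter_upwards [hO.mem_nhds hq] with x hx
      rw [hq0]
      simp only [sub_zero, zero_apply, norm_pow, norm_norm]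
      by_cases hx0 : 0 < x.2
      · rw [logExtension_of_pos _ hx0]
        refine (hC _ (hmem x hx hx0)).trans ?_
        have e : Real.exp (2 * Real.log x.2) = x.2 ^ 2 := by
          rw [mul_comm, Real.exp_mul, Real.exp_log hx0]
          norm_cast
        simp only [e]
        have h2 : |x.2| ≤ ‖x - q‖ := by simpa [h] using norm_snd_le (x - q)
        rw [← sq_abs x.2]
        exact (mul_le_mul_of_nonneg_right (le_abs_self C) (by positivity)).trans (by gcongr)
      · rw [logExtension_of_nonpos _ (not_lt.1 hx0), norm_zero]
        positivity
    refine h1.trans_isLittleO ?_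
    have h3 : (fun x : ℝ × ℝ => ‖x - q‖ ^ 2) =o[𝓝 q] fun x => ‖x - q‖ := by
      have : Tendsto (fun x : ℝ × ℝ => ‖x - q‖) (𝓝 q) (𝓝 0) := by
        have : Continuous fun x : ℝ × ℝ => ‖x - q‖ := by fun_prop
        simpa using this.tendsto q
      exact (Asymptotics.isLittleO_pow_id one_lt_two).comp_tendsto this
    exact h3.of_norm_right
  · rw [logExtension_of_pos _ h]
    have h1 := (hr.differentiableAt' hB (hmem q hq h)).hasFDerivAt
    have h2 : HasFDerivAt (fun x : ℝ × ℝ => (x.1, Real.log x.2))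
        (logDiag (q.1, Real.log q.2)) q := by
      have := (hasFDerivAt_fst (𝕜 := ℝ) (p := q)).prodMk
        ((hasFDerivAt_snd (𝕜 := ℝ) (p := q)).log h.ne')
      refine this.congr_fderiv ?_
      ext <;> simp [logDiag, Real.exp_neg, Real.exp_log h]
    refine (h1.comp q h2).congr_of_eventuallyEq ?_
    filter_upwards [(isOpen_Ioi.preimage continuous_snd).mem_nhds h] with x hx
    exact logExtension_of_pos r hx

theorem exists_jetNorm_logDiag_le (k : ℕ) {x₁ x₂ : ℝ} : ∃ C : ℝ, 0 ≤ C ∧ ∀ p : ℝ × ℝ,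
    p.1 ∈ Icc x₁ x₂ → p.2 ≤ 0 → jetNorm k logDiag p ≤ C * Real.exp (-p.2) := by
  obtain ⟨C, hC, h⟩ := exists_jetNorm_exp_smul_le k (D := univ) (K := Icc x₁ x₂) (z₀ := 1)
    (f := fun p : ℝ × ℝ =>
      p.2 • (ContinuousLinearMap.inl ℝ ℝ ℝ).comp (ContinuousLinearMap.fst ℝ ℝ ℝ) +
      (ContinuousLinearMap.inr ℝ ℝ ℝ).comp (ContinuousLinearMap.snd ℝ ℝ ℝ)) isOpen_univ
    ((contDiffOn_snd.smul contDiffOn_const).add contDiffOn_const) isCompact_Icc (subset_univ _) (-1)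
  refine ⟨C, hC, fun p hp1 hp2 => ?_⟩
  have := h p hp1 (Real.exp_le_one_iff.2 hp2)
  rw [neg_one_mul] at this
  refine le_of_eq_of_le (jetNorm_congr (Eventually.of_forall fun q => ?_) k) this
  simp only [smul_add, smul_smul, neg_one_mul, logDiag]
  rw [← Real.exp_add, neg_add_cancel, Real.exp_zero, one_smul]

theorem contDiffOn_logExtension (k : ℕ) : ∀ {G : Type} [NormedAddCommGroup G] [NormedSpace ℝ G]
    {r : ℝ × ℝ → G} {x₁ x₂ ζ₀ C : ℝ} {M : ℕ}, ζ₀ ≤ 0 → SmoothOn r (Ioo x₁ x₂ ×ˢ Iio ζ₀) →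
    k + 2 ≤ M → (∀ p ∈ Ioo x₁ x₂ ×ˢ Iio ζ₀, jetNorm k r p ≤ C * Real.exp (M * p.2)) →
    ContDiffOn ℝ k (logExtension r) (Ioo x₁ x₂ ×ˢ Iio (Real.exp ζ₀)) := by
  have base : ∀ (k : ℕ) {G : Type} [NormedAddCommGroup G] [NormedSpace ℝ G]
    {r : ℝ × ℝ → G} {x₁ x₂ ζ₀ C : ℝ} {M : ℕ}, ζ₀ ≤ 0 → SmoothOn r (Ioo x₁ x₂ ×ˢ Iio ζ₀) →
    k + 2 ≤ M → (∀ p ∈ Ioo x₁ x₂ ×ˢ Iio ζ₀, jetNorm k r p ≤ C * Real.exp (M * p.2)) →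
    ∀ q ∈ Ioo x₁ x₂ ×ˢ Iio (Real.exp ζ₀), HasFDerivAt (logExtension r)
      (logExtension (fun p => (fderiv ℝ r p).comp (logDiag p)) q) q := by
    intro k G _ _ r x₁ x₂ ζ₀ C M hζ hr hM hC q hq
    refine hasFDerivAt_logExtension (C := |C|) hr (fun p hp => ?_) hq
    refine ((norm_le_jetNorm k r p).trans (hC p hp)).trans ?_
    have hp2 : p.2 < ζ₀ := hp.2
    have hM' : (2 : ℝ) ≤ M := by exact_mod_cast (by omega : 2 ≤ M)
    have : (M : ℝ) * p.2 ≤ 2 * p.2 := by nlinarith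
    exact (mul_le_mul_of_nonneg_right (le_abs_self C) (Real.exp_pos _).le).trans (by gcongr)
  induction k with
  | zero =>
    intro G _ _ r x₁ x₂ ζ₀ C M hζ hr hM hC
    rw [Nat.cast_zero, contDiffOn_zero]
    exact fun q hq => (base 0 hζ hr hM hC q hq).continuousAt.continuousWithinAt
  | succ k ih =>
    intro G _ _ r x₁ x₂ ζ₀ C M hζ hr hM hC
    have hB : IsOpen (Ioo x₁ x₂ ×ˢ Iio ζ₀) := isOpen_Ioo.prod isOpen_Iio
    have hO : IsOpen (Ioo x₁ x₂ ×ˢ Iio (Real.exp ζ₀)) := isOpen_Ioo.prod isOpen_Iio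
    have hd := base (k + 1) hζ hr hM hC
    rw [Nat.cast_succ, contDiffOn_succ_iff_fderiv_of_isOpen hO]
    refine ⟨fun q hq => (hd q hq).differentiableAt.differentiableWithinAt, by simp, ?_⟩
    obtain ⟨M, rfl⟩ : ∃ M', M = M' + 1 := ⟨M - 1, by omega⟩
    obtain ⟨C₁, hC₁, h1⟩ := exists_jetNorm_logDiag_le k (x₁ := x₁) (x₂ := x₂)
    have hDr : SmoothOn (fderiv ℝ r) (Ioo x₁ x₂ ×ˢ Iio ζ₀) := hr.fderiv_of_isOpen hB (by simp)
    have hs : SmoothOn (fun p => (fderiv ℝ r p).comp (logDiag p)) (Ioo x₁ x₂ ×ˢ Iio ζ₀) :=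
      hDr.clm_comp contDiff_logDiag.contDiffOn
    refine (ih (r := fun p => (fderiv ℝ r p).comp (logDiag p)) (C := 2 ^ (k + 1) * (|C| * C₁))
      (M := M) hζ hs (by omega) ?_).congr fun q hq => (hd q hq).fderiv
    intro p hp
    have e1 := jetNorm_bilinear_le (ContinuousLinearMap.compL ℝ (ℝ × ℝ) (ℝ × ℝ) G)
      (ContinuousLinearMap.norm_compL_le ℝ _ _ G) hB hDr contDiff_logDiag.contDiffOn hp k
    refine e1.trans ?_
    have e2 : jetNorm k (fderiv ℝ r) p ≤ |C| * Real.exp (((M + 1 : ℕ) : ℝ) * p.2) := by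
      have := hC p hp
      rw [jetNorm_succ] at this
      have h3 := mul_le_mul_of_nonneg_right (le_abs_self C)
        (Real.exp_pos (((M + 1 : ℕ) : ℝ) * p.2)).le
      linarith [norm_nonneg (r p)]
    have e3 := h1 p (Ioo_subset_Icc_self hp.1) ((le_of_lt hp.2).trans hζ)
    have e4 : Real.exp (M * p.2) = Real.exp (((M + 1 : ℕ) : ℝ) * p.2) * Real.exp (-p.2) := by
      rw [← Real.exp_add]
      congr 1
      push_cast
      ring
    calc _ ≤ 2 ^ (k + 1) * ((|C| * Real.exp (((M + 1 : ℕ) : ℝ) * p.2)) *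
          (C₁ * Real.exp (-p.2))) := by
          gcongr
          exact jetNorm_nonneg _ _ _
      _ = _ := by
          rw [e4]
          ring

end JetEstimates

section Antiderivative

theorem exists_smooth_antiderivative {a b c : ℝ} (hc : c ∈ Ioo a b) {g : ℝ → ℝ}
    (hg : SmoothOn g (Ioo a b)) : ∃ q : ℝ → ℝ, SmoothOn q (Ioo a b) ∧ q c = 0 ∧
      (∀ s ∈ Ioo a b, HasDerivAt q (g s) s) ∧ ((∀ s, c ≤ s → s < b → g s = 0) →
        ∀ s, c ≤ s → s < b → q s = 0) := by
  have hd : ∀ s ∈ Ioo a b, HasDerivAt (fun s => ∫ t in c..s, g t) (g s) s := by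
    intro s hs
    have hsub : uIcc c s ⊆ Ioo a b := fun x hx =>
      ⟨(lt_min hc.1 hs.1).trans_le hx.1, hx.2.trans_lt (max_lt hc.2 hs.2)⟩
    refine intervalIntegral.integral_hasDerivAt_right
      (hg.continuousOn.mono hsub).intervalIntegrable ?_ (hg.continuousOn.continuousAt
        (isOpen_Ioo.mem_nhds hs))
    exact (hg.continuousOn.stronglyMeasurableAtFilter isOpen_Ioo s hs)
  refine ⟨fun s => ∫ t in c..s, g t, ?_, by simp, hd, ?_⟩
  · rw [SmoothOn, contDiffOn_infty_iff_deriv_of_isOpen isOpen_Ioo]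
    exact ⟨fun s hs => (hd s hs).differentiableAt.differentiableWithinAt,
      hg.congr fun s hs => (hd s hs).deriv⟩
  · intro h s hs hsb
    have : ∫ t in c..s, g t = ∫ t in c..s, (0 : ℝ) := by
      refine intervalIntegral.integral_congr fun t ht => ?_
      rw [uIcc_of_le hs] at ht
      exact h t ht.1 (ht.2.trans_lt hsb)
    simp [this]

end Antiderivative

section FormalSolution

/-- The map `(s, z) ↦ (s + z A, z + z² B)`. -/
def billiardMap (A B : ℝ × ℝ → ℝ) (p : ℝ × ℝ) : ℝ × ℝ :=
  (p.1 + p.2 * A p, p.2 + p.2 ^ 2 * B p)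

/-- A reversible map of the form `(s, z) ↦ (s + z A, z + z² B)` near `(a, b) × {0}`, where
`A > 0` and `B` vanishes on `{z = 0}`. -/
structure IsReversibleMap (a b x₀ : ℝ) (D : Set (ℝ × ℝ)) (A B : ℝ × ℝ → ℝ) : Prop where
  base : x₀ ∈ Ioo a b
  isOpen : IsOpen D
  axis : Jset a b ⊆ D
  strip : ∀ p ∈ D, p.1 ∈ Ioo a b
  star : BoxStar x₀ D
  smoothA : SmoothOn A D
  smoothB : SmoothOn B D
  posA : ∀ p ∈ D, 0 < A p
  zeroB : ∀ s ∈ Ioo a b, B (s, 0) = 0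
  posScale : ∀ p ∈ D, 0 < 1 + p.2 * B p
  reversible : ∀ p ∈ D, billiardMap A B p ∈ D →
    billiardMap A B ((billiardMap A B p).1, -(billiardMap A B p).2) = (p.1, -p.2)

variable {a b x₀ : ℝ} {D : Set (ℝ × ℝ)} {A B : ℝ × ℝ → ℝ}

theorem billiardMap_axis (s : ℝ) : billiardMap A B (s, 0) = (s, 0) := by
  simp [billiardMap]

theorem billiardMap_snd (p : ℝ × ℝ) : (billiardMap A B p).2 = p.2 * (1 + p.2 * B p) := by
  simp only [billiardMap]
  ring

theorem IsReversibleMap.smooth (h : IsReversibleMap a b x₀ D A B) :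
    SmoothOn (billiardMap A B) D :=
  (contDiffOn_fst.add (contDiffOn_snd.mul h.smoothA)).prodMk
    (contDiffOn_snd.add ((contDiffOn_snd.pow 2).mul h.smoothB))

theorem IsReversibleMap.mono (h : IsReversibleMap a b x₀ D A B) {D' : Set (ℝ × ℝ)}
    (hD' : IsOpen D') (hJ : Jset a b ⊆ D') (hs : BoxStar x₀ D') (hsub : D' ⊆ D) :
    IsReversibleMap a b x₀ D' A B where
  base := h.base
  isOpen := hD'
  axis := hJ
  strip p hp := h.strip p (hsub hp)
  star := hs
  smoothA := h.smoothA.mono hsub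
  smoothB := h.smoothB.mono hsub
  posA p hp := h.posA p (hsub hp)
  zeroB := h.zeroB
  posScale p hp := h.posScale p (hsub hp)
  reversible p hp hFp := h.reversible p (hsub hp) (hsub hFp)

/-- The box hull of the points of `D` that stay in `D`. -/
def returnHull (x₀ : ℝ) (A B : ℝ × ℝ → ℝ) (D : Set (ℝ × ℝ)) : Set (ℝ × ℝ) :=
  boxHull x₀ (D ∩ billiardMap A B ⁻¹' D)

theorem returnHull_subset : returnHull x₀ A B D ⊆ D :=
  (boxHull_subset _ _).trans inter_subset_left

theorem billiardMap_mem_of_mem_returnHull {p : ℝ × ℝ} (hp : p ∈ returnHull x₀ A B D) :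
    billiardMap A B p ∈ D :=
  (boxHull_subset _ _ hp).2

theorem IsReversibleMap.returnHull (h : IsReversibleMap a b x₀ D A B) :
    IsReversibleMap a b x₀ (returnHull x₀ A B D) A B := by
  refine h.mono (isOpen_boxHull _ (h.smooth.continuousOn.isOpen_inter_preimage h.isOpen h.isOpen))
    (Jset_subset_boxHull h.base ?_) (boxStar_boxHull _ _) returnHull_subset
  rintro ⟨s, z⟩ ⟨hs, hz⟩
  obtain rfl : z = 0 := hz
  refine ⟨h.axis (mem_Jset hs), ?_⟩
  rw [mem_preimage, billiardMap_axis]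
  exact h.axis (mem_Jset hs)

theorem IsReversibleMap.fst_le_fst (h : IsReversibleMap a b x₀ D A B) {p : ℝ × ℝ} (hp : p ∈ D)
    (hz : 0 ≤ p.2) : p.1 ≤ (billiardMap A B p).1 := by
  have := mul_nonneg hz (h.posA p hp).le
  simp only [billiardMap]
  linarith

theorem IsReversibleMap.snd_pos (h : IsReversibleMap a b x₀ D A B) {p : ℝ × ℝ} (hp : p ∈ D)
    (hz : 0 < p.2) : 0 < (billiardMap A B p).2 := by
  rw [billiardMap_snd]
  exact mul_pos hz (h.posScale p hp)

/-- `P / z` solves `Q ∘ F - Q = χ + O(z ^ N)`, with `P` vanishing for `s ≥ s₁`. -/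
structure IsFormalSolution (a b s₁ : ℝ) (D : Set (ℝ × ℝ)) (A B : ℝ × ℝ → ℝ) (χ : ℝ → ℝ) (N : ℕ)
    (P f : ℝ × ℝ → ℝ) : Prop where
  smooth : SmoothOn P (Ioo a b ×ˢ univ)
  smoothRem : SmoothOn f D
  vanish : ∀ p : ℝ × ℝ, p.1 ∈ Ioo a b → s₁ ≤ p.1 → P p = 0
  eqn : ∀ p ∈ D, p.2 ≠ 0 → P (billiardMap A B p) / (billiardMap A B p).2 - P p / p.2 =
    χ p.1 + p.2 ^ N * f p

theorem IsFormalSolution.rem_axis_eq_zero (h : IsReversibleMap a b x₀ D A B) {s₁ : ℝ}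
    {χ : ℝ → ℝ} (hχ : ∀ s, s₁ ≤ s → χ s = 0) {N : ℕ} {P f : ℝ × ℝ → ℝ}
    (hP : IsFormalSolution a b s₁ (returnHull x₀ A B D) A B χ N P f) {s : ℝ} (hs : s ∈ Ioo a b)
    (hs₁ : s₁ ≤ s) : f (s, 0) = 0 := by
  have h' := h.returnHull
  have hpos : ∀ p ∈ _root_.returnHull x₀ A B D, 0 < p.2 → s₁ ≤ p.1 → f p = 0 := by
    intro p hp hz hs
    have e := hP.eqn p hp hz.ne'
    have hF := h.strip _ (billiardMap_mem_of_mem_returnHull hp)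
    rw [hP.vanish _ hF (hs.trans (h'.fst_le_fst hp hz.le)),
      hP.vanish _ (h'.strip p hp) hs, hχ _ hs] at e
    have := pow_ne_zero N hz.ne'
    simp only [zero_div, sub_zero, zero_add] at e
    exact (mul_eq_zero.1 e.symm).resolve_left this
  have hmem : (s, (0 : ℝ)) ∈ _root_.returnHull x₀ A B D := h'.axis (mem_Jset hs)
  have hcont : ContinuousAt (fun z : ℝ => f (s, z)) 0 :=
    ContinuousAt.comp (g := f) (f := fun z : ℝ => (s, z))
      (hP.smoothRem.continuousOn.continuousAt (h'.isOpen.mem_nhds hmem)) (by fun_prop)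
  have hev : ∀ᶠ z : ℝ in 𝓝[>] 0, f (s, z) = 0 := by
    have : ∀ᶠ z : ℝ in 𝓝 0, (s, z) ∈ _root_.returnHull x₀ A B D :=
      (Continuous.continuousAt (by fun_prop : Continuous fun z : ℝ => (s, z))).preimage_mem_nhds
        (h'.isOpen.mem_nhds hmem)
    filter_upwards [self_mem_nhdsWithin, nhdsWithin_le_nhds this] with z hz hzm
    exact hpos _ hzm hz hs₁
  exact tendsto_nhds_unique (hcont.tendsto.mono_left nhdsWithin_le_nhds)
    (tendsto_const_nhds.congr' (hev.mono fun _ hx => hx.symm))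

theorem IsFormalSolution.step (h : IsReversibleMap a b x₀ D A B) {s₁ : ℝ}
    {χ : ℝ → ℝ} {N : ℕ} {P f : ℝ × ℝ → ℝ}
    (hP : IsFormalSolution a b s₁ (returnHull x₀ A B D) A B χ N P f) {q : ℝ → ℝ}
    (hq : SmoothOn q (Ioo a b)) (hq' : ∀ s ∈ Ioo a b, HasDerivAt q (-f (s, 0) / A (s, 0)) s)
    (hq₁ : ∀ s, s₁ ≤ s → s < b → q s = 0) :
    ∃ f' : ℝ × ℝ → ℝ, IsFormalSolution a b s₁ (returnHull x₀ A B D) A B χ (N + 1)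
      (fun p => P p + p.2 ^ N * q p.1) f' := by
  have h' := h.returnHull
  set D₁ := _root_.returnHull x₀ A B D with hD₁
  have hstar : ∀ p ∈ D₁, ∀ t ∈ Icc (0 : ℝ) 1, (p.1, t * p.2) ∈ D₁ := fun p hp t ht =>
    h'.star.scale hp ⟨by linarith [ht.1], ht.2⟩
  have hFs : ∀ p ∈ D₁, p.1 + p.2 * A p ∈ Ioo a b := fun p hp =>
    h.strip _ (billiardMap_mem_of_mem_returnHull hp)
  set μ : ℝ × ℝ → ℝ := fun p => 1 + p.2 * B p with hμ
  have hμs : SmoothOn μ D₁ := contDiffOn_const.add (contDiffOn_snd.mul h'.smoothB)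
  have hμ0 : ∀ p ∈ D₁, μ p ≠ 0 := fun p hp => (h'.posScale p hp).ne'
  set g : ℝ × ℝ → ℝ := fun p => μ p ^ N / μ p * q (p.1 + p.2 * A p) - q p.1 with hg
  have hgs : SmoothOn g D₁ := by
    have h1 : SmoothOn (fun p : ℝ × ℝ => q (p.1 + p.2 * A p)) D₁ :=
      hq.comp (contDiffOn_fst.add (contDiffOn_snd.mul h'.smoothA)) hFs
    have h2 : SmoothOn (fun p : ℝ × ℝ => q p.1) D₁ := hq.comp contDiffOn_fst h'.strip
    exact (((hμs.pow N).div hμs hμ0).mul h1).sub h2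
  obtain ⟨g₁, hg₁s, hg₁, hg₁0⟩ := exists_smooth_quotient h'.isOpen hstar hgs
  have hg0 : ∀ p ∈ D₁, g p = p.2 * g₁ p := by
    intro p hp
    have h0 : g (p.1, 0) = 0 := by simp [hg, hμ]
    rw [hg₁ p hp, h0, zero_add, smul_eq_mul]
  have hg₁axis : ∀ s ∈ Ioo a b, g₁ (s, 0) = -f (s, 0) := by
    intro s hs
    have hm : (s, (0 : ℝ)) ∈ D₁ := h'.axis (mem_Jset hs)
    rw [hg₁0 _ hm]
    have hline : HasDerivAt (fun z : ℝ => (s, z)) ((0 : ℝ), (1 : ℝ)) 0 :=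
      (hasDerivAt_const _ _).prodMk (hasDerivAt_id _)
    have e1 := (hgs.differentiableAt' h'.isOpen hm).hasFDerivAt.comp_hasDerivAt (0 : ℝ) hline
    have eA := (h'.smoothA.differentiableAt' h'.isOpen hm).hasFDerivAt.comp_hasDerivAt (0 : ℝ) hline
    have eB := (h'.smoothB.differentiableAt' h'.isOpen hm).hasFDerivAt.comp_hasDerivAt (0 : ℝ) hline
    have eμ : HasDerivAt (fun z : ℝ => μ (s, z)) 0 0 := by
      refine (((hasDerivAt_id (0 : ℝ)).mul eB).const_add 1).congr_deriv ?_
      simp [h.zeroB s hs]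
    have eμN : HasDerivAt (fun z : ℝ => μ (s, z) ^ N / μ (s, z)) 0 0 := by
      have hne : μ (s, 0) ≠ 0 := hμ0 _ hm
      refine ((eμ.fun_pow N).fun_div eμ hne).congr_deriv ?_
      simp
    have ein : HasDerivAt (fun z : ℝ => s + z * A (s, z)) (A (s, 0)) 0 := by
      have := ((hasDerivAt_id (0 : ℝ)).mul eA).const_add s
      simpa using this
    have eq' : HasDerivAt (fun z : ℝ => q (s + z * A (s, z)))
        (-f (s, 0) / A (s, 0) * A (s, 0)) 0 := by
      refine HasDerivAt.comp (h₂ := q) (0 : ℝ) ?_ ein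
      simpa using hq' s hs
    have etot := (eμN.mul eq').sub_const (q s)
    have := e1.unique etot
    rw [this]
    have hA := (h'.posA _ hm).ne'
    have hμ1 : μ (s, 0) = 1 := by simp [hμ]
    simp only [hμ1, one_pow, div_one, one_mul, zero_mul, zero_add]
    field_simp
  obtain ⟨f', hf's, hf', -⟩ := exists_smooth_quotient h'.isOpen hstar (hP.smoothRem.add hg₁s)
  refine ⟨f', ?_, hf's, ?_, ?_⟩
  · exact hP.smooth.add ((contDiffOn_snd.pow N).mul (hq.comp contDiffOn_fst fun p hp => hp.1))
  · intro p hp hs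
    simp [hP.vanish p hp hs, hq₁ _ hs hp.2]
  · intro p hp hz
    have e1 := hP.eqn p hp hz
    have e2 := hf' p hp
    have e3 : f (p.1, 0) + g₁ (p.1, 0) = 0 := by
      rw [hg₁axis _ (h'.strip p hp)]
      ring
    rw [e3, zero_add, smul_eq_mul] at e2
    have e4 := hg0 p hp
    have hμp := hμ0 p hp
    have e5 : (billiardMap A B p).2 = p.2 * μ p := billiardMap_snd p
    have e6 : (billiardMap A B p).1 = p.1 + p.2 * A p := rfl
    simp only [hg] at e4
    have e7 : (billiardMap A B p).2 ^ N * q (billiardMap A B p).1 / (billiardMap A B p).2 -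
        p.2 ^ N * q p.1 / p.2 = p.2 ^ N * g₁ p := by
      rw [e5, e6]
      have : p.2 ^ N * g₁ p = p.2 ^ N / p.2 * (p.2 * g₁ p) := by
        field_simp
      rw [this, ← e4, mul_pow]
      field_simp
    calc _ = (P (billiardMap A B p) / (billiardMap A B p).2 - P p / p.2) +
        ((billiardMap A B p).2 ^ N * q (billiardMap A B p).1 / (billiardMap A B p).2 -
        p.2 ^ N * q p.1 / p.2) := by ring
      _ = χ p.1 + p.2 ^ N * (f p + g₁ p) := by
        rw [e1, e7]
        ring
      _ = _ := by
        rw [e2]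
        ring

theorem exists_isFormalSolution (h : IsReversibleMap a b x₀ D A B) {s₁ : ℝ} (hs₁ : s₁ ∈ Ioo a b)
    {χ : ℝ → ℝ} (hχs : SmoothOn χ (Ioo a b)) (hχ : ∀ s, s₁ ≤ s → χ s = 0) {q₀ : ℝ → ℝ}
    (hq₀ : SmoothOn q₀ (Ioo a b)) (hq₀' : ∀ s ∈ Ioo a b, HasDerivAt q₀ (χ s / A (s, 0)) s)
    (hq₀₁ : ∀ s, s₁ ≤ s → s < b → q₀ s = 0) {N : ℕ} (hN : 1 ≤ N) :
    ∃ P f : ℝ × ℝ → ℝ, IsFormalSolution a b s₁ (returnHull x₀ A B D) A B χ N P f ∧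
      ∀ s, P (s, 0) = q₀ s := by
  have h' := h.returnHull
  induction N, hN using Nat.le_induction with
  | base =>
    have h0 : IsFormalSolution a b s₁ (_root_.returnHull x₀ A B D) A B χ 0 (fun _ => 0)
        (fun p => -χ p.1) :=
      ⟨contDiffOn_const, (hχs.comp contDiffOn_fst h'.strip).neg, fun _ _ _ => rfl, by simp⟩
    obtain ⟨f', hf'⟩ := h0.step h hq₀ (by simpa using hq₀') hq₀₁
    exact ⟨_, f', hf', by simp⟩
  | succ N hN ih =>
    obtain ⟨P, f, hP, hP0⟩ := ih
    have hg : SmoothOn (fun s => -f (s, 0) / A (s, 0)) (Ioo a b) := by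
      have hc : SmoothOn (fun s : ℝ => (s, (0 : ℝ))) (Ioo a b) := ContDiff.contDiffOn (by fun_prop)
      have hm : MapsTo (fun s : ℝ => (s, (0 : ℝ))) (Ioo a b) (_root_.returnHull x₀ A B D) :=
        fun s hs => h'.axis (mem_Jset hs)
      exact (hP.smoothRem.comp hc hm).neg.div (h'.smoothA.comp hc hm) fun s hs =>
        (h'.posA _ (hm hs)).ne'
    obtain ⟨q, hq, -, hq', hq₁⟩ := exists_smooth_antiderivative hs₁ hg
    obtain ⟨f', hf'⟩ := hP.step h hq hq' (hq₁ fun s hs hsb => by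
      rw [hP.rem_axis_eq_zero h hχ ⟨hs₁.1.trans_le hs, hsb⟩ hs]
      simp)
    exact ⟨_, f', hf', fun s => by simp [hP0 s, (Nat.one_le_iff_ne_zero.1 hN)]⟩

end FormalSolution

section EvenFormalSolution

variable {a b x₀ : ℝ} {D : Set (ℝ × ℝ)} {A B : ℝ × ℝ → ℝ}

/-- An even `P` such that `P / z` solves `Q ∘ F - Q = (χ + χ ∘ F) / 2 + O(z ^ N)`. -/
structure IsEvenFormalSolution (a b s₁ : ℝ) (D : Set (ℝ × ℝ)) (A B : ℝ × ℝ → ℝ) (χ q₀ : ℝ → ℝ)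
    (N : ℕ) (P f : ℝ × ℝ → ℝ) : Prop where
  smooth : SmoothOn P (Ioo a b ×ˢ univ)
  smoothRem : SmoothOn f D
  even : ∀ s z, P (s, -z) = P (s, z)
  vanish : ∀ p : ℝ × ℝ, p.1 ∈ Ioo a b → s₁ ≤ p.1 → P p = 0
  axis : ∀ s, P (s, 0) = q₀ s
  eqn : ∀ p ∈ D, 0 < p.2 → P (billiardMap A B p) / (billiardMap A B p).2 - P p / p.2 =
    (χ p.1 + χ (billiardMap A B p).1) / 2 + p.2 ^ N * f p

theorem exists_isEvenFormalSolution (h : IsReversibleMap a b x₀ D A B) {s₁ : ℝ}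
    (hs₁ : s₁ ∈ Ioo a b) {χ : ℝ → ℝ} (hχs : SmoothOn χ (Ioo a b)) (hχ : ∀ s, s₁ ≤ s → χ s = 0)
    {q₀ : ℝ → ℝ} (hq₀ : SmoothOn q₀ (Ioo a b))
    (hq₀' : ∀ s ∈ Ioo a b, HasDerivAt q₀ (χ s / A (s, 0)) s)
    (hq₀₁ : ∀ s, s₁ ≤ s → s < b → q₀ s = 0) {N : ℕ} (hN : 1 ≤ N) :
    ∃ P f : ℝ × ℝ → ℝ, IsEvenFormalSolution a b s₁ (returnHull x₀ A B (returnHull x₀ A B D))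
      A B χ q₀ N P f := by
  obtain ⟨P, f, hP, hP0⟩ := exists_isFormalSolution h hs₁ hχs hχ hq₀ hq₀' hq₀₁ hN
  have h' := h.returnHull
  have h'' := h'.returnHull
  have hneg : ∀ p ∈ returnHull x₀ A B D, (p.1, -p.2) ∈ returnHull x₀ A B D := fun p hp =>
    h'.star.neg hp
  have hFs := h''.smooth
  have hIF : SmoothOn (fun p => ((billiardMap A B p).1, -(billiardMap A B p).2))
      (returnHull x₀ A B (returnHull x₀ A B D)) :=
    (contDiff_fst.comp_contDiffOn hFs).prodMk (contDiff_snd.comp_contDiffOn hFs).neg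
  have hI : SmoothOn (fun p : ℝ × ℝ => (p.1, -p.2)) (Ioo a b ×ˢ univ) :=
    ContDiff.contDiffOn (by fun_prop)
  refine ⟨fun p => (P p + P (p.1, -p.2)) / 2, fun p => (f p + (-(1 + p.2 * B p)) ^ N *
    f ((billiardMap A B p).1, -(billiardMap A B p).2)) / 2, ?_, ?_, ?_, ?_, ?_, ?_⟩
  · exact (hP.smooth.add (hP.smooth.comp hI fun p hp => ⟨hp.1, trivial⟩)).div_const 2
  · refine ContDiffOn.div_const (ContDiffOn.add (hP.smoothRem.mono returnHull_subset)
      (ContDiffOn.mul (ContDiffOn.pow ?_ N) (hP.smoothRem.comp hIF fun p hp =>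
        hneg _ (billiardMap_mem_of_mem_returnHull hp)))) 2
    exact (contDiffOn_const.add (contDiffOn_snd.mul h''.smoothB)).neg
  · intro s z
    simp [add_comm]
  · intro p hp hs
    simp [hP.vanish p hp hs, hP.vanish (p.1, -p.2) hp hs]
  · intro s
    simp [hP0 s]
  · intro p hp hz
    have hp1 := returnHull_subset hp
    have hp0 := returnHull_subset hp1
    have hF1 := billiardMap_mem_of_mem_returnHull hp
    have hF0 := returnHull_subset hF1
    have hz' := h.snd_pos hp0 hz
    have e1 := hP.eqn p hp1 hz.ne'
    have e2 := hP.eqn _ (hneg _ hF1) (neg_ne_zero.2 hz'.ne')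
    rw [h.reversible p hp0 hF0] at e2
    have hs := billiardMap_snd (A := A) (B := B) p
    have e3 : (-(billiardMap A B p).2) ^ N = p.2 ^ N * (-(1 + p.2 * B p)) ^ N := by
      rw [hs, ← mul_pow]
      ring
    simp only at e2 ⊢
    rw [e3, div_neg, div_neg] at e2
    linear_combination (e1 + e2) / 2

end EvenFormalSolution

section LogRegion

/-- A region in which `T` drifts to the right until the first coordinate exceeds `σ`. -/
structure IsDriftRegion (G : Set (ℝ × ℝ)) (T : ℝ × ℝ → ℝ × ℝ) (σ s₂ κ C : ℝ) : Prop where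
  isOpen : IsOpen G
  pos : 0 < κ
  nonneg : 0 ≤ C
  lt : ∀ p ∈ G, p.1 < s₂
  nonpos : ∀ p ∈ G, p.2 ≤ 0
  maps : ∀ p ∈ G, p.1 < σ → T p ∈ G
  fst : ∀ p ∈ G, p.1 < σ → p.1 + κ * Real.exp p.2 ≤ (T p).1
  snd : ∀ p ∈ G, p.1 < σ → |(T p).2 - p.2| ≤ C * Real.exp p.2

variable {G : Set (ℝ × ℝ)} {T : ℝ × ℝ → ℝ × ℝ} {σ s₂ κ C : ℝ}

theorem IsDriftRegion.induction (h : IsDriftRegion G T σ s₂ κ C) {P : ℝ × ℝ → Prop}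
    (base : ∀ p ∈ G, σ ≤ p.1 → P p) (step : ∀ p ∈ G, p.1 < σ → P (T p) → P p) :
    ∀ p ∈ G, P p := by
  intro p₀ hp₀
  set L := C / κ with hL
  have hL0 : 0 ≤ L := div_nonneg h.nonneg h.pos.le
  have hLκ : L * κ = C := div_mul_cancel₀ _ h.pos.ne'
  set η := p₀.2 + L * p₀.1 with hη
  set d := κ * Real.exp (η - L * s₂) with hd
  have hdpos : 0 < d := mul_pos h.pos (Real.exp_pos _)
  have key : ∀ n : ℕ, ∀ p ∈ G, η ≤ p.2 + L * p.1 → s₂ ≤ p.1 + n * d → P p := by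
    intro n
    induction n with
    | zero =>
      intro p hp _ hs
      have := h.lt p hp
      simp only [Nat.cast_zero, zero_mul, add_zero] at hs
      linarith
    | succ n ih =>
      intro p hp he hs
      rcases le_or_gt σ p.1 with hσ | hσ
      · exact base p hp hσ
      · refine step p hp hσ (ih _ (h.maps p hp hσ) ?_ ?_)
        · have h1 := mul_le_mul_of_nonneg_left (h.fst p hp hσ) hL0
          have h2 := (abs_le.1 (h.snd p hp hσ)).1
          have h3 : L * (p.1 + κ * Real.exp p.2) = L * p.1 + C * Real.exp p.2 := by
            rw [← hLκ]
            ring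
          linarith
        · have h1 := h.fst p hp hσ
          have h2 : η - L * s₂ ≤ p.2 := by
            have := mul_le_mul_of_nonneg_left (h.lt p hp).le hL0
            linarith
          have h3 : d ≤ κ * Real.exp p.2 :=
            mul_le_mul_of_nonneg_left (Real.exp_le_exp.2 h2) h.pos.le
          push_cast at hs
          linarith
  obtain ⟨n, hn⟩ := exists_nat_ge ((s₂ - p₀.1) / d)
  refine key n p₀ hp₀ le_rfl ?_
  rw [div_le_iff₀ hdpos] at hn
  linarith

theorem half_le_one_sub_exp_neg {x : ℝ} (h0 : 0 ≤ x) (h1 : x ≤ 1) :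
    x / 2 ≤ 1 - Real.exp (-x) := by
  have h2 : Real.exp (-x) * (1 + x) ≤ 1 := by
    have := mul_le_mul_of_nonneg_left (Real.add_one_le_exp x) (Real.exp_pos (-x)).le
    rw [← Real.exp_add] at this
    simpa [add_comm] using this
  nlinarith [Real.exp_pos (-x)]

theorem IsDriftRegion.barrier (h : IsDriftRegion G T σ s₂ κ C) {m : ℝ × ℝ → ℝ} {b c : ℝ}
    (hb : 0 ≤ b) (hc : 0 ≤ c) {N : ℕ} (base : ∀ p ∈ G, σ ≤ p.1 → m p = 0)
    (step : ∀ p ∈ G, p.1 < σ →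
      m p ≤ b * Real.exp ((N + 1) * p.2) + (1 + c * Real.exp p.2) * m (T p)) :
    ∃ L, ∀ p ∈ G, m p ≤ 2 * b * Real.exp (N * p.2) * Real.exp (L * (s₂ - p.1)) := by
  set L := (N * C + c + 1) / κ with hL
  have hL0 : 0 ≤ L := div_nonneg (by have := h.nonneg; positivity) h.pos.le
  have hLκ : L * κ = N * C + c + 1 := div_mul_cancel₀ _ h.pos.ne'
  refine ⟨L, h.induction (fun p hp hs => ?_) fun p hp hs ih => ?_⟩
  · rw [base p hp hs]
    positivity
  · refine (step p hp hs).trans ?_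
    set x := Real.exp p.2 with hx
    have hx0 : 0 < x := Real.exp_pos _
    have hx1 : x ≤ 1 := Real.exp_le_one_iff.2 (h.nonpos p hp)
    set W := Real.exp (N * p.2) * Real.exp (L * (s₂ - p.1)) with hW
    have h1 : (1 + c * x) * m (T p) ≤ 2 * b * W * Real.exp (-x) := by
      have e1 : 1 + c * x ≤ Real.exp (c * x) := by
        rw [add_comm]
        exact Real.add_one_le_exp _
      have e2 : Real.exp (c * x) * (Real.exp (N * (T p).2) *
          Real.exp (L * (s₂ - (T p).1))) ≤ W * Real.exp (-x) := by
        rw [hW, ← Real.exp_add, ← Real.exp_add, ← Real.exp_add, ← Real.exp_add]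
        refine Real.exp_le_exp.2 ?_
        have f1 := mul_le_mul_of_nonneg_left (h.fst p hp hs) hL0
        have f2 := mul_le_mul_of_nonneg_left (abs_le.1 (h.snd p hp hs)).2 (Nat.cast_nonneg (α := ℝ) N)
        have f3 : L * (p.1 + κ * x) = L * p.1 + (N * C + c + 1) * x := by
          rw [← hLκ]
          ring
        rw [← hx] at f1 f2
        nlinarith
      calc (1 + c * x) * m (T p) ≤ (1 + c * x) * (2 * b * Real.exp (N * (T p).2) *
            Real.exp (L * (s₂ - (T p).1))) := by gcongr
        _ ≤ Real.exp (c * x) * (2 * b * Real.exp (N * (T p).2) *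
            Real.exp (L * (s₂ - (T p).1))) := by gcongr
        _ = 2 * b * (Real.exp (c * x) * (Real.exp (N * (T p).2) *
            Real.exp (L * (s₂ - (T p).1)))) := by ring
        _ ≤ 2 * b * (W * Real.exp (-x)) := by gcongr
        _ = _ := by ring
    have h2 : b * Real.exp ((N + 1) * p.2) ≤ 2 * b * W * (1 - Real.exp (-x)) := by
      have e1 : Real.exp ((N + 1) * p.2) = Real.exp (N * p.2) * x := by
        rw [hx, ← Real.exp_add]
        ring_nf
      have e2 : Real.exp (N * p.2) ≤ W := by
        refine le_mul_of_one_le_right (Real.exp_pos _).le (Real.one_le_exp ?_)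
        exact mul_nonneg hL0 (by linarith [h.lt p hp])
      have e3 := half_le_one_sub_exp_neg hx0.le hx1
      calc b * Real.exp ((N + 1) * p.2) = 2 * b * Real.exp (N * p.2) * (x / 2) := by
            rw [e1]
            ring
        _ ≤ 2 * b * W * (1 - Real.exp (-x)) := by gcongr
    calc _ ≤ 2 * b * W * (1 - Real.exp (-x)) + 2 * b * W * Real.exp (-x) := add_le_add h2 h1
      _ = _ := by
        rw [hW]
        ring

end LogRegion

section LogMap

variable {a b x₀ : ℝ} {D : Set (ℝ × ℝ)} {A B : ℝ × ℝ → ℝ}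

/-- The map `billiardMap` in the coordinates `(s, log z)`. -/
noncomputable def logMap (A B : ℝ × ℝ → ℝ) (p : ℝ × ℝ) : ℝ × ℝ :=
  (p.1 + Real.exp p.2 * A (p.1, Real.exp p.2),
    p.2 + Real.log (1 + Real.exp p.2 * B (p.1, Real.exp p.2)))

theorem exp_logMap (h : IsReversibleMap a b x₀ D A B) {p : ℝ × ℝ}
    (hp : (p.1, Real.exp p.2) ∈ D) :
    ((logMap A B p).1, Real.exp (logMap A B p).2) = billiardMap A B (p.1, Real.exp p.2) := by
  have := h.posScale _ hp
  simp only at this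
  ext
  · simp [logMap, billiardMap]
  · rw [billiardMap_snd]
    simp only [logMap]
    rw [Real.exp_add, Real.exp_log this]

theorem exists_logMap_displacement (h : IsReversibleMap a b x₀ D A B) :
    ∃ ℓ : ℝ × ℝ → ℝ, SmoothOn ℓ D ∧ ∀ p : ℝ × ℝ, (p.1, Real.exp p.2) ∈ D →
      logMap A B p = p + Real.exp (1 * p.2) • (A (p.1, Real.exp p.2), ℓ (p.1, Real.exp p.2)) := by
  have hsm : SmoothOn (fun p : ℝ × ℝ => Real.log (1 + p.2 * B p)) D :=
    (contDiffOn_const.add (contDiffOn_snd.mul h.smoothB)).log fun p hp => (h.posScale p hp).ne'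
  obtain ⟨ℓ, hℓ, e, -⟩ := exists_smooth_quotient h.isOpen
    (fun p hp t ht => h.star.scale hp ⟨by linarith [ht.1], ht.2⟩) hsm
  refine ⟨ℓ, hℓ, fun p hp => ?_⟩
  have := e _ hp
  simp only [zero_mul, add_zero, Real.log_one, zero_add, smul_eq_mul] at this
  ext
  · simp [logMap]
  · simp [logMap, this]

theorem exists_rectangle_subset (hD : IsOpen D) (hJ : Jset a b ⊆ D) {K : Set ℝ} (hK : IsCompact K)
    (hKs : K ⊆ Ioo a b) : ∃ z₀ : ℝ, 0 < z₀ ∧ z₀ ≤ 1 ∧ K ×ˢ Icc 0 z₀ ⊆ D := by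
  have hO : IsOpen {z : ℝ | ∀ s ∈ K, (z, s) ∈ Prod.swap ⁻¹' D} :=
    isOpen_forall_compact hK (hD.preimage continuous_swap)
  have h0 : (0 : ℝ) ∈ {z : ℝ | ∀ s ∈ K, (z, s) ∈ Prod.swap ⁻¹' D} := fun s hs =>
    hJ (mem_Jset (hKs hs))
  obtain ⟨ε, hε, hb⟩ := Metric.isOpen_iff.1 hO 0 h0
  refine ⟨min (ε / 2) 1, lt_min (by linarith) one_pos, min_le_right _ _, ?_⟩
  rintro ⟨s, z⟩ ⟨hs, hz⟩
  have h1 := hz.2.trans (min_le_left _ _)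
  have hzb : z ∈ ball (0 : ℝ) ε := by
    rw [Real.ball_eq_Ioo]
    constructor <;> linarith [hz.1]
  exact hb hzb s hs

theorem exists_isDriftRegion (h : IsReversibleMap a b x₀ D A B) {c σ s₂ η : ℝ} (hc : c < s₂)
    (hσ : σ < s₂) (hη : 0 < η) (hη1 : η ≤ 1) (hsub : Icc c s₂ ×ˢ Icc 0 η ⊆ D) :
    ∃ (G : Set (ℝ × ℝ)) (κ C ε : ℝ), IsDriftRegion G (logMap A B) σ s₂ κ C ∧ 0 < ε ∧ ε ≤ 1 ∧
      Ioo c s₂ ×ˢ Iio (Real.log ε) ⊆ G ∧ ∀ p ∈ G, p.1 ∈ Ioo c s₂ ∧ Real.exp p.2 ≤ η := by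
  obtain ⟨ℓ, hℓ, hv⟩ := exists_logMap_displacement h
  have hQ : IsCompact (Icc c s₂ ×ˢ Icc 0 η) := isCompact_Icc.prod isCompact_Icc
  have hne : (Icc c s₂ ×ˢ Icc 0 η).Nonempty := ⟨(c, 0), ⟨le_rfl, hc.le⟩, le_rfl, hη.le⟩
  obtain ⟨p₁, hp₁, hmin⟩ := hQ.exists_isMinOn hne (h.smoothA.continuousOn.mono hsub)
  obtain ⟨M, hM⟩ := hQ.exists_bound_of_continuousOn (h.smoothA.continuousOn.mono hsub)
  obtain ⟨C, hC⟩ := hQ.exists_bound_of_continuousOn (hℓ.continuousOn.mono hsub)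
  have hκ := h.posA p₁ (hsub hp₁)
  set κ := A p₁
  have hM0 : 0 ≤ M := (norm_nonneg _).trans (hM p₁ hp₁)
  have hC0 : 0 ≤ C := (norm_nonneg _).trans (hC p₁ hp₁)
  set L := C / κ with hL
  have hL0 : 0 ≤ L := div_nonneg hC0 hκ.le
  have hLκ : L * κ = C := div_mul_cancel₀ _ hκ.ne'
  set ε₀ := min η ((s₂ - σ) / (M + 1)) with hε₀
  have hε₀pos : 0 < ε₀ := lt_min hη (div_pos (by linarith) (by linarith))
  have hεlog : Real.log (ε₀ * Real.exp (-(L * (s₂ - c)))) = Real.log ε₀ - L * (s₂ - c) := by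
    rw [Real.log_mul hε₀pos.ne' (Real.exp_pos _).ne', Real.log_exp]
    ring
  set G : Set (ℝ × ℝ) := {p | p.1 ∈ Ioo c s₂ ∧
    p.2 - L * (p.1 - c) < Real.log ε₀ - L * (s₂ - c)} with hG
  have hGε : ∀ p ∈ G, Real.exp p.2 ≤ ε₀ := by
    intro p hp
    rw [← Real.le_log_iff_exp_le hε₀pos]
    have := mul_le_mul_of_nonneg_left hp.1.2.le hL0
    linarith [hp.2]
  have hGη : ∀ p ∈ G, Real.exp p.2 ≤ η := fun p hp => (hGε p hp).trans (min_le_left _ _)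
  have hGQ : ∀ p ∈ G, (p.1, Real.exp p.2) ∈ Icc c s₂ ×ˢ Icc 0 η := fun p hp =>
    ⟨Ioo_subset_Icc_self hp.1, (Real.exp_pos _).le, hGη p hp⟩
  have hfst : ∀ p ∈ G, (logMap A B p).1 = p.1 + Real.exp p.2 * A (p.1, Real.exp p.2) :=
    fun p _ => rfl
  have hsnd : ∀ p ∈ G, |(logMap A B p).2 - p.2| ≤ C * Real.exp p.2 := by
    intro p hp
    rw [hv p (hsub (hGQ p hp))]
    simp only [Prod.snd_add, Prod.smul_snd, smul_eq_mul, add_sub_cancel_left, one_mul, abs_mul,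
      Real.abs_exp]
    rw [mul_comm]
    exact mul_le_mul_of_nonneg_right (hC _ (hGQ p hp)) (Real.exp_pos _).le
  have hge : ∀ p ∈ G, p.1 + κ * Real.exp p.2 ≤ (logMap A B p).1 := by
    intro p hp
    rw [hfst p hp, mul_comm κ]
    have := mul_le_mul_of_nonneg_left (hmin (hGQ p hp)) (Real.exp_pos p.2).le
    simp only [κ] at this ⊢
    linarith
  refine ⟨G, κ, C, ε₀ * Real.exp (-(L * (s₂ - c))), ⟨?_, hκ, hC0, fun p hp => hp.1.2, ?_, ?_,
    fun p hp _ => hge p hp, fun p hp _ => hsnd p hp⟩, mul_pos hε₀pos (Real.exp_pos _), ?_, ?_,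
    fun p hp => ⟨hp.1, hGη p hp⟩⟩
  · exact (isOpen_Ioo.preimage continuous_fst).inter (isOpen_lt
      (f := fun p : ℝ × ℝ => p.2 - L * (p.1 - c)) (by fun_prop) continuous_const)
  · intro p hp
    exact Real.exp_le_one_iff.1 ((hGη p hp).trans hη1)
  · intro p hp hpσ
    have hx := Real.exp_pos p.2
    refine ⟨⟨?_, ?_⟩, ?_⟩
    · have := hge p hp
      have := mul_pos hκ hx
      linarith [hp.1.1]
    · rw [hfst p hp]
      have h1 := (le_abs_self _).trans (hM _ (hGQ p hp))
      have h2 : Real.exp p.2 * A (p.1, Real.exp p.2) ≤ (s₂ - σ) / (M + 1) * M :=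
        mul_le_mul ((hGε p hp).trans (min_le_right _ _)) h1 (h.posA _ (hsub (hGQ p hp))).le
          (div_nonneg (by linarith) (by linarith))
      have h3 : (s₂ - σ) / (M + 1) * M ≤ s₂ - σ := by
        rw [div_mul_eq_mul_div, div_le_iff₀ (by linarith)]
        nlinarith
      linarith
    · have h1 := mul_le_mul_of_nonneg_left (hge p hp) hL0
      have h2 := (abs_le.1 (hsnd p hp)).2
      have h3 : L * (p.1 + κ * Real.exp p.2) = L * p.1 + C * Real.exp p.2 := by
        rw [← hLκ]
        ring
      linarith [hp.2]
  · refine (mul_le_mul ((min_le_left _ _).trans hη1) (Real.exp_le_one_iff.2 ?_)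
      (Real.exp_pos _).le zero_le_one).trans (by simp)
    have := mul_nonneg hL0 (sub_nonneg.2 hc.le)
    linarith
  · rintro p ⟨hp1, hp2⟩
    rw [hεlog] at hp2
    refine ⟨hp1, ?_⟩
    have := mul_nonneg hL0 (sub_nonneg.2 hp1.1.le)
    have hp2' : p.2 < Real.log ε₀ - L * (s₂ - c) := hp2
    linarith

end LogMap

section Transfer

/-- `T` stopped at `{s ≥ σ}`. -/
noncomputable def stoppedMap (T : ℝ × ℝ → ℝ × ℝ) (σ : ℝ) (p : ℝ × ℝ) : ℝ × ℝ :=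
  if p.1 < σ then T p else p

/-- `-∑ h ∘ T ^ i`, summed until the orbit reaches `{s ≥ σ}`. -/
noncomputable def orbitSum (T : ℝ × ℝ → ℝ × ℝ) (σ : ℝ) (h : ℝ × ℝ → ℝ) (p : ℝ × ℝ) : ℝ :=
  -∑' i : ℕ, (if ((stoppedMap T σ)^[i] p).1 < σ then h ((stoppedMap T σ)^[i] p) else 0)

variable {G : Set (ℝ × ℝ)} {T : ℝ × ℝ → ℝ × ℝ} {σ s₂ κ C : ℝ} {h : ℝ × ℝ → ℝ}

theorem orbitSum_of_le {p : ℝ × ℝ} (hp : σ ≤ p.1) : orbitSum T σ h p = 0 := by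
  have e : ∀ i : ℕ, (stoppedMap T σ)^[i] p = p := fun i =>
    Function.iterate_fixed (by simp [stoppedMap, hp.not_gt]) i
  simp [orbitSum, e, hp.not_gt]

theorem IsDriftRegion.orbitSum_eq (hG : IsDriftRegion G T σ s₂ κ C) :
    ∀ p ∈ G, p.1 < σ → orbitSum T σ h p = orbitSum T σ h (T p) - h p := by
  intro p hp hpσ
  have hfin : ∀ p ∈ G, ∃ n : ℕ, ∀ i, n ≤ i → σ ≤ ((stoppedMap T σ)^[i] p).1 := by
    refine hG.induction (fun p _ hσ => ⟨0, fun i _ => ?_⟩) fun p _ hσ ⟨n, hn⟩ => ⟨n + 1, ?_⟩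
    · rwa [Function.iterate_fixed (by simp [stoppedMap, hσ.not_gt]) i]
    · rintro (_ | i) hi
      · simp at hi
      · rw [Function.iterate_succ_apply, stoppedMap, if_pos hσ]
        exact hn i (by omega)
  obtain ⟨n, hn⟩ := hfin p hp
  have hsum : Summable fun i : ℕ => if ((stoppedMap T σ)^[i] p).1 < σ then
      h ((stoppedMap T σ)^[i] p) else 0 := by
    refine summable_of_ne_finset_zero (s := Finset.range n) fun i hi => ?_
    rw [if_neg (hn i (by simpa using hi)).not_gt]
  rw [orbitSum, hsum.tsum_eq_zero_add,
    if_pos (show ((stoppedMap T σ)^[0] p).1 < σ from hpσ), orbitSum]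
  have e : stoppedMap T σ p = T p := if_pos hpσ
  simp only [Function.iterate_zero, id_eq, Function.iterate_succ_apply, e]
  ring

end Transfer

section OneSided

variable {a b x₀ : ℝ} {D : Set (ℝ × ℝ)} {A B : ℝ × ℝ → ℝ} {χ q₀ : ℝ → ℝ}
  {G : Set (ℝ × ℝ)} {s₁ σ s₂ κ C : ℝ}

theorem contDiff_expSnd : ContDiff ℝ (⊤ : ℕ∞) fun p : ℝ × ℝ => (p.1, Real.exp p.2) :=
  contDiff_fst.prodMk (Real.contDiff_exp.comp contDiff_snd)

theorem IsReversibleMap.smoothOn_logMap (h : IsReversibleMap a b x₀ D A B) :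
    SmoothOn (logMap A B) {p : ℝ × ℝ | (p.1, Real.exp p.2) ∈ D} := by
  have hA := h.smoothA.comp contDiff_expSnd.contDiffOn (fun p hp => hp)
  have hB := h.smoothB.comp contDiff_expSnd.contDiffOn (fun p hp => hp)
  have hE : SmoothOn (fun p : ℝ × ℝ => Real.exp p.2) {p : ℝ × ℝ | (p.1, Real.exp p.2) ∈ D} :=
    (Real.contDiff_exp.comp contDiff_snd).contDiffOn
  exact (contDiffOn_fst.add (hE.mul hA)).prodMk (contDiffOn_snd.add
    ((contDiffOn_const.add (hE.mul hB)).log fun p hp => (h.posScale _ hp).ne'))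

/-- The solution of `θ ∘ T - θ = (χ + χ ∘ T) / 2` vanishing for `s ≥ σ`, in the coordinates
`(s, log z)`. -/
noncomputable def transferSum (A B : ℝ × ℝ → ℝ) (σ : ℝ) (χ : ℝ → ℝ) : ℝ × ℝ → ℝ :=
  orbitSum (logMap A B) σ fun p => (χ p.1 + χ (logMap A B p).1) / 2

theorem transferSum_sub (hG : IsDriftRegion G (logMap A B) σ s₂ κ C) {p : ℝ × ℝ} (hp : p ∈ G)
    (hpσ : p.1 < σ) : transferSum A B σ χ (logMap A B p) - transferSum A B σ χ p =
      (χ p.1 + χ (logMap A B p).1) / 2 := by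
  rw [transferSum, hG.orbitSum_eq p hp hpσ]
  ring

theorem transferSum_eq_zero (hG : IsDriftRegion G (logMap A B) σ s₂ κ C)
    (hχ : ∀ s, s₁ ≤ s → χ s = 0) : ∀ p ∈ G, s₁ ≤ p.1 → transferSum A B σ χ p = 0 := by
  refine hG.induction (fun p _ hσ _ => orbitSum_of_le hσ) fun p hp hσ ih hs => ?_
  have h1 : s₁ ≤ (logMap A B p).1 := by
    have := hG.fst p hp hσ
    have := mul_pos hG.pos (Real.exp_pos p.2)
    linarith
  have := transferSum_sub (χ := χ) hG hp hσ
  rw [ih h1, hχ _ hs, hχ _ h1] at this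
  linarith

theorem smoothOn_transferSum (h : IsReversibleMap a b x₀ D A B)
    (hG : IsDriftRegion G (logMap A B) σ s₂ κ C) (hGD : ∀ p ∈ G, (p.1, Real.exp p.2) ∈ D)
    (hs₁ : s₁ < σ) (hχs : SmoothOn χ (Ioo a b)) (hχ : ∀ s, s₁ ≤ s → χ s = 0) :
    SmoothOn (transferSum A B σ χ) G := by
  have hpt : ∀ p ∈ G, ContDiffAt ℝ (⊤ : ℕ∞) (transferSum A B σ χ) p := by
    refine hG.induction (fun p hp hσ => ?_) fun p hp hσ ih => ?_
    · refine (contDiffAt_const (c := (0 : ℝ))).congr_of_eventuallyEq ?_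
      filter_upwards [hG.isOpen.mem_nhds hp,
        (isOpen_lt continuous_const continuous_fst).mem_nhds (hs₁.trans_le hσ)] with q hq hqs
      exact transferSum_eq_zero hG hχ q hq (le_of_lt hqs)
    · have hT : ContDiffAt ℝ (⊤ : ℕ∞) (logMap A B) p :=
        (h.smoothOn_logMap.mono hGD).contDiffAt (hG.isOpen.mem_nhds hp)
      have hχat : ∀ q ∈ G, ContDiffAt ℝ (⊤ : ℕ∞) χ q.1 := fun q hq =>
        hχs.contDiffAt (isOpen_Ioo.mem_nhds (h.strip (q.1, Real.exp q.2) (hGD q hq)))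
      have e : ContDiffAt ℝ (⊤ : ℕ∞) (fun q => transferSum A B σ χ (logMap A B q) -
          (χ q.1 + χ (logMap A B q).1) / 2) p :=
        (ih.comp p hT).sub ((((hχat p hp).comp p contDiffAt_fst).add
          ((hχat _ (hG.maps p hp hσ)).comp p (contDiffAt_fst.comp p hT))).div_const 2)
      refine e.congr_of_eventuallyEq ?_
      filter_upwards [hG.isOpen.mem_nhds hp,
        (isOpen_lt continuous_fst continuous_const).mem_nhds hσ] with q hq hqs
      rw [← transferSum_sub hG hq hqs]
      ring
  exact fun p hp => (hpt p hp).contDiffWithinAt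

/-- The function `|z| θ(s, log |z|)`, extended by `q₀` to the axis. -/
noncomputable def axisExtension (θ : ℝ × ℝ → ℝ) (q₀ : ℝ → ℝ) (p : ℝ × ℝ) : ℝ :=
  if p.2 = 0 then q₀ p.1 else |p.2| * θ (p.1, Real.log p.2)

theorem axisExtension_axis {θ : ℝ × ℝ → ℝ} (s : ℝ) : axisExtension θ q₀ (s, 0) = q₀ s := by
  simp [axisExtension]

theorem axisExtension_of_ne {θ : ℝ × ℝ → ℝ} {p : ℝ × ℝ} (hp : p.2 ≠ 0) :
    axisExtension θ q₀ p = |p.2| * θ (p.1, Real.log p.2) := if_neg hp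

theorem axisExtension_neg {θ : ℝ × ℝ → ℝ} (p : ℝ × ℝ) :
    axisExtension θ q₀ (p.1, -p.2) = axisExtension θ q₀ p := by
  simp [axisExtension]

theorem smoothOn_axisExtension_of_ne {θ : ℝ × ℝ → ℝ} (hG : IsOpen G) (hθ : SmoothOn θ G) :
    SmoothOn (axisExtension θ q₀) {p : ℝ × ℝ | p.2 ≠ 0 ∧ (p.1, Real.log p.2) ∈ G} := by
  rintro p ⟨hp, hpG⟩
  have h1 : ContDiffAt ℝ (⊤ : ℕ∞) (fun q : ℝ × ℝ => (q.1, Real.log q.2)) p :=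
    contDiffAt_fst.prodMk ((Real.contDiffAt_log.2 hp).comp p contDiffAt_snd)
  have h2 : ContDiffAt ℝ (⊤ : ℕ∞) θ (p.1, Real.log p.2) := hθ.contDiffAt (hG.mem_nhds hpG)
  have h3 : ContDiffAt ℝ (⊤ : ℕ∞) (fun q : ℝ × ℝ => |q.2|) p :=
    (contDiffAt_abs hp).comp p contDiffAt_snd
  refine ((h3.mul (h2.comp p h1)).congr_of_eventuallyEq ?_).contDiffWithinAt
  filter_upwards [(isOpen_ne_fun continuous_snd continuous_const).mem_nhds hp] with q hq
  exact axisExtension_of_ne hq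

theorem axisExtension_eq_formal {θ P : ℝ × ℝ → ℝ} {p : ℝ × ℝ} (hP0 : P (p.1, 0) = q₀ p.1)
    (hPe : P (p.1, -p.2) = P p) :
    axisExtension θ q₀ p = P p + p.2 *
      (logExtension (fun q => θ q - Real.exp (-q.2) * P (q.1, Real.exp q.2)) p -
        logExtension (fun q => θ q - Real.exp (-q.2) * P (q.1, Real.exp q.2)) (p.1, -p.2)) := by
  obtain ⟨s, z⟩ := p
  simp only at hP0 hPe ⊢
  rcases lt_trichotomy z 0 with hz | rfl | hz
  · rw [logExtension_of_nonpos _ (q := (s, z)) hz.le,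
      logExtension_of_pos _ (q := (s, -z)) (by simpa using hz), axisExtension_of_ne hz.ne]
    simp only [abs_of_neg hz, Real.log_neg_eq_log, Real.exp_neg, Real.exp_log_of_neg hz, hPe]
    have := hz.ne
    field_simp
    ring
  · simp [axisExtension_axis, hP0]
  · rw [logExtension_of_nonpos _ (q := (s, -z)) (by simpa using hz.le),
      logExtension_of_pos _ (q := (s, z)) hz, axisExtension_of_ne hz.ne']
    simp only [abs_of_pos hz, Real.exp_neg, Real.exp_log hz]
    field_simp
    ring

theorem exists_contDiffOn_axisExtension (h : IsReversibleMap a b x₀ D A B) {c : ℝ} (hc : a < c)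
    (hcs : c < s₂) (hs₁ : s₁ < σ) (hσ : σ < s₂) (hs₂ : s₂ < b)
    (hχs : SmoothOn χ (Ioo a b)) (hχ : ∀ s, s₁ ≤ s → χ s = 0) (k : ℕ) {P f : ℝ × ℝ → ℝ}
    (hP : IsEvenFormalSolution a b s₁ D A B χ q₀ (k + 2 + 1) P f) :
    ∃ ε : ℝ, 0 < ε ∧ ContDiffOn ℝ k (axisExtension (transferSum A B σ χ) q₀)
      (Ioo c s₂ ×ˢ Ioo (-ε) ε) := by
  have hIcc : Icc c s₂ ⊆ Ioo a b := fun x hx => ⟨hc.trans_le hx.1, hx.2.trans_lt hs₂⟩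
  obtain ⟨z₀, hz₀, hz₀1, hrect⟩ := exists_rectangle_subset h.isOpen h.axis isCompact_Icc hIcc
  obtain ⟨ℓ, hℓ, hv⟩ := exists_logMap_displacement h
  have hAℓ : SmoothOn (fun q => (A q, ℓ q)) D := h.smoothA.prodMk hℓ
  obtain ⟨C₁, hC₁, hjv⟩ := exists_jetNorm_exp_smul_le (k + 1) h.isOpen hAℓ isCompact_Icc hrect 1
  obtain ⟨C₂, hC₂, hjf⟩ := exists_jetNorm_exp_smul_le k h.isOpen hP.smoothRem isCompact_Icc hrect
    ((k + 2 : ℕ) + 1)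
  obtain ⟨C₀, hC₀, hcomp⟩ := jetNorm_comp_le (E := ℝ × ℝ) k
  set η := min z₀ (1 / (C₁ + 1)) with hη
  have hηpos : 0 < η := lt_min hz₀ (by positivity)
  have hηz : η ≤ z₀ := min_le_left _ _
  obtain ⟨G, κ, C, ε, hG, hε, hε1, hbox, hGη⟩ := exists_isDriftRegion h (σ := σ) hcs hσ hηpos
    (hηz.trans hz₀1) ((prod_mono_right (Icc_subset_Icc_right hηz)).trans hrect)
  have hGD : ∀ p ∈ G, (p.1, Real.exp p.2) ∈ D := fun p hp =>
    hrect ⟨Ioo_subset_Icc_self (hGη p hp).1, (Real.exp_pos _).le, (hGη p hp).2.trans hηz⟩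
  have hθ := smoothOn_transferSum h hG hGD hs₁ hχs hχ
  set θ := transferSum A B σ χ with hθdef
  set R : ℝ × ℝ → ℝ := fun q => θ q - Real.exp (-q.2) * P (q.1, Real.exp q.2) with hR
  have hRs : SmoothOn R G := by
    refine hθ.sub (ContDiffOn.mul (ContDiff.contDiffOn (by fun_prop))
      (hP.smooth.comp contDiff_expSnd.contDiffOn fun p hp => ⟨h.strip _ (hGD p hp), trivial⟩))
  have hReq : ∀ p ∈ G, p.1 < σ → R p = R (logMap A B p) +
      Real.exp (((k + 2 : ℕ) + 1) * p.2) • f (p.1, Real.exp p.2) := by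
    intro p hp hpσ
    have e1 := transferSum_sub (χ := χ) hG hp hpσ
    have e2 := hP.eqn _ (hGD p hp) (Real.exp_pos p.2)
    have e3 := exp_logMap h (hGD p hp)
    have e4 : (logMap A B p).1 = (billiardMap A B (p.1, Real.exp p.2)).1 := by
      rw [← e3]
    have e5 : Real.exp (logMap A B p).2 = (billiardMap A B (p.1, Real.exp p.2)).2 := by
      rw [← e3]
    have e6 : Real.exp (((k + 2 : ℕ) + 1) * p.2) = Real.exp p.2 ^ (k + 2 + 1) := by
      rw [← Real.exp_nat_mul]
      push_cast
      ring_nf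
    simp only [hR, Real.exp_neg, e6, smul_eq_mul]
    rw [e3, e5]
    simp only at e2
    rw [← e4] at e2
    rw [div_eq_inv_mul, div_eq_inv_mul] at e2
    linear_combination e2 - e1
  have hRz : ∀ p ∈ G, s₁ ≤ p.1 → R p = 0 := by
    intro p hp hs
    simp only [hR, hθdef]
    rw [transferSum_eq_zero hG hχ p hp hs, hP.vanish _ (h.strip _ (hGD p hp)) hs]
    simp
  have hG' : IsOpen (G ∩ {p | p.1 < σ}) := hG.isOpen.inter (isOpen_lt continuous_fst continuous_const)
  have hvs : SmoothOn (fun q : ℝ × ℝ => Real.exp (1 * q.2) •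
      (A (q.1, Real.exp q.2), ℓ (q.1, Real.exp q.2))) (G ∩ {p | p.1 < σ}) :=
    ContDiffOn.smul (Real.contDiff_exp.comp (contDiff_const.mul contDiff_snd)).contDiffOn
      (hAℓ.comp contDiff_expSnd.contDiffOn fun p hp => hGD p hp.1)
  have hfs : SmoothOn (fun q : ℝ × ℝ => Real.exp (((k + 2 : ℕ) + 1) * q.2) •
      f (q.1, Real.exp q.2)) (G ∩ {p | p.1 < σ}) :=
    ContDiffOn.smul (Real.contDiff_exp.comp (contDiff_const.mul contDiff_snd)).contDiffOn
      (hP.smoothRem.comp contDiff_expSnd.contDiffOn fun p hp => hGD p hp.1)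
  have hmaps : ∀ p ∈ G ∩ {p | p.1 < σ}, logMap A B p ∈ G := fun p hp => hG.maps p hp.1 hp.2
  obtain ⟨L, hL⟩ := hG.barrier (m := jetNorm k R) (b := C₂) (c := C₀ * C₁) (N := k + 2) hC₂
    (mul_nonneg hC₀ hC₁) (fun p hp hpσ => by
      refine jetNorm_of_eventually_zero ?_ k
      filter_upwards [hG.isOpen.mem_nhds hp,
        (isOpen_lt continuous_const continuous_fst).mem_nhds (hs₁.trans_le hpσ)] with q hq hqs
      exact hRz q hq (le_of_lt hqs)) (fun p hp hpσ => by
      have hp' : p ∈ G ∩ {p | p.1 < σ} := ⟨hp, hpσ⟩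
      have hpI := Ioo_subset_Icc_self (hGη p hp).1
      have hpz := (hGη p hp).2.trans hηz
      have e1 : jetNorm k R p = jetNorm k (fun q => (R ∘ logMap A B) q +
          Real.exp (((k + 2 : ℕ) + 1) * q.2) • f (q.1, Real.exp q.2)) p := by
        refine jetNorm_congr ?_ k
        filter_upwards [hG'.mem_nhds hp'] with q hq
        exact hReq q hq.1 hq.2
      have hRT : SmoothOn (R ∘ logMap A B) (G ∩ {p | p.1 < σ}) :=
        hRs.comp (h.smoothOn_logMap.mono fun q hq => hGD q hq.1) hmaps
      have hδ : C₁ * Real.exp p.2 ≤ 1 := by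
        have := (hGη p hp).2.trans (min_le_right _ _)
        rw [le_div_iff₀ (by linarith)] at this
        nlinarith [Real.exp_pos p.2]
      have hj : jetNorm k (fderiv ℝ fun q : ℝ × ℝ => Real.exp (1 * q.2) •
          (A (q.1, Real.exp q.2), ℓ (q.1, Real.exp q.2))) p ≤ C₁ * Real.exp p.2 := by
        have e := hjv p hpI hpz
        rw [jetNorm_succ, one_mul] at e
        exact (le_add_of_nonneg_left (norm_nonneg _)).trans e
      have e2 := hcomp hG.isOpen hG' hmaps (fun q hq => hv q (hGD q hq.1)) hvs hRs hp' hδ hj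
      have e3 := hjf p hpI hpz
      have e4 := jetNorm_add_le hG' hRT hfs hp' k
      rw [e1]
      calc _ ≤ _ := e4
        _ ≤ (1 + C₀ * (C₁ * Real.exp p.2)) * jetNorm k R (logMap A B p) +
            C₂ * Real.exp (((k + 2 : ℕ) + 1) * p.2) := add_le_add e2 e3
        _ = _ := by ring)
  have hbound : ∀ p ∈ Ioo c s₂ ×ˢ Iio (Real.log ε), jetNorm k R p ≤
      (2 * C₂ * Real.exp (|L| * (s₂ - c))) * Real.exp ((k + 2 : ℕ) * p.2) := by
    intro p hp
    refine (hL p (hbox hp)).trans ?_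
    have : L * (s₂ - p.1) ≤ |L| * (s₂ - c) :=
      mul_le_mul (le_abs_self L) (by linarith [hp.1.1]) (by linarith [hp.1.2]) (abs_nonneg _)
    calc _ ≤ 2 * C₂ * Real.exp ((k + 2 : ℕ) * p.2) * Real.exp (|L| * (s₂ - c)) := by gcongr
      _ = _ := by ring
  have hE := contDiffOn_logExtension k (Real.log_nonpos hε.le hε1) (hRs.mono hbox) le_rfl hbound
  rw [Real.exp_log hε] at hE
  refine ⟨ε, hε, ?_⟩
  have hI : ContDiff ℝ k fun p : ℝ × ℝ => (p.1, -p.2) := by fun_prop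
  have hsum : ContDiffOn ℝ k (fun p => P p + p.2 * (logExtension R p -
      logExtension R (p.1, -p.2))) (Ioo c s₂ ×ˢ Ioo (-ε) ε) := by
    refine ((hP.smooth.of_le (by exact_mod_cast le_top)).mono fun p hp =>
      ⟨hIcc (Ioo_subset_Icc_self hp.1), trivial⟩).add (contDiffOn_snd.mul
      ((hE.mono fun p hp => ⟨hp.1, hp.2.2⟩).sub (hE.comp hI.contDiffOn fun p hp => ⟨hp.1, ?_⟩)))
    have : -ε < p.2 := hp.2.1
    exact (by linarith : -p.2 < ε)
  exact hsum.congr fun p _ => axisExtension_eq_formal (hP.axis _) (hP.even _ _)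

end OneSided

section OneSidedSolution

variable {a b x₀ : ℝ} {D : Set (ℝ × ℝ)} {A B : ℝ × ℝ → ℝ} {χ q₀ : ℝ → ℝ} {s₁ σ s₂ : ℝ}

theorem exists_smoothOn_axisExtension (h : IsReversibleMap a b x₀ D A B) {c : ℝ} (hc : a < c)
    (hcs : c < s₂) (hs₁ : s₁ < σ) (hσ : σ < s₂) (hs₂ : s₂ < b)
    (hχs : SmoothOn χ (Ioo a b)) (hχ : ∀ s, s₁ ≤ s → χ s = 0)
    (hP : ∀ N : ℕ, 1 ≤ N → ∃ P f, IsEvenFormalSolution a b s₁ D A B χ q₀ N P f) :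
    ∃ ε : ℝ, 0 < ε ∧ Ioo c s₂ ×ˢ Ioo (-ε) ε ⊆ D ∧
      SmoothOn (axisExtension (transferSum A B σ χ) q₀) (Ioo c s₂ ×ˢ Ioo (-ε) ε) ∧
      ∀ p ∈ Ioo c s₂ ×ˢ Ioo (-ε) ε, 0 < p.2 → p.1 < σ →
        axisExtension (transferSum A B σ χ) q₀ (billiardMap A B p) / (billiardMap A B p).2 -
          axisExtension (transferSum A B σ χ) q₀ p / p.2 =
          (χ p.1 + χ (billiardMap A B p).1) / 2 := by
  have hIcc : Icc c s₂ ⊆ Ioo a b := fun x hx => ⟨hc.trans_le hx.1, hx.2.trans_lt hs₂⟩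
  obtain ⟨z₀, hz₀, hz₀1, hrect⟩ := exists_rectangle_subset h.isOpen h.axis isCompact_Icc hIcc
  obtain ⟨G, κ, C, ε, hG, hε, hε1, hbox, hGη⟩ := exists_isDriftRegion h (σ := σ) hcs hσ hz₀
    hz₀1 hrect
  have hGD : ∀ p ∈ G, (p.1, Real.exp p.2) ∈ D := fun p hp =>
    hrect ⟨Ioo_subset_Icc_self (hGη p hp).1, (Real.exp_pos _).le, (hGη p hp).2⟩
  have hθ := smoothOn_transferSum h hG hGD hs₁ hχs hχ
  have hlog : ∀ p ∈ Ioo c s₂ ×ˢ Ioo (-ε) ε, p.2 ≠ 0 → (p.1, Real.log p.2) ∈ G := by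
    intro p hp hz
    refine hbox ⟨hp.1, ?_⟩
    rw [mem_Iio, ← Real.log_abs]
    exact Real.log_lt_log (abs_pos.2 hz) (abs_lt.2 hp.2)
  have hpos : ∀ p ∈ Ioo c s₂ ×ˢ Ioo (-ε) ε, 0 < p.2 → p ∈ D := by
    intro p hp hz
    simpa [Real.exp_log hz] using hGD _ (hlog p hp hz.ne')
  refine ⟨ε, hε, ?_, ?_, ?_⟩
  · intro p hp
    rcases lt_trichotomy p.2 0 with hz | hz | hz
    · have := h.star.neg (hpos (p.1, -p.2)
        ⟨hp.1, by have := hp.2.2; simp only; linarith, by have := hp.2.1; simp only; linarith⟩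
        (by simpa using hz))
      simpa using this
    · have := h.axis (mem_Jset (hIcc (Ioo_subset_Icc_self hp.1)))
      rwa [← hz] at this
    · exact hpos p hp hz
  · intro p hp
    by_cases hz : p.2 = 0
    · refine (contDiffAt_infty.2 fun k => ?_).contDiffWithinAt
      obtain ⟨P, f, hPf⟩ := hP (k + 2 + 1) (by omega)
      obtain ⟨ε', hε', hcd⟩ := exists_contDiffOn_axisExtension h hc hcs hs₁ hσ hs₂ hχs hχ k hPf
      refine hcd.contDiffAt ((isOpen_Ioo.prod isOpen_Ioo).mem_nhds ⟨hp.1, ?_⟩)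
      rw [hz]
      exact ⟨neg_neg_of_pos hε', hε'⟩
    · refine ContDiffAt.contDiffWithinAt ?_
      have hO : IsOpen ((Ioo c s₂ ×ˢ Ioo (-ε) ε) ∩ {p : ℝ × ℝ | p.2 ≠ 0}) :=
        (isOpen_Ioo.prod isOpen_Ioo).inter (isOpen_ne_fun continuous_snd continuous_const)
      exact ((smoothOn_axisExtension_of_ne hG.isOpen hθ).mono fun q hq =>
        ⟨hq.2, hlog q hq.1 hq.2⟩).contDiffAt (hO.mem_nhds ⟨hp, hz⟩)
  · intro p hp hz hpσ
    have hpD := hpos p hp hz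
    have hz' := h.snd_pos hpD hz
    have e := transferSum_sub (χ := χ) hG (hlog p hp hz.ne') hpσ
    have e1 := exp_logMap h (p := (p.1, Real.log p.2)) (by simpa [Real.exp_log hz] using hpD)
    simp only [Real.exp_log hz] at e1
    have e2 : logMap A B (p.1, Real.log p.2) =
        ((billiardMap A B p).1, Real.log (billiardMap A B p).2) := by
      rw [← e1]
      simp
    rw [e2] at e
    rw [axisExtension_of_ne hz'.ne', axisExtension_of_ne hz.ne', abs_of_pos hz, abs_of_pos hz',
      mul_div_cancel_left₀ _ hz'.ne', mul_div_cancel_left₀ _ hz.ne']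
    exact e

/-- A smooth even `S` such that `S / z` solves `Q ∘ F - Q = (χ + χ ∘ F) / 2`. -/
structure IsTransferSolution (O : Set (ℝ × ℝ)) (A B : ℝ × ℝ → ℝ) (χ q₀ : ℝ → ℝ)
    (S : ℝ × ℝ → ℝ) : Prop where
  smooth : SmoothOn S O
  even : ∀ p, S (p.1, -p.2) = S p
  axis : ∀ s, S (s, 0) = q₀ s
  eqn : ∀ p ∈ O, 0 < p.2 → S (billiardMap A B p) / (billiardMap A B p).2 - S p / p.2 =
    (χ p.1 + χ (billiardMap A B p).1) / 2

theorem exists_isTransferSolution (h : IsReversibleMap a b x₀ D A B) (hs₁ : s₁ ∈ Ioo a b)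
    (hχs : SmoothOn χ (Ioo a b)) (hχ : ∀ s, s₁ ≤ s → χ s = 0)
    (hq₀ : SmoothOn q₀ (Ioo a b))
    (hq₀' : ∀ s ∈ Ioo a b, HasDerivAt q₀ (χ s / A (s, 0)) s)
    (hq₀₁ : ∀ s, s₁ ≤ s → s < b → q₀ s = 0) :
    ∃ O S, IsOpen O ∧ Jset a b ⊆ O ∧ O ⊆ D ∧ IsTransferSolution O A B χ q₀ S := by
  obtain ⟨σ, hσ₁, hσb⟩ := exists_between hs₁.2
  obtain ⟨s₂, hσ, hs₂⟩ := exists_between hσb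
  have h' := h.returnHull.returnHull
  set D' := returnHull x₀ A B (returnHull x₀ A B D) with hD'
  set S := axisExtension (transferSum A B σ χ) q₀ with hS
  set Q : Set (ℝ × ℝ) := {p | p ∈ D' ∧ ContDiffAt ℝ (⊤ : ℕ∞) S p ∧ (0 < p.2 →
    S (billiardMap A B p) / (billiardMap A B p).2 - S p / p.2 =
    (χ p.1 + χ (billiardMap A B p).1) / 2)} with hQ
  have hzero : ∀ p ∈ D', σ ≤ p.1 → S p = 0 := by
    intro p hp hpσ
    by_cases hz : p.2 = 0
    · rw [hS, axisExtension, if_pos hz, hq₀₁ _ (hσ₁.le.trans hpσ) (h'.strip p hp).2]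
    · rw [hS, axisExtension_of_ne hz, transferSum, orbitSum_of_le (p := (p.1, Real.log p.2)) hpσ,
        mul_zero]
  have hzero' : ∀ p ∈ D', 0 < p.2 → σ ≤ p.1 → S (billiardMap A B p) = 0 := by
    intro p hp hz hpσ
    have hz' := h'.snd_pos hp hz
    rw [hS, axisExtension_of_ne hz'.ne', transferSum, orbitSum_of_le, mul_zero]
    exact hpσ.trans (h'.fst_le_fst hp hz.le)
  have heq : ∀ p ∈ D', 0 < p.2 → σ ≤ p.1 → S (billiardMap A B p) / (billiardMap A B p).2 - S p / p.2 =
      (χ p.1 + χ (billiardMap A B p).1) / 2 := by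
    intro p hp hz hpσ
    rw [hzero p hp hpσ, hzero' p hp hz hpσ, hχ _ (hσ₁.le.trans hpσ),
      hχ _ (hσ₁.le.trans (hpσ.trans (h'.fst_le_fst hp hz.le)))]
    simp
  refine ⟨interior Q, S, isOpen_interior, ?_, ?_, ?_, ?_, ?_, ?_⟩
  · rintro ⟨s, z⟩ ⟨hs, hz⟩
    obtain rfl : z = 0 := hz
    rw [mem_interior]
    rcases lt_or_ge s s₂ with hss | hss
    · obtain ⟨c, hac, hcs⟩ := exists_between hs.1
      obtain ⟨ε, hε, hsub, hsm, hE⟩ := exists_smoothOn_axisExtension (q₀ := q₀) h' hac (hcs.trans hss)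
        hσ₁ hσ hs₂ hχs hχ fun N hN => exists_isEvenFormalSolution h hs₁ hχs hχ hq₀ hq₀' hq₀₁ hN
      refine ⟨_, fun p hp => ⟨hsub hp, hsm.contDiffAt ((isOpen_Ioo.prod isOpen_Ioo).mem_nhds hp),
        fun hz => ?_⟩, isOpen_Ioo.prod isOpen_Ioo, ⟨⟨hcs, hss⟩, neg_neg_of_pos hε, hε⟩⟩
      rcases lt_or_ge p.1 σ with hpσ | hpσ
      · exact hE p hp hz hpσ
      · exact heq p (hsub hp) hz hpσ
    · have hO : IsOpen (D' ∩ {p : ℝ × ℝ | σ < p.1}) :=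
        h'.isOpen.inter (isOpen_lt continuous_const continuous_fst)
      refine ⟨_, fun p hp => ⟨hp.1, ?_, fun hz => heq p hp.1 hz (le_of_lt hp.2)⟩, hO,
        h'.axis (mem_Jset hs), hσ.trans_le hss⟩
      refine (contDiffAt_const (c := (0 : ℝ))).congr_of_eventuallyEq ?_
      filter_upwards [hO.mem_nhds hp] with q hq
      exact hzero q hq.1 (le_of_lt hq.2)
  · exact fun p hp => returnHull_subset (returnHull_subset (interior_subset hp).1)
  · exact fun p hp => (interior_subset hp).2.1.contDiffWithinAt
  · exact fun p => axisExtension_neg p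
  · exact fun s => axisExtension_axis s
  · exact fun p hp => (interior_subset hp).2.2

end OneSidedSolution

section TwoSided

variable {a b x₀ : ℝ} {D : Set (ℝ × ℝ)} {A B : ℝ × ℝ → ℝ}

theorem billiardMap_reflect (p : ℝ × ℝ) :
    billiardMap (fun q => A (-q)) (fun q => -B (-q)) p = -billiardMap A B (-p) := by
  ext
  · simp [billiardMap]
    ring
  · simp [billiardMap]
    ring

theorem IsReversibleMap.reflect (h : IsReversibleMap a b x₀ D A B) :
    IsReversibleMap (-b) (-a) (-x₀) (Neg.neg ⁻¹' D) (fun p => A (-p)) fun p => -B (-p) where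
  base := ⟨neg_lt_neg h.base.2, neg_lt_neg h.base.1⟩
  isOpen := h.isOpen.preimage continuous_neg
  axis := by
    rintro ⟨s, z⟩ ⟨hs, hz⟩
    obtain rfl : z = 0 := hz
    have := h.axis (mem_Jset (s := -s) ⟨by linarith [hs.2], by linarith [hs.1]⟩)
    simpa using this
  strip p hp := by
    have := h.strip _ hp
    simp only [Prod.fst_neg, mem_Ioo] at this
    exact ⟨by linarith [this.2], by linarith [this.1]⟩
  star := by
    intro p hp t ht r hr
    have := h.star _ hp t ht r hr
    rw [mem_preimage]
    convert this using 1
    ext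
    · simp
      ring
    · simp
  smoothA := h.smoothA.comp contDiff_neg.contDiffOn fun p hp => hp
  smoothB := (h.smoothB.comp contDiff_neg.contDiffOn fun p hp => hp).neg
  posA p hp := h.posA _ hp
  zeroB s hs := by
    have := h.zeroB (-s) ⟨by linarith [hs.2], by linarith [hs.1]⟩
    simpa using this
  posScale p hp := by
    have := h.posScale _ hp
    simpa using this
  reversible p hp hFp := by
    rw [billiardMap_reflect, mem_preimage, neg_neg] at hFp
    have := h.reversible _ hp hFp
    rw [billiardMap_reflect, billiardMap_reflect]
    simp only [Prod.fst_neg, Prod.snd_neg, Prod.neg_mk, neg_neg] at this ⊢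
    rw [this]
    simp

/-- A smooth even `S` with `S / z` conjugating `F` to the unit translation. -/
structure IsTranslationSolution (a b : ℝ) (O : Set (ℝ × ℝ)) (A B S : ℝ × ℝ → ℝ) : Prop where
  smooth : SmoothOn S O
  even : ∀ p, S (p.1, -p.2) = S p
  axis : ∀ s ∈ Ioo a b, HasDerivAt (fun s => S (s, 0)) (1 / A (s, 0)) s
  eqn : ∀ p ∈ O, 0 < p.2 → S (billiardMap A B p) / (billiardMap A B p).2 = S p / p.2 + 1

theorem exists_isTransferSolution' (h : IsReversibleMap a b x₀ D A B) {s₁ : ℝ}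
    (hs₁ : s₁ ∈ Ioo a b) {χ : ℝ → ℝ} (hχs : SmoothOn χ (Ioo a b)) (hχ : ∀ s, s₁ ≤ s → χ s = 0) :
    ∃ q₀ O S, IsOpen O ∧ Jset a b ⊆ O ∧ O ⊆ D ∧ IsTransferSolution O A B χ q₀ S ∧ q₀ s₁ = 0 ∧
      ∀ s ∈ Ioo a b, HasDerivAt q₀ (χ s / A (s, 0)) s := by
  have hA : SmoothOn (fun s => χ s / A (s, 0)) (Ioo a b) := by
    refine hχs.div (h.smoothA.comp (ContDiff.contDiffOn (by fun_prop)) fun s hs =>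
      h.axis (mem_Jset hs)) fun s hs => (h.posA _ (h.axis (mem_Jset hs))).ne'
  obtain ⟨q₀, hq₀, hq1, hq', hqv⟩ := exists_smooth_antiderivative hs₁ hA
  obtain ⟨O, S, h1, h2, h3, h4⟩ := exists_isTransferSolution h hs₁ hχs hχ hq₀ hq'
    (hqv fun s hs _ => by rw [hχ s hs, zero_div])
  exact ⟨q₀, O, S, h1, h2, h3, h4, hq1, hq'⟩

theorem nonneg_sub_of_deriv_nonneg {q g : ℝ → ℝ} (hq : ∀ s ∈ Ioo a b, HasDerivAt q (g s) s)
    (hg : ∀ s ∈ Ioo a b, 0 ≤ g s) {x y : ℝ} (hx : x ∈ Ioo a b) (hy : y ∈ Ioo a b) (hxy : x ≤ y) :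
    q x ≤ q y := by
  refine monotoneOn_of_deriv_nonneg (convex_Ioo a b)
    (fun s hs => (hq s hs).continuousAt.continuousWithinAt) (fun s hs => ?_) (fun s hs => ?_)
    hx hy hxy
  · exact (hq s (interior_subset hs)).differentiableAt.differentiableWithinAt
  · rw [(hq s (interior_subset hs)).deriv]
    exact hg s (interior_subset hs)

theorem exists_isTranslationSolution (h : IsReversibleMap a b x₀ D A B) :
    ∃ O S, IsOpen O ∧ Jset a b ⊆ O ∧ O ⊆ D ∧ IsTranslationSolution a b O A B S ∧
      ∃ s₀ ∈ Ioo a b, S (s₀, 0) = 0 := by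
  obtain ⟨l, hal, hlx⟩ := exists_between h.base.1
  obtain ⟨r, hxr, hrb⟩ := exists_between h.base.2
  have hlr : 0 < r - l := by linarith
  have hl : l ∈ Ioo a b := ⟨hal, hlx.trans h.base.2⟩
  have hr : r ∈ Ioo a b := ⟨h.base.1.trans hxr, hrb⟩
  set χ : ℝ → ℝ := fun s => Real.smoothTransition ((s - l) / (r - l)) with hχ
  have hχs : ContDiff ℝ (⊤ : ℕ∞) χ := Real.smoothTransition.contDiff.comp (by fun_prop)
  have hχ0 : ∀ s, s ≤ l → χ s = 0 := fun s hs =>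
    Real.smoothTransition.zero_of_nonpos (div_nonpos_of_nonpos_of_nonneg (by linarith) hlr.le)
  have hχ1 : ∀ s, r ≤ s → 1 - χ s = 0 := fun s hs => by
    rw [sub_eq_zero, eq_comm]
    exact Real.smoothTransition.one_of_one_le ((one_le_div hlr).2 (by linarith))
  obtain ⟨q₁, O₁, S₁, hO₁, hJ₁, hD₁, hS₁, hq₁, hq₁'⟩ := exists_isTransferSolution' h hr
    (χ := fun s => 1 - χ s) (contDiff_const.sub hχs).contDiffOn hχ1
  obtain ⟨q₂, O₂, S₂, hO₂, hJ₂, hD₂, hS₂, hq₂, hq₂'⟩ := exists_isTransferSolution' h.reflect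
    (s₁ := -l) ⟨by linarith [hl.2], by linarith [hl.1]⟩ (χ := fun s => χ (-s))
    (hχs.comp contDiff_neg).contDiffOn (fun s hs => hχ0 _ (by linarith))
  have hσ : Continuous fun p : ℝ × ℝ => (-p.1, p.2) := by fun_prop
  set O₂' : Set (ℝ × ℝ) := (fun p : ℝ × ℝ => (-p.1, p.2)) ⁻¹' O₂ with hO₂'
  have hO₂'o : IsOpen O₂' := hO₂.preimage hσ
  have hJ₂' : Jset a b ⊆ O₂' := by
    rintro ⟨s, z⟩ ⟨hs, hz⟩
    obtain rfl : z = 0 := hz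
    exact hJ₂ (mem_Jset ⟨by linarith [hs.2], by linarith [hs.1]⟩)
  set O : Set (ℝ × ℝ) := O₁ ∩ O₂' ∩ (D ∩ billiardMap A B ⁻¹' (D ∩ O₂')) with hO
  set S : ℝ × ℝ → ℝ := fun p => S₁ p - S₂ (-p.1, p.2) with hS
  have hJ : Jset a b ⊆ O := by
    intro p hp
    refine ⟨⟨hJ₁ hp, hJ₂' hp⟩, h.axis hp, ?_⟩
    have : billiardMap A B p = p := by
      obtain ⟨s, z⟩ := p
      obtain rfl : z = 0 := hp.2
      exact billiardMap_axis s
    rw [mem_preimage, this]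
    exact ⟨h.axis hp, hJ₂' hp⟩
  have hSaxis : ∀ s, S (s, 0) = q₁ s - q₂ (-s) := fun s => by simp [hS, hS₁.axis, hS₂.axis]
  have hq₂r : ∀ s ∈ Ioo a b, HasDerivAt (fun s => -q₂ (-s)) (χ s / A (s, 0)) s := by
    intro s hs
    have h1 := hq₂' (-s) ⟨by linarith [hs.2], by linarith [hs.1]⟩
    refine ((h1.comp s (hasDerivAt_neg s)).neg).congr_deriv ?_
    simp
  have hAp : ∀ s ∈ Ioo a b, 0 < A (s, 0) := fun s hs => h.posA _ (h.axis (mem_Jset hs))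
  have hSder : ∀ s ∈ Ioo a b, HasDerivAt (fun s => S (s, 0)) (1 / A (s, 0)) s := by
    intro s hs
    simp only [hSaxis]
    refine ((hq₁' s hs).add (hq₂r s hs)).congr_deriv ?_
    rw [← add_div, sub_add_cancel]
  refine ⟨O, S, (hO₁.inter hO₂'o).inter (h.smooth.continuousOn.isOpen_inter_preimage h.isOpen
    (h.isOpen.inter hO₂'o)), hJ, fun p hp => hp.2.1, ⟨?_, ?_, hSder, ?_⟩, ?_⟩
  · exact (hS₁.smooth.mono fun p hp => hp.1.1).sub (hS₂.smooth.comp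
      (ContDiff.contDiffOn (by fun_prop : ContDiff ℝ (⊤ : ℕ∞) fun p : ℝ × ℝ => (-p.1, p.2)))
      fun p hp => hp.1.2)
  · intro p
    simp only [hS]
    rw [hS₁.even, hS₂.even (-p.1, p.2)]
  · intro p hp hz
    have e1 := hS₁.eqn p hp.1.1 hz
    have hz' := h.snd_pos hp.2.1 hz
    have e2 := hS₂.eqn (-(billiardMap A B p).1, (billiardMap A B p).2) hp.2.2.2 hz'
    have e3 : billiardMap (fun q => A (-q)) (fun q => -B (-q))
        (-(billiardMap A B p).1, (billiardMap A B p).2) = (-p.1, p.2) := by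
      rw [billiardMap_reflect]
      have := h.reversible p hp.2.1 hp.2.2.1
      simp only [Prod.neg_mk, neg_neg]
      rw [this]
      simp
    rw [e3] at e2
    simp only [neg_neg] at e2
    simp only [hS, sub_div]
    linear_combination e1 + e2
  · have hχn : ∀ s, 0 ≤ χ s := fun s => Real.smoothTransition.nonneg _
    have hχl : ∀ s, 0 ≤ 1 - χ s := fun s => sub_nonneg.2 (Real.smoothTransition.le_one _)
    have h1 : S (l, 0) ≤ 0 := by
      rw [hSaxis, hq₂, sub_zero, ← hq₁]
      exact nonneg_sub_of_deriv_nonneg hq₁' (fun s hs => div_nonneg (hχl s) (hAp s hs).le) hl hr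
        (by linarith)
    have h2 : 0 ≤ S (r, 0) := by
      rw [hSaxis, hq₁, zero_sub]
      have := nonneg_sub_of_deriv_nonneg hq₂r (fun s hs => div_nonneg (hχn s) (hAp s hs).le) hl hr
        (by linarith)
      simpa [hq₂] using this
    have hsub : Icc l r ⊆ Ioo a b := fun x hx => ⟨hal.trans_le hx.1, hx.2.trans_lt hrb⟩
    obtain ⟨s₀, hs₀, h0⟩ := intermediate_value_Icc (f := fun s => S (s, 0)) (by linarith)
      (fun s hs => (hSder s (hsub hs)).continuousAt.continuousWithinAt) ⟨h1, h2⟩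
    exact ⟨s₀, hsub hs₀, h0⟩

end TwoSided

section PlaneTools

theorem det_eq_of_prod (L : ℝ × ℝ →L[ℝ] ℝ × ℝ) :
    L.det = (L (1, 0)).1 * (L (0, 1)).2 - (L (0, 1)).1 * (L (1, 0)).2 := by
  have h := LinearMap.det_toMatrix (Module.Basis.finTwoProd ℝ) (L : ℝ × ℝ →ₗ[ℝ] ℝ × ℝ)
  rw [Matrix.det_fin_two] at h
  simp only [LinearMap.toMatrix_apply, Module.Basis.finTwoProd_zero,
    Module.Basis.finTwoProd_one, ContinuousLinearMap.coe_coe] at h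
  rw [ContinuousLinearMap.det, ← h]
  simp [Module.Basis.coe_finTwoProd_repr]

theorem SmoothOn.exists_inverse {f : ℝ × ℝ → ℝ × ℝ} {D : Set (ℝ × ℝ)} (hD : IsOpen D)
    (hf : SmoothOn f D) (hinj : InjOn f D) (hdet : ∀ p ∈ D, (fderiv ℝ f p).det ≠ 0) :
    IsOpen (f '' D) ∧ ∃ g : ℝ × ℝ → ℝ × ℝ, SmoothOn g (f '' D) ∧ ∀ p ∈ D, g (f p) = p := by
  have key : ∀ p ∈ D, ∃ e : (ℝ × ℝ) ≃L[ℝ] (ℝ × ℝ), HasFDerivAt f e.toContinuousLinearMap p := by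
    intro p hp
    refine ⟨(fderiv ℝ f p).toContinuousLinearEquivOfDetNeZero (hdet p hp), ?_⟩
    rw [ContinuousLinearMap.coe_toContinuousLinearEquivOfDetNeZero]
    exact (hf.differentiableAt' hD hp).hasFDerivAt
  have hopen : ∀ O ⊆ D, IsOpen O → IsOpen (f '' O) := by
    intro O hOD hO
    rw [isOpen_iff_mem_nhds]
    rintro _ ⟨p, hp, rfl⟩
    obtain ⟨e, he⟩ := key p (hOD hp)
    have hs := (hf.contDiffAt (hD.mem_nhds (hOD hp))).hasStrictFDerivAt' he (by simp)
    rw [← hs.map_nhds_eq_of_equiv]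
    exact image_mem_map (hO.mem_nhds hp)
  refine ⟨hopen D Subset.rfl hD, Function.invFunOn f D, ?_, fun p hp => hinj.leftInvOn_invFunOn hp⟩
  rintro _ ⟨p, hp, rfl⟩
  obtain ⟨e, he⟩ := key p hp
  have hc := hf.contDiffAt (hD.mem_nhds hp)
  have hl := hc.to_localInverse he (by simp)
  refine ContDiffAt.contDiffWithinAt (hl.congr_of_eventuallyEq ?_)
  have hs := hc.hasStrictFDerivAt' he (by simp)
  have hev : ∀ᶠ x in 𝓝 p, hc.localInverse he (by simp) (f x) = x :=
    hs.eventually_left_inverse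
  rw [← hs.map_nhds_eq_of_equiv]
  rw [EventuallyEq, eventually_map]
  filter_upwards [hev, hD.mem_nhds hp] with x hx hxD
  rw [hx]
  exact hinj.leftInvOn_invFunOn hxD

end PlaneTools

section RadialEuler

variable {W : Set (ℝ × ℝ)}

theorem BoxStar.smul_mem (hst : BoxStar 0 W) {q : ℝ × ℝ} (hq : q ∈ W) {t : ℝ}
    (ht : t ∈ Icc (0 : ℝ) 1) : t • q ∈ W := by
  have := hst q hq t ht t ⟨by linarith [ht.1], ht.2⟩
  simpa [Prod.smul_def] using this

theorem exists_radial_average (hW : IsOpen W) (hst : BoxStar 0 W) {σ : ℝ × ℝ → ℝ}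
    (hσ : SmoothOn σ W) : ∃ k : ℝ × ℝ → ℝ, SmoothOn k W ∧
      (∀ q, k q = ∫ t in (0:ℝ)..1, 2 * t ^ 2 * σ (t • q)) ∧
      ∀ q ∈ W, 3 * k q + fderiv ℝ k q q = 2 * σ q := by
  set k : ℝ × ℝ → ℝ := fun q => ∫ t in (0:ℝ)..1, 2 * t ^ 2 * σ (t • q) with hk
  have hsm : SmoothOn k W := by
    have hΩ : IsOpen {x : (ℝ × ℝ) × ℝ | x.2 • x.1 ∈ W} :=
      hW.preimage (by fun_prop : Continuous fun x : (ℝ × ℝ) × ℝ => x.2 • x.1)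
    have hg : SmoothOn (fun x : (ℝ × ℝ) × ℝ => 2 * x.2 ^ 2 * σ (x.2 • x.1))
        {x : (ℝ × ℝ) × ℝ | x.2 • x.1 ∈ W} := by
      refine ContDiffOn.mul (by fun_prop) ?_
      exact hσ.comp (f := fun x : (ℝ × ℝ) × ℝ => x.2 • x.1)
        (contDiff_snd.smul contDiff_fst).contDiffOn fun x hx => hx
    exact smoothOn_integral_unitInterval hΩ hg hW fun x hx t ht => hst.smul_mem hx ht
  refine ⟨k, hsm, fun q => rfl, fun q hq => ?_⟩
  have hray : Continuous fun r : ℝ => r • q := by fun_prop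
  have hO : IsOpen {r : ℝ | r • q ∈ W} := hW.preimage hray
  have hsub : Icc (0 : ℝ) 1 ⊆ {r : ℝ | r • q ∈ W} := fun t ht => hst.smul_mem hq ht
  have hcont : ContinuousOn (fun u : ℝ => 2 * u ^ 2 * σ (u • q)) {r : ℝ | r • q ∈ W} :=
    ContinuousOn.mul (by fun_prop) (hσ.continuousOn.comp hray.continuousOn fun r hr => hr)
  have h1 : HasDerivAt (fun r : ℝ => ∫ u in (0:ℝ)..r, 2 * u ^ 2 * σ (u • q)) (2 * σ q) 1 := by
    have := intervalIntegral.integral_hasDerivAt_right (a := (0:ℝ)) (b := 1)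
      (f := fun u : ℝ => 2 * u ^ 2 * σ (u • q))
      ((hcont.mono (by rwa [uIcc_of_le zero_le_one])).intervalIntegrable)
      (hcont.stronglyMeasurableAtFilter hO 1 (hsub (by simp)))
      (hcont.continuousAt (hO.mem_nhds (hsub (by simp))))
    simpa using this
  have h2 : HasDerivAt (fun r : ℝ => r ^ 3 * k (r • q)) (3 * k q + fderiv ℝ k q q) 1 := by
    have hd : HasFDerivAt k (fderiv ℝ k q) ((1:ℝ) • q) := by
      rw [one_smul]; exact (hsm.differentiableAt' hW hq).hasFDerivAt
    have hr : HasDerivAt (fun r : ℝ => r • q) ((1:ℝ) • q) 1 := (hasDerivAt_id 1).smul_const q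
    have := (hasDerivAt_pow 3 (1:ℝ)).mul (hd.comp_hasDerivAt (1:ℝ) hr)
    refine this.congr_deriv ?_
    simp
  have heq : (fun r : ℝ => r ^ 3 * k (r • q)) = fun r : ℝ =>
      ∫ u in (0:ℝ)..r, 2 * u ^ 2 * σ (u • q) := by
    funext r
    have := intervalIntegral.mul_integral_comp_mul_right (a := (0:ℝ)) (b := 1) (c := r)
      (f := fun u : ℝ => 2 * u ^ 2 * σ (u • q))
    simp only [zero_mul, one_mul] at this
    rw [← this, hk]
    simp only
    rw [← intervalIntegral.integral_const_mul, ← intervalIntegral.integral_const_mul]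
    refine intervalIntegral.integral_congr fun t _ => ?_
    simp only [smul_smul]
    ring
  rw [heq] at h2
  exact h2.unique h1

/-- A solution of the transport equation saying that the radial rescaling by `m`
turns `σ` times Lebesgue measure into its normal form. -/
structure IsRadialScale (W : Set (ℝ × ℝ)) (σ m : ℝ × ℝ → ℝ) : Prop where
  smooth : SmoothOn m W
  even : EvenOn m W
  pos : ∀ q ∈ W, 0 < m q
  eqn : ∀ q ∈ W, m q ^ 2 * (m q + fderiv ℝ m q q) = σ q

theorem exists_isRadialScale (hW : IsOpen W) (hst : BoxStar 0 W) {σ : ℝ × ℝ → ℝ}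
    (hσ : SmoothOn σ W) (heven : EvenOn σ W) (hpos : ∀ q ∈ W, 0 < σ q) :
    ∃ m, IsRadialScale W σ m := by
  obtain ⟨k, hk, hkdef, hE⟩ := exists_radial_average hW hst hσ
  have hkpos : ∀ q ∈ W, 0 < k q := by
    intro q hq
    rw [hkdef]
    have hc : ContinuousOn (fun t : ℝ => 2 * t ^ 2 * σ (t • q)) (Icc 0 1) :=
      ContinuousOn.mul (by fun_prop) (hσ.continuousOn.comp
        (by fun_prop : Continuous fun r : ℝ => r • q).continuousOn fun t ht => hst.smul_mem hq ht)
    refine intervalIntegral.intervalIntegral_pos_of_pos_on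
      (ContinuousOn.intervalIntegrable (by rwa [uIcc_of_le zero_le_one])) (fun t ht => ?_)
      zero_lt_one
    have := hpos _ (hst.smul_mem hq (Ioo_subset_Icc_self ht))
    have := ht.1
    positivity
  set m : ℝ × ℝ → ℝ := fun q => (3 / 2 * k q) ^ ((1:ℝ) / 3) with hm
  have hmpos : ∀ q ∈ W, 0 < m q := fun q hq => by
    have := hkpos q hq
    simp only [hm]; positivity
  have hcube : ∀ q ∈ W, m q ^ 3 = 3 / 2 * k q := by
    intro q hq
    have := hkpos q hq
    simp only [hm]
    rw [← Real.rpow_natCast, ← Real.rpow_mul (by positivity)]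
    norm_num
  have hmsm : SmoothOn m W := by
    intro q hq
    have := hkpos q hq
    exact ContDiffWithinAt.rpow_const_of_ne (contDiffWithinAt_const.mul (hk q hq)) (by positivity)
  refine ⟨m, hmsm, ?_, hmpos, ?_⟩
  · intro q hq
    simp only [hm, hkdef]
    congr 2
    refine intervalIntegral.integral_congr fun t ht => ?_
    rw [uIcc_of_le zero_le_one] at ht
    have := heven _ (hst.smul_mem hq ht)
    simp only [Prod.smul_mk, Prod.smul_fst, Prod.smul_snd, smul_eq_mul, mul_neg] at this ⊢
    rw [this]
  · intro q hq
    have hd := (hmsm.differentiableAt' hW hq).hasFDerivAt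
    have hd3 : HasFDerivAt (fun q => m q ^ 3) ((3 / 2 : ℝ) • fderiv ℝ k q) q := by
      refine (((hk.differentiableAt' hW hq).hasFDerivAt).const_mul (3 / 2 : ℝ)).congr_of_eventuallyEq
        ?_
      filter_upwards [hW.mem_nhds hq] with x hx using hcube x hx
    have h := congrArg (fun L : ℝ × ℝ →L[ℝ] ℝ => L q) ((hd.pow 3).unique hd3)
    simp at h
    have h1 := hE q hq
    have h2 := hcube q hq
    nlinarith

theorem IsRadialScale.hasDerivAt_ray (hW : IsOpen W) {σ m : ℝ × ℝ → ℝ}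
    (h : IsRadialScale W σ m) {q : ℝ × ℝ} {t : ℝ} (ht : t • q ∈ W) :
    HasDerivAt (fun t : ℝ => t * m (t • q)) (σ (t • q) / m (t • q) ^ 2) t := by
  have hr : HasDerivAt (fun r : ℝ => r • q) ((1:ℝ) • q) t := (hasDerivAt_id t).smul_const q
  have := (hasDerivAt_id t).mul
    (((h.smooth.differentiableAt' hW ht).hasFDerivAt).comp_hasDerivAt t hr)
  refine this.congr_deriv ?_
  have hp := (h.pos _ ht).ne'
  rw [eq_div_iff (pow_ne_zero 2 hp), ← h.eqn _ ht]
  have : fderiv ℝ m (t • q) (t • q) = t * fderiv ℝ m (t • q) q := by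
    rw [map_smul, smul_eq_mul]
  rw [this]
  simp
  ring

theorem IsRadialScale.injOn (hW : IsOpen W) (hst : BoxStar 0 W) {σ m : ℝ × ℝ → ℝ}
    (hpos : ∀ q ∈ W, 0 < σ q) (h : IsRadialScale W σ m) : InjOn (fun q => m q • q) W := by
  have aux : ∀ q ∈ W, ∀ q' ∈ W, m q • q = m q' • q' → m q ≤ m q' → q = q' := by
    intro q hq q' hq' he hle
    have hm' := h.pos q' hq'
    have hm := h.pos q hq
    set l := m q / m q' with hl
    have hl0 : 0 < l := div_pos hm hm'
    have hl1 : l ≤ 1 := (div_le_one hm').2 hle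
    have hq'e : q' = l • q := by
      rw [hl, div_eq_inv_mul, mul_smul, he, smul_smul, inv_mul_cancel₀ hm'.ne', one_smul]
    have hmono : StrictMonoOn (fun t : ℝ => t * m (t • q)) (Icc 0 1) := by
      refine strictMonoOn_of_deriv_pos (convex_Icc 0 1) (fun t ht =>
        (h.hasDerivAt_ray hW (hst.smul_mem hq ht)).continuousAt.continuousWithinAt) fun t ht => ?_
      rw [interior_Icc] at ht
      have hmem := hst.smul_mem hq (Ioo_subset_Icc_self ht)
      rw [(h.hasDerivAt_ray hW hmem).deriv]
      exact div_pos (hpos _ hmem) (pow_pos (h.pos _ hmem) 2)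
    have : l = 1 := by
      refine hmono.injOn ⟨hl0.le, hl1⟩ ⟨zero_le_one, le_rfl⟩ ?_
      simp only [one_smul, one_mul]
      rw [← hq'e, hl]
      field_simp
    rw [hq'e, this, one_smul]
  intro q hq q' hq' he
  rcases le_total (m q) (m q') with hle | hle
  · exact aux q hq q' hq' he hle
  · exact (aux q' hq' q hq he.symm hle).symm

theorem IsRadialScale.det_fderiv (hW : IsOpen W) {σ m : ℝ × ℝ → ℝ}
    (h : IsRadialScale W σ m) {q : ℝ × ℝ} (hq : q ∈ W) :
    (fderiv ℝ (fun q => m q • q) q).det = σ q / m q := by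
  have hd := ((h.smooth.differentiableAt' hW hq).hasFDerivAt).smul (hasFDerivAt_id q)
  have hp := (h.pos _ hq).ne'
  have hlin : fderiv ℝ m q q = q.1 * fderiv ℝ m q (1, 0) + q.2 * fderiv ℝ m q (0, 1) := by
    have : q = q.1 • ((1:ℝ), (0:ℝ)) + q.2 • ((0:ℝ), (1:ℝ)) := by ext <;> simp
    have h2 := congrArg (fderiv ℝ m q) this
    rwa [map_add, map_smul, map_smul, smul_eq_mul, smul_eq_mul] at h2
  have heq := h.eqn q hq
  rw [hlin] at heq
  have hfd : fderiv ℝ (fun q => m q • q) q = _ := hd.fderiv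
  rw [det_eq_of_prod, hfd, eq_div_iff hp, ← heq]
  simp
  ring

end RadialEuler

section RadialInvariance

variable {W Y : Set (ℝ × ℝ)} {σ m : ℝ × ℝ → ℝ} {T : ℝ × ℝ → ℝ × ℝ}

theorem apply_eq_coordinates (L : ℝ × ℝ →L[ℝ] ℝ × ℝ) (q : ℝ × ℝ) :
    (L q).2 = q.1 * (L (1, 0)).2 + q.2 * (L (0, 1)).2 := by
  have h : q = q.1 • ((1:ℝ), (0:ℝ)) + q.2 • ((0:ℝ), (1:ℝ)) := by ext <;> simp
  have h2 := congrArg (fun v => (L v).2) h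
  simpa only [map_add, map_smul, Prod.snd_add, Prod.smul_snd, smul_eq_mul] using h2

theorem det_of_translation_identity (hY : IsOpen Y) (hT : SmoothOn T Y)
    (htrans : ∀ q ∈ Y, 0 < q.2 → q.2 * (T q).1 = (q.1 + q.2) * (T q).2)
    {p : ℝ × ℝ} (hp : p ∈ Y) (hz : 0 < p.2) :
    p.2 ^ 2 * (fderiv ℝ T p).det = (T p).2 * (fderiv ℝ T p p).2 := by
  have hd := (hT.differentiableAt' hY hp).hasFDerivAt
  have h1 : HasFDerivAt (fun q : ℝ × ℝ => q.2 * (T q).1) _ p := hasFDerivAt_snd.mul hd.fst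
  have h2 : HasFDerivAt (fun q : ℝ × ℝ => (q.1 + q.2) * (T q).2) _ p :=
    (hasFDerivAt_fst.add hasFDerivAt_snd).mul hd.snd
  have h3 := h1.congr_of_eventuallyEq (f₁ := fun q : ℝ × ℝ => (q.1 + q.2) * (T q).2) (by
    filter_upwards [hY.mem_nhds hp, (isOpen_lt continuous_const continuous_snd).mem_nhds hz]
      with x hx hxz using (htrans x hx hxz).symm)
  have he := h3.unique h2
  have ex := congrArg (fun L : ℝ × ℝ →L[ℝ] ℝ => L (1, 0)) he
  have ez := congrArg (fun L : ℝ × ℝ →L[ℝ] ℝ => L (0, 1)) he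
  simp at ex ez
  have h0 := htrans p hp hz
  rw [det_eq_of_prod, apply_eq_coordinates (fderiv ℝ T p) p]
  set x1 := (fderiv ℝ T p (1, 0)).1
  set x2 := (fderiv ℝ T p (1, 0)).2
  set z1 := (fderiv ℝ T p (0, 1)).1
  set z2 := (fderiv ℝ T p (0, 1)).2
  linear_combination p.2 * z2 * ex - p.2 * x2 * ez + x2 * h0

theorem IsRadialScale.invariant (hW : IsOpen W) (h : IsRadialScale W σ m)
    (hst : BoxStar 0 W) (hY : IsOpen Y) (hYW : Y ⊆ W) (hYst : BoxStar 0 Y)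
    (hTW : ∀ q ∈ Y, T q ∈ W) (hT : SmoothOn T Y) (hT0 : T 0 = 0)
    (htrans : ∀ q ∈ Y, 0 < q.2 → q.2 * (T q).1 = (q.1 + q.2) * (T q).2)
    (harea : ∀ q ∈ Y, 0 < q.2 →
      (T q).2 * σ (T q) * (fderiv ℝ T q).det = q.2 * σ q)
    {q : ℝ × ℝ} (hq : q ∈ Y) (hz : 0 < q.2) : (T q).2 * m (T q) = q.2 * m q := by
  set e : ℝ × ℝ := (q.1 / q.2 + 1, 1) with he
  have hray : Continuous fun r : ℝ => r • q := by fun_prop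
  have hmemY : ∀ t ∈ Icc (0:ℝ) 1, t • q ∈ Y := fun t ht => hYst.smul_mem hq ht
  have hTe : ∀ t : ℝ, 0 < t → t • q ∈ Y → T (t • q) = (T (t • q)).2 • e := by
    intro t ht hY
    have := htrans _ hY (by simp; positivity)
    simp only [Prod.smul_fst, Prod.smul_snd, smul_eq_mul] at this
    ext
    · simp only [he, Prod.smul_fst, smul_eq_mul]
      field_simp
      have h2 : t * (q.2 * (T (t • q)).1) = t * ((q.1 + q.2) * (T (t • q)).2) := by
        linear_combination this
      linear_combination mul_left_cancel₀ ht.ne' h2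
    · simp [he]
  have hcT : ContinuousOn (fun t : ℝ => T (t • q)) (Icc 0 1) :=
    hT.continuousOn.comp hray.continuousOn hmemY
  have hcont : ContinuousOn (fun t : ℝ => ((T (t • q)).2 * m (T (t • q))) ^ 3
      - (t * q.2 * m (t • q)) ^ 3) (Icc 0 1) := by
    refine ContinuousOn.sub (ContinuousOn.pow (ContinuousOn.mul ?_ ?_) 3)
      (ContinuousOn.pow (ContinuousOn.mul (by fun_prop) ?_) 3)
    · exact continuous_snd.comp_continuousOn hcT
    · exact h.smooth.continuousOn.comp hcT fun t ht => hTW _ (hmemY t ht)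
    · exact h.smooth.continuousOn.comp hray.continuousOn fun t ht => hst.smul_mem (hYW hq) ht
  have hder : ∀ t ∈ Ioo (0:ℝ) 1, HasDerivAt (fun t : ℝ => ((T (t • q)).2 * m (T (t • q))) ^ 3
      - (t * q.2 * m (t • q)) ^ 3) 0 t := by
    intro t ht
    have htY := hmemY t (Ioo_subset_Icc_self ht)
    have hr : HasDerivAt (fun r : ℝ => r • q) ((1:ℝ) • q) t := (hasDerivAt_id t).smul_const q
    have hdT : HasDerivAt (fun r : ℝ => T (r • q)) (fderiv ℝ T (t • q) ((1:ℝ) • q)) t :=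
      ((hT.differentiableAt' hY htY).hasFDerivAt).comp_hasDerivAt t hr
    have hu : HasDerivAt (fun r : ℝ => (T (r • q)).2) (fderiv ℝ T (t • q) ((1:ℝ) • q)).2 t :=
      hdT.snd
    have hWe : (T (t • q)).2 • e ∈ W := by rw [← hTe t ht.1 htY]; exact hTW _ htY
    have hm1 : HasDerivAt (fun r : ℝ => (T (r • q)).2 * m ((T (r • q)).2 • e))
        ((fderiv ℝ T (t • q) ((1:ℝ) • q)).2 • (σ ((T (t • q)).2 • e) / m ((T (t • q)).2 • e) ^ 2)) t :=
      HasDerivAt.scomp (g₁ := fun r : ℝ => r * m (r • e)) t (h.hasDerivAt_ray hW hWe) hu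
    rw [← hTe t ht.1 htY] at hm1
    have hm2 := hm1.congr_of_eventuallyEq (f₁ := fun r : ℝ => (T (r • q)).2 * m (T (r • q))) (by
      filter_upwards [(hY.preimage hray).mem_nhds htY, Ioi_mem_nhds ht.1] with r hr hr0
      have := hTe r hr0 hr
      exact congrArg (fun v => (T (r • q)).2 * m v) this)
    have hm3 := (h.hasDerivAt_ray hW (hYW htY)).const_mul q.2
    have hm4 := hm3.congr_of_eventuallyEq (f₁ := fun r : ℝ => r * q.2 * m (r • q))
      (Eventually.of_forall fun r => by simp only; ring)
    refine ((hm2.fun_pow 3).sub (hm4.fun_pow 3)).congr_deriv ?_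
    have hz' : 0 < (t • q).2 := by simp; exact mul_pos ht.1 hz
    have hdet := det_of_translation_identity hY hT htrans htY hz'
    have hA := harea _ htY hz'
    have hmT := (h.pos _ (hTW _ htY)).ne'
    have hmq := (h.pos _ (hYW htY)).ne'
    have hE : (fderiv ℝ T (t • q) (t • q)).2 = t * (fderiv ℝ T (t • q) q).2 := by
      rw [map_smul]; rfl
    rw [hE] at hdet
    rw [one_smul]
    simp only [Prod.smul_snd, smul_eq_mul] at hdet hA hz'
    set v := (fderiv ℝ T (t • q) q).2
    set u := (T (t • q)).2
    set d := (fderiv ℝ T (t • q)).det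
    have key : u ^ 2 * σ (T (t • q)) * v = t ^ 2 * q.2 ^ 3 * σ (t • q) := by
      refine mul_left_cancel₀ ht.1.ne' ?_
      linear_combination (t * q.2) ^ 2 * hA - u * σ (T (t • q)) * hdet
    clear_value u v d
    generalize m (T (t • q)) = m₁ at *
    generalize m (t • q) = m₂ at *
    generalize σ (T (t • q)) = σ₁ at *
    generalize σ (t • q) = σ₂ at *
    simp only [Nat.cast_ofNat, smul_eq_mul]
    field_simp
    linear_combination 3 * m₁ ^ 2 * m₂ ^ 2 * key
  obtain ⟨c, hc, hslope⟩ := exists_hasDerivAt_eq_slope _ _ zero_lt_one hcont hder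
  simp [hT0] at hslope
  have : ((T q).2 * m (T q)) ^ 3 = (q.2 * m q) ^ 3 := by linarith
  exact (Odd.strictMono_pow (by decide : Odd 3)).injective this

end RadialInvariance

section Straightening

variable {a b x₀ s₀ : ℝ} {D O D₁ : Set (ℝ × ℝ)} {A B S : ℝ × ℝ → ℝ}

theorem exists_fderiv_fst_pos_region (h : IsReversibleMap a b x₀ D A B) (hO : IsOpen O)
    (hJ : Jset a b ⊆ O) (hS : IsTranslationSolution a b O A B S) (hs₀ : s₀ ∈ Ioo a b) :
    ∃ D₁, IsOpen D₁ ∧ Jset a b ⊆ D₁ ∧ D₁ ⊆ O ∧ BoxStar s₀ D₁ ∧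
      ∀ p ∈ D₁, 0 < fderiv ℝ S p (1, 0) := by
  have hc : ContinuousOn (fun p => fderiv ℝ S p (1, 0)) O :=
    (hS.smooth.continuousOn_fderiv_of_isOpen hO (by simp)).clm_apply continuousOn_const
  have hO₁ : IsOpen (O ∩ (fun p => fderiv ℝ S p (1, 0)) ⁻¹' Ioi 0) :=
    hc.isOpen_inter_preimage hO isOpen_Ioi
  refine ⟨boxHull s₀ (O ∩ (fun p => fderiv ℝ S p (1, 0)) ⁻¹' Ioi 0), isOpen_boxHull _ hO₁,
    Jset_subset_boxHull hs₀ ?_, (boxHull_subset _ _).trans inter_subset_left,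
    boxStar_boxHull _ _, fun p hp => (boxHull_subset _ _ hp).2⟩
  rintro ⟨s, z⟩ ⟨hs, hz⟩
  obtain rfl : z = 0 := hz
  have hsO := hJ (mem_Jset hs)
  refine ⟨hsO, ?_⟩
  have h1 := (hS.smooth.differentiableAt' hO hsO).hasFDerivAt.comp_hasDerivAt s
    ((hasDerivAt_id s).prodMk (hasDerivAt_const s (0:ℝ)))
  have h2 := h1.unique (hS.axis s hs)
  simp only [mem_preimage, mem_Ioi]
  rw [h2]
  exact one_div_pos.2 (h.posA _ (h.axis (mem_Jset hs)))

theorem injOn_straighten (hD₁ : IsOpen D₁) (hst : BoxStar s₀ D₁) (hS : SmoothOn S D₁)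
    (hpos : ∀ p ∈ D₁, 0 < fderiv ℝ S p (1, 0)) :
    InjOn (fun p : ℝ × ℝ => (S p, p.2)) D₁ := by
  rintro ⟨x, z⟩ hx ⟨y, z'⟩ hy he
  simp only [Prod.mk.injEq] at he
  obtain ⟨he, rfl⟩ := he
  have hconv : Convex ℝ {x : ℝ | (x, z) ∈ D₁} := by
    refine OrdConnected.convex ⟨fun u hu v hv t ht => ?_⟩
    have aux : ∀ u : ℝ, (u, z) ∈ D₁ → ∀ t, (s₀ ≤ t ∧ t ≤ u ∨ u ≤ t ∧ t ≤ s₀) → (t, z) ∈ D₁ := by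
      intro u hu t ht
      rcases eq_or_ne u s₀ with rfl | hne
      · have : t = u := by rcases ht with ht | ht <;> linarith [ht.1, ht.2]
        rwa [this]
      have hne' : u - s₀ ≠ 0 := sub_ne_zero.2 hne
      have h01 : (t - s₀) / (u - s₀) ∈ Icc (0:ℝ) 1 := by
        rcases ht with ht | ht
        · have : 0 < u - s₀ := lt_of_le_of_ne (by linarith [ht.1, ht.2]) hne'.symm
          exact ⟨div_nonneg (by linarith [ht.1]) this.le, (div_le_one this).2 (by linarith [ht.2])⟩
        · have : u - s₀ < 0 := lt_of_le_of_ne (by linarith [ht.1, ht.2]) hne'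
          exact ⟨div_nonneg_of_nonpos (by linarith [ht.2]) this.le,
            (div_le_one_of_neg this).2 (by linarith [ht.1])⟩
      have := hst _ hu _ h01 1 (by simp)
      simpa [div_mul_cancel₀ _ hne'] using this
    rcases le_total s₀ t with h | h
    · exact aux v hv t (Or.inl ⟨h, ht.2⟩)
    · exact aux u hu t (Or.inr ⟨ht.1, h⟩)
  have hd : ∀ t, (t, z) ∈ D₁ → HasDerivAt (fun x => S (x, z)) (fderiv ℝ S (t, z) (1, 0)) t :=
    fun t ht => (hS.differentiableAt' hD₁ ht).hasFDerivAt.comp_hasDerivAt t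
      ((hasDerivAt_id t).prodMk (hasDerivAt_const t z))
  have hmono : StrictMonoOn (fun x => S (x, z)) {x : ℝ | (x, z) ∈ D₁} := by
    refine strictMonoOn_of_deriv_pos hconv
      (fun t ht => (hd t ht).continuousAt.continuousWithinAt) fun t ht => ?_
    have ht' := interior_subset ht
    rw [(hd t ht').deriv]
    exact hpos _ ht'
  rw [hmono.injOn hx hy he]

theorem hasFDerivAt_straighten (hD₁ : IsOpen D₁) (hS : SmoothOn S D₁) {p : ℝ × ℝ} (hp : p ∈ D₁) :
    HasFDerivAt (fun p : ℝ × ℝ => (S p, p.2))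
      ((fderiv ℝ S p).prod (ContinuousLinearMap.snd ℝ ℝ ℝ)) p :=
  (hS.differentiableAt' hD₁ hp).hasFDerivAt.prodMk hasFDerivAt_snd

theorem det_straighten (L : ℝ × ℝ →L[ℝ] ℝ) :
    (L.prod (ContinuousLinearMap.snd ℝ ℝ ℝ)).det = L (1, 0) := by
  rw [det_eq_of_prod]
  simp

theorem axis_mem_boxHull_image (hJ : Jset a b ⊆ D₁) (hs₀ : s₀ ∈ Ioo a b) (hS0 : S (s₀, 0) = 0)
    (hS : ContinuousOn (fun s => S (s, 0)) (Ioo a b)) {s : ℝ} (hs : s ∈ Ioo a b) :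
    (S (s, 0), (0 : ℝ)) ∈ boxHull 0 ((fun p : ℝ × ℝ => (S p, p.2)) '' D₁) := by
  refine mem_boxHull_of_axis fun t ht => ?_
  have hoc : OrdConnected ((fun s => S (s, 0)) '' Ioo a b) :=
    (isPreconnected_Ioo.image _ hS).ordConnected
  have hconv := hoc.convex (𝕜 := ℝ)
  obtain ⟨s', hs', he⟩ := hconv.add_smul_sub_mem (mem_image_of_mem _ hs₀)
    (mem_image_of_mem _ hs) ht
  refine ⟨(s', 0), hJ (mem_Jset hs'), ?_⟩
  simp only [hS0, smul_eq_mul] at he ⊢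
  rw [he]

end Straightening

section NormalForm

variable {a b x₀ : ℝ} {D D' : Set (ℝ × ℝ)} {A B S μ : ℝ × ℝ → ℝ} {g : ℝ → ℝ}

/-- The pair `(τ, z μ)` is a system of coordinates putting `billiardMap A B` in normal form,
and turning the measure `z g(s) ds dz` into its standard expression. -/
structure IsNormalizing (a b : ℝ) (D : Set (ℝ × ℝ)) (A B : ℝ × ℝ → ℝ) (g : ℝ → ℝ)
    (τ μ : ℝ × ℝ → ℝ) : Prop where
  smoothτ : SmoothOn τ D
  smoothμ : SmoothOn μ D
  evenτ : EvenOn τ D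
  evenμ : EvenOn μ D
  posμ : ∀ p ∈ D, 0 < μ p
  inj : InjOn (fun p => (τ p, p.2 * μ p)) D
  det : ∀ p ∈ D, (fderiv ℝ (fun p => (τ p, p.2 * μ p)) p).det = g p.1 / μ p
  vert : ∀ p ∈ D, 0 < fderiv ℝ (fun p : ℝ × ℝ => p.2 * μ p) p (0, 1)
  invariant : ∀ p ∈ D, 0 < p.2 →
    (billiardMap A B p).2 * μ (billiardMap A B p) = p.2 * μ p ∧
    τ (billiardMap A B p) = τ p + p.2 * μ p

theorem exists_isNormalizing (h : IsReversibleMap a b x₀ D A B) (hg : SmoothOn g (Ioo a b))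
    (hgpos : ∀ s ∈ Ioo a b, 0 < g s)
    (harea : ∀ p ∈ D, 0 < p.2 → billiardMap A B p ∈ D →
      (billiardMap A B p).2 * g (billiardMap A B p).1 * (fderiv ℝ (billiardMap A B) p).det =
        p.2 * g p.1) :
    ∃ D' τ μ, IsOpen D' ∧ Jset a b ⊆ D' ∧ D' ⊆ D ∧ IsNormalizing a b D' A B g τ μ := by
  obtain ⟨O, S, hO, hJO, hOD, hS, s₀, hs₀, hS0⟩ := exists_isTranslationSolution h
  obtain ⟨D₁, hD₁, hJ₁, hD₁O, hst₁, hpos₁⟩ := exists_fderiv_fst_pos_region h hO hJO hS hs₀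
  have hS₁ : SmoothOn S D₁ := hS.smooth.mono hD₁O
  set κ : ℝ × ℝ → ℝ × ℝ := fun p => (S p, p.2) with hκ
  have hκs : SmoothOn κ D₁ := hS₁.prodMk contDiffOn_snd
  have hκd : ∀ p ∈ D₁, HasFDerivAt κ ((fderiv ℝ S p).prod (ContinuousLinearMap.snd ℝ ℝ ℝ)) p :=
    fun p hp => hasFDerivAt_straighten hD₁ hS₁ hp
  have hκdet : ∀ p ∈ D₁, (fderiv ℝ κ p).det = fderiv ℝ S p (1, 0) := fun p hp => by
    rw [(hκd p hp).fderiv, det_straighten]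
  have hκinj : InjOn κ D₁ := injOn_straighten hD₁ hst₁ hS₁ hpos₁
  obtain ⟨hW₀, P, hP, hPκ⟩ := hκs.exists_inverse hD₁ hκinj fun p hp => by
    rw [hκdet p hp]; exact (hpos₁ p hp).ne'
  have hPmem : ∀ q ∈ κ '' D₁, P q ∈ D₁ ∧ κ (P q) = q := by
    rintro _ ⟨p, hp, rfl⟩
    rw [hPκ p hp]; exact ⟨hp, rfl⟩
  have hPneg : ∀ q ∈ κ '' D₁, P (q.1, -q.2) = ((P q).1, -(P q).2) := by
    rintro _ ⟨p, hp, rfl⟩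
    rw [hPκ p hp, ← hPκ _ (hst₁.neg hp)]
    simp only [hκ, hS.even p]
  set W := boxHull 0 (κ '' D₁) with hWdef
  have hW : IsOpen W := isOpen_boxHull _ hW₀
  have hstW : BoxStar 0 W := boxStar_boxHull _ _
  have hWW₀ : W ⊆ κ '' D₁ := boxHull_subset _ _
  have hScont : ContinuousOn (fun s => S (s, 0)) (Ioo a b) := fun s hs =>
    (hS.axis s hs).continuousAt.continuousWithinAt
  have hJW : ∀ s ∈ Ioo a b, κ (s, 0) ∈ W := fun s hs =>
    axis_mem_boxHull_image hJ₁ hs₀ hS0 hScont hs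
  have hstrip : ∀ p ∈ D₁, p.1 ∈ Ioo a b := fun p hp => h.strip p (hOD (hD₁O hp))
  have hSs : SmoothOn (fun p => fderiv ℝ S p (1, 0)) D₁ :=
    (hS₁.fderiv_of_isOpen hD₁ (by simp)).clm_apply contDiffOn_const
  have hPW : SmoothOn P W := hP.mono hWW₀
  have hPW₁ : MapsTo P W D₁ := fun q hq => (hPmem q (hWW₀ hq)).1
  set σ : ℝ × ℝ → ℝ := fun q => g (P q).1 / fderiv ℝ S (P q) (1, 0) with hσ
  have hσs : SmoothOn σ W := by
    refine ContDiffOn.div ?_ (hSs.comp hPW hPW₁) fun q hq => (hpos₁ _ (hPW₁ hq)).ne'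
    exact hg.comp (contDiff_fst.comp_contDiffOn hPW) fun q hq => hstrip _ (hPW₁ hq)
  have hσe : EvenOn σ W := by
    intro q hq
    simp only [hσ, hPneg q (hWW₀ hq)]
    rw [EvenOn.fderiv_neg hD₁ (fun p hp => hst₁.neg hp) hS₁ (fun p _ => hS.even p) (hPW₁ hq)]
    simp
  have hσpos : ∀ q ∈ W, 0 < σ q := fun q hq =>
    div_pos (hgpos _ (hstrip _ (hPW₁ hq))) (hpos₁ _ (hPW₁ hq))
  obtain ⟨m, hm⟩ := exists_isRadialScale hW hstW hσs hσe hσpos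
  have hFs : SmoothOn (billiardMap A B) D₁ := h.smooth.mono (hD₁O.trans hOD)
  set T : ℝ × ℝ → ℝ × ℝ := fun q => κ (billiardMap A B (P q)) with hT
  set Z : Set (ℝ × ℝ) := W ∩ (fun q => billiardMap A B (P q)) ⁻¹' D₁ with hZ
  have hFP : SmoothOn (fun q => billiardMap A B (P q)) W := hFs.comp hPW hPW₁
  have hZo : IsOpen Z := hFP.continuousOn.isOpen_inter_preimage hW hD₁
  have hTs : SmoothOn T Z := hκs.comp (hFP.mono inter_subset_left) fun q hq => hq.2
  have hY₀ : IsOpen (Z ∩ T ⁻¹' W) := hTs.continuousOn.isOpen_inter_preimage hZo hW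
  set Y := boxHull 0 (Z ∩ T ⁻¹' W) with hY
  have hYo : IsOpen Y := isOpen_boxHull _ hY₀
  have hYsub : Y ⊆ Z ∩ T ⁻¹' W := boxHull_subset _ _
  have hTaxis : ∀ s ∈ Ioo a b, T (κ (s, 0)) = κ (s, 0) := fun s hs => by
    simp only [hT]
    rw [hPκ _ (hJ₁ (mem_Jset hs)), billiardMap_axis]
  have hJY : ∀ s ∈ Ioo a b, κ (s, 0) ∈ Y := by
    intro s hs
    refine mem_boxHull_of_axis fun t ht => ?_
    have hmem : ((0:ℝ) + t * (S (s, 0) - 0), (0:ℝ)) ∈ W := by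
      simpa using hstW _ (hJW s hs) t ht 0 (by simp)
    obtain ⟨p, hp, hpe⟩ := hWW₀ hmem
    have hp2 : p.2 = 0 := congrArg Prod.snd hpe
    have hpe' : p = (p.1, 0) := Prod.ext rfl hp2
    have hps := hstrip p hp
    rw [← hpe] at hmem ⊢
    refine ⟨⟨hmem, ?_⟩, ?_⟩
    · rw [mem_preimage, hPκ p hp, hpe', billiardMap_axis, ← hpe']; exact hp
    · rw [mem_preimage]
      rw [hpe', hTaxis _ hps, ← hpe']; exact hmem
  have hPz : ∀ q ∈ W, (P q).2 = q.2 := fun q hq =>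
    show (κ (P q)).2 = q.2 by rw [(hPmem q (hWW₀ hq)).2]
  have hPS : ∀ q ∈ W, S (P q) = q.1 := fun q hq =>
    show (κ (P q)).1 = q.1 by rw [(hPmem q (hWW₀ hq)).2]
  have hT0 : T 0 = 0 := by
    have := hTaxis s₀ hs₀
    have e0 : κ (s₀, 0) = 0 := by simp [hκ, hS0]
    rwa [e0] at this
  have hYW : Y ⊆ W := fun q hq => (hYsub hq).1.1
  have hinv : ∀ q ∈ Y, 0 < q.2 → (T q).2 * m (T q) = q.2 * m q := by
    intro q hq hz
    refine hm.invariant hW hstW hYo hYW (boxStar_boxHull _ _)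
      (fun q hq => (hYsub hq).2) (hTs.mono fun q hq => (hYsub hq).1) hT0 ?_ ?_ hq hz
    · intro q hq hz
      have hqW := hYW hq
      have hpz : 0 < (P q).2 := by rwa [hPz q hqW]
      have hpD := hD₁O (hPW₁ hqW)
      have he := hS.eqn _ hpD hpz
      have hF := h.snd_pos (hOD hpD) hpz
      rw [hPz q hqW, hPS q hqW] at he
      simp only [hT, hκ]
      field_simp at he
      linarith
    · intro q hq hz
      have hqW := hYW hq
      have hpD₁ := hPW₁ hqW
      have hFD₁ : billiardMap A B (P q) ∈ D₁ := (hYsub hq).1.2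
      have hpz : 0 < (P q).2 := by rwa [hPz q hqW]
      have hA := harea _ (hOD (hD₁O hpD₁)) hpz (hOD (hD₁O hFD₁))
      have hdP := (hPW.differentiableAt' hW hqW).hasFDerivAt
      have hdF := (hFs.differentiableAt' hD₁ hpD₁).hasFDerivAt
      have hdκ := (hκs.differentiableAt' hD₁ hFD₁).hasFDerivAt
      have hdT : HasFDerivAt T ((fderiv ℝ κ (billiardMap A B (P q))).comp
        ((fderiv ℝ (billiardMap A B) (P q)).comp (fderiv ℝ P q))) q :=
        hdκ.comp q (hdF.comp q hdP)
      have hdid : HasFDerivAt (fun q => q) ((fderiv ℝ κ (P q)).comp (fderiv ℝ P q)) q := by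
        refine (((hκs.differentiableAt' hD₁ hpD₁).hasFDerivAt).comp q
          hdP).congr_of_eventuallyEq ?_
        filter_upwards [hW.mem_nhds hqW] with x hx using ((hPmem x (hWW₀ hx)).2).symm
      have hone := congrArg ContinuousLinearMap.det (hdid.unique (hasFDerivAt_id q))
      have hcomp : ∀ L M : ℝ × ℝ →L[ℝ] ℝ × ℝ, (L.comp M).det = L.det * M.det := fun L M =>
        LinearMap.det_comp (L : ℝ × ℝ →ₗ[ℝ] ℝ × ℝ) (M : ℝ × ℝ →ₗ[ℝ] ℝ × ℝ)
      rw [hcomp, hκdet _ hpD₁] at hone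
      have hone' : fderiv ℝ S (P q) (1, 0) * (fderiv ℝ P q).det = 1 := by
        rw [hone, det_eq_of_prod]; simp
      rw [hdT.fderiv, hcomp, hcomp, hκdet _ hFD₁]
      have hPT : P (T q) = billiardMap A B (P q) := hPκ _ hFD₁
      have h1 := (hpos₁ _ hpD₁).ne'
      have h2 := (hpos₁ _ hFD₁).ne'
      simp only [hσ, hPT]
      rw [hPz q hqW] at hA
      have hT2 : (T q).2 = (billiardMap A B (P q)).2 := rfl
      rw [hT2]
      field_simp
      linear_combination hA * (fderiv ℝ S (P q) (1, 0) * (fderiv ℝ P q).det) + q.2 * g (P q).1 * hone'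
  set μ : ℝ × ℝ → ℝ := fun p => m (κ p) with hμ
  set D₂ : Set (ℝ × ℝ) := D₁ ∩ κ ⁻¹' Y with hD₂def
  have hD₂ : IsOpen D₂ := hκs.continuousOn.isOpen_inter_preimage hD₁ hYo
  have hμs : SmoothOn μ D₂ :=
    hm.smooth.comp (hκs.mono inter_subset_left) fun p hp => hYW hp.2
  have hρs : SmoothOn (fun p : ℝ × ℝ => p.2 * μ p) D₂ := contDiffOn_snd.mul hμs
  have hvc : ContinuousOn (fun p => fderiv ℝ (fun p : ℝ × ℝ => p.2 * μ p) p (0, 1)) D₂ :=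
    (hρs.continuousOn_fderiv_of_isOpen hD₂ (by simp)).clm_apply continuousOn_const
  refine ⟨D₂ ∩ (fun p => fderiv ℝ (fun p : ℝ × ℝ => p.2 * μ p) p (0, 1)) ⁻¹' Ioi 0,
    fun p => S p * μ p, μ, hvc.isOpen_inter_preimage hD₂ isOpen_Ioi, ?_,
    fun p hp => hOD (hD₁O hp.1.1), ?_⟩
  · rintro ⟨s, z⟩ ⟨hs, hz⟩
    obtain rfl : z = 0 := hz
    have hmem : (s, (0:ℝ)) ∈ D₂ := ⟨hJ₁ (mem_Jset hs), hJY s hs⟩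
    refine ⟨hmem, ?_⟩
    have hd : HasFDerivAt (fun p : ℝ × ℝ => p.2 * μ p) _ (s, 0) :=
      hasFDerivAt_snd.mul ((hμs.differentiableAt' hD₂ hmem).hasFDerivAt)
    rw [mem_preimage, hd.fderiv]
    simpa using hm.pos _ (hJW s hs)
  have hsub : (D₂ ∩ (fun p => fderiv ℝ (fun p : ℝ × ℝ => p.2 * μ p) p (0, 1)) ⁻¹' Ioi 0) ⊆ D₂ :=
    inter_subset_left
  have hpair : (fun p : ℝ × ℝ => (S p * μ p, p.2 * μ p)) = fun p => m (κ p) • κ p := by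
    funext p
    simp [hμ, hκ, mul_comm]
  refine ⟨((hS₁.mono inter_subset_left).mul hμs).mono hsub, hμs.mono hsub, ?_, ?_, ?_, ?_, ?_, ?_,
    ?_⟩
  · intro p hp
    simp only [hμ, hκ, hS.even p]
    rw [hm.even (S p, p.2) (hYW hp.1.2)]
  · intro p hp
    simp only [hμ, hκ, hS.even p]
    exact hm.even (S p, p.2) (hYW hp.1.2)
  · exact fun p hp => hm.pos _ (hYW hp.1.2)
  · rw [hpair]
    exact (hm.injOn hW hstW hσpos).comp (hκinj.mono fun p hp => hp.1.1) fun p hp => hYW hp.1.2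
  · intro p hp
    have hpD₁ := hp.1.1
    have hκW := hYW hp.1.2
    have hdκ := (hκs.differentiableAt' hD₁ hpD₁).hasFDerivAt
    have hM : SmoothOn (fun q => m q • q) W := hm.smooth.smul contDiffOn_id
    have hd : HasFDerivAt (fun p => m (κ p) • κ p)
        ((fderiv ℝ (fun q => m q • q) (κ p)).comp (fderiv ℝ κ p)) p :=
      ((hM.differentiableAt' hW hκW).hasFDerivAt).comp p hdκ
    rw [hpair, hd.fderiv]
    have hcomp := LinearMap.det_comp
      (fderiv ℝ (fun q => m q • q) (κ p) : ℝ × ℝ →ₗ[ℝ] ℝ × ℝ)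
      (fderiv ℝ κ p : ℝ × ℝ →ₗ[ℝ] ℝ × ℝ)
    refine hcomp.trans ?_
    change (fderiv ℝ (fun q => m q • q) (κ p)).det * (fderiv ℝ κ p).det = _
    rw [hκdet p hpD₁, hm.det_fderiv hW hκW]
    simp only [hσ, hPκ p hpD₁]
    have h1 := (hpos₁ _ hpD₁).ne'
    field_simp
    rfl
  · exact fun p hp => hp.2
  · intro p hp hz
    have hi := hinv _ hp.1.2 hz
    simp only [hT, hPκ p hp.1.1] at hi
    have he := hS.eqn p (hD₁O hp.1.1) hz
    have hF := h.snd_pos (hOD (hD₁O hp.1.1)) hz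
    refine ⟨hi, ?_⟩
    have hi' : (billiardMap A B p).2 * μ (billiardMap A B p) = p.2 * μ p := hi
    rw [div_eq_iff hF.ne'] at he
    rw [he, mul_assoc, hi']
    field_simp

end NormalForm

section SquareRootRegion

variable {a b x₀ : ℝ} {D : Set (ℝ × ℝ)}

/-- The points `(s, y)` of the open upper half-plane with `(s, √y) ∈ D`. -/
def sqrtRegion (D : Set (ℝ × ℝ)) : Set (ℝ × ℝ) := {p | 0 < p.2 ∧ (p.1, √p.2) ∈ D}

theorem isOpen_sqrtRegion (hD : IsOpen D) : IsOpen (sqrtRegion D) :=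
  (isOpen_lt continuous_const continuous_snd).inter
    (hD.preimage (by fun_prop : Continuous fun p : ℝ × ℝ => (p.1, √p.2)))

theorem exists_half_box (hD : IsOpen D) {s : ℝ} (hs : (s, (0:ℝ)) ∈ D) :
    ∃ ε > 0, ∀ p : ℝ × ℝ, p.1 ∈ Ioo (s - ε) (s + ε) → p.2 ∈ Ioo (-ε) ε → (p.1, √p.2) ∈ D := by
  have hc : Continuous fun p : ℝ × ℝ => (p.1, √p.2) := by fun_prop
  obtain ⟨ε, hε, hb⟩ := Metric.isOpen_iff.1 (hD.preimage hc) (s, 0) (by simpa using hs)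
  refine ⟨ε, hε, fun p h1 h2 => hb ?_⟩
  rw [mem_ball, Prod.dist_eq, max_lt_iff, Real.dist_eq, Real.dist_eq, abs_lt, abs_lt]
  exact ⟨⟨by linarith [h1.1], by linarith [h1.2]⟩, by linarith [h2.1], by linarith [h2.2]⟩

theorem isAdjDomain_sqrtRegion (hx₀ : x₀ ∈ Ioo a b) (hD : IsOpen D) (hJ : Jset a b ⊆ D)
    (hst : BoxStar x₀ D) : IsAdjDomain a b (sqrtRegion D) := by
  have hadj : ∀ s ∈ Ioo a b, ∃ ε > 0, Ioo (s - ε) (s + ε) ×ˢ Ioo (0 : ℝ) ε ⊆ sqrtRegion D := by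
    intro s hs
    obtain ⟨ε, hε, hb⟩ := exists_half_box hD (hJ (mem_Jset hs))
    exact ⟨ε, hε, fun p hp => ⟨hp.2.1, hb p hp.1 ⟨by linarith [hp.2.1], hp.2.2⟩⟩⟩
  refine ⟨isOpen_sqrtRegion hD, ?_, fun p hp => hp.1, hadj⟩
  have hbox : ∀ s y t r : ℝ, (s, y) ∈ sqrtRegion D → t ∈ Icc (0:ℝ) 1 → r ∈ Ioc (0:ℝ) 1 →
      (x₀ + t * (s - x₀), r * y) ∈ sqrtRegion D := by
    intro s y t r hp ht hr
    refine ⟨mul_pos hr.1 hp.1, ?_⟩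
    simp only
    rw [Real.sqrt_mul hr.1.le]
    refine hst _ hp.2 t ht (√r) ⟨by linarith [Real.sqrt_nonneg r], ?_⟩
    exact Real.sqrt_le_one.2 hr.2
  have hcenter : ∀ s y : ℝ, (s, y) ∈ sqrtRegion D →
      JoinedIn (sqrtRegion D) (s, y) (x₀, y) := by
    intro s y hp
    refine JoinedIn.of_segment_subset ?_
    rintro _ ⟨α, β, hα, hβ, hsum, rfl⟩
    have := hbox s y α 1 hp ⟨hα, by linarith⟩ (by simp)
    have e : α • (s, y) + β • (x₀, y) = (x₀ + α * (s - x₀), 1 * y) := by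
      obtain rfl : β = 1 - α := by linarith
      ext <;> simp <;> ring
    rwa [e]
  have hvert : ∀ y y' : ℝ, 0 < y → y ≤ y' → (x₀, y') ∈ sqrtRegion D →
      JoinedIn (sqrtRegion D) (x₀, y) (x₀, y') := by
    intro y y' hy hyy hp
    refine JoinedIn.of_segment_subset ?_
    rintro _ ⟨α, β, hα, hβ, hsum, rfl⟩
    have hy' : 0 < y' := hp.1
    have hr : (α * y + β * y') / y' ∈ Ioc (0:ℝ) 1 := by
      obtain rfl : β = 1 - α := by linarith
      refine ⟨div_pos ?_ hy', (div_le_one hy').2 (by nlinarith)⟩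
      rcases hα.eq_or_lt with rfl | hα
      · simpa using hy'
      · have := mul_pos hα hy
        have := mul_nonneg hβ hy'.le
        linarith
    have := hbox x₀ y' 1 _ hp (by simp) hr
    have e : α • (x₀, y) + β • (x₀, y') =
        (x₀ + 1 * (x₀ - x₀), (α * y + β * y') / y' * y') := by
      rw [div_mul_cancel₀ _ hy'.ne']
      obtain rfl : β = 1 - α := by linarith
      ext <;> simp
      ring
    rwa [e]
  have hcc : ∀ y y' : ℝ, (x₀, y) ∈ sqrtRegion D → (x₀, y') ∈ sqrtRegion D →
      JoinedIn (sqrtRegion D) (x₀, y) (x₀, y') := by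
    intro y y' h h'
    rcases le_total y y' with hle | hle
    · exact hvert y y' h.1 hle h'
    · exact (hvert y' y h'.1 hle h).symm
  have hmem : ∀ s y : ℝ, (s, y) ∈ sqrtRegion D → (x₀, y) ∈ sqrtRegion D := fun s y hp => by
    simpa using hbox s y 0 1 hp (by simp) (by simp)
  refine IsPathConnected.isConnected (isPathConnected_iff.2 ⟨?_, ?_⟩)
  · obtain ⟨ε, hε, hsub⟩ := hadj x₀ hx₀
    exact ⟨(x₀, ε / 2), hsub ⟨⟨by simp; linarith, by simp; linarith⟩, by simp; linarith,
      by simp; linarith⟩⟩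
  · rintro ⟨s, y⟩ hp ⟨s', y'⟩ hp'
    exact ((hcenter s y hp).trans (hcc y y' (hmem s y hp) (hmem s' y' hp'))).trans
      (hcenter s' y' hp').symm

theorem sqrtRegion_union_Jset (hJ : Jset a b ⊆ D) (hstrip : ∀ p ∈ D, p.1 ∈ Ioo a b) :
    sqrtRegion D ∪ Jset a b = {p : ℝ × ℝ | 0 ≤ p.2 ∧ (p.1, √p.2) ∈ D} := by
  ext ⟨s, y⟩
  constructor
  · rintro (h | ⟨hs, hz⟩)
    · exact ⟨h.1.le, h.2⟩
    · obtain rfl : y = 0 := hz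
      exact ⟨le_rfl, by simpa using hJ (mem_Jset hs)⟩
  · rintro ⟨hy, hD⟩
    rcases hy.eq_or_lt with h | h
    · exact Or.inr ⟨hstrip (s, √y) hD, h.symm⟩
    · exact Or.inl ⟨h, hD⟩

theorem uniqueDiffOn_sqrtRegion_union (hD : IsOpen D) (hJ : Jset a b ⊆ D) :
    UniqueDiffOn ℝ (sqrtRegion D ∪ Jset a b) := by
  have hmono : ∀ p ∈ sqrtRegion D, UniqueDiffWithinAt ℝ (sqrtRegion D ∪ Jset a b) p :=
    fun p hp => ((isOpen_sqrtRegion hD).uniqueDiffWithinAt hp).mono subset_union_left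
  rintro ⟨s, y⟩ (h | ⟨hs, hz⟩)
  · exact hmono _ h
  · obtain rfl : y = 0 := hz
    obtain ⟨ε, hε, hb⟩ := exists_half_box hD (hJ (mem_Jset hs))
    simp only at hs
    set δ := min ε (min (s - a) (b - s)) with hδ
    have hδ0 : 0 < δ := lt_min hε (lt_min (by linarith [hs.1]) (by linarith [hs.2]))
    have h1 : δ ≤ ε := min_le_left _ _
    have h2 : δ ≤ s - a := (min_le_right _ _).trans (min_le_left _ _)
    have h3 : δ ≤ b - s := (min_le_right _ _).trans (min_le_right _ _)
    have hu : UniqueDiffOn ℝ (Ioo (s - δ) (s + δ) ×ˢ Ico (0:ℝ) δ) :=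
      isOpen_Ioo.uniqueDiffOn.prod (uniqueDiffOn_Ico 0 δ)
    refine (hu (s, 0) ⟨⟨by simp; linarith, by simp; linarith⟩, by simp [hδ0]⟩).mono ?_
    rintro ⟨u, v⟩ ⟨hu, hv⟩
    simp only at hu hv
    rcases hv.1.eq_or_lt with h | h
    · exact Or.inr ⟨⟨by simp; linarith [hu.1], by simp; linarith [hu.2]⟩, h.symm⟩
    · exact Or.inl ⟨h, hb (u, v) ⟨by simp; linarith [hu.1], by simp; linarith [hu.2]⟩
        ⟨by simp; linarith, by simp; linarith [hv.2]⟩⟩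

theorem Jset_subset_closure_sqrtRegion (hD : IsOpen D) (hJ : Jset a b ⊆ D) :
    Jset a b ⊆ closure (sqrtRegion D) := by
  rintro ⟨s, z⟩ ⟨hs, hz⟩
  obtain rfl : z = 0 := hz
  obtain ⟨ε, hε, hb⟩ := exists_half_box hD (hJ (mem_Jset hs))
  have ht : Tendsto (fun y : ℝ => (s, y)) (𝓝[>] 0) (𝓝 (s, 0)) :=
    (Continuous.tendsto (by fun_prop : Continuous fun y : ℝ => (s, y)) 0).mono_left
      nhdsWithin_le_nhds
  refine mem_closure_of_tendsto ht ?_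
  filter_upwards [Ioo_mem_nhdsGT hε] with y hy
  exact ⟨hy.1, hb (s, y) ⟨by simp; linarith, by simp; linarith⟩ ⟨by simp; linarith [hy.1], hy.2⟩⟩

end SquareRootRegion

section Descent

variable {a b x₀ : ℝ} {V D : Set (ℝ × ℝ)} {F : ℝ × ℝ → ℝ × ℝ} {τ ν : ℝ × ℝ → ℝ}

/-- Coordinates `(τ, z ν)` on a neighborhood of `z = 0` in the plane of `(s, z)`, `z = √y`, that
descend to symplectic coordinates `(τ, y ν²)` in which `F` has the normal form. -/
structure IsLiftedNormalForm (a b x₀ : ℝ) (V : Set (ℝ × ℝ)) (F : ℝ × ℝ → ℝ × ℝ)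
    (D : Set (ℝ × ℝ)) (τ ν : ℝ × ℝ → ℝ) : Prop where
  isOpen : IsOpen D
  axis : Jset a b ⊆ D
  strip : ∀ p ∈ D, p.1 ∈ Ioo a b
  star : BoxStar x₀ D
  smoothτ : SmoothOn τ D
  smoothν : SmoothOn ν D
  evenτ : EvenOn τ D
  evenν : EvenOn ν D
  posν : ∀ p ∈ D, 0 < ν p
  inj : InjOn (fun p => (τ p, p.2 * ν p)) D
  det : ∀ p ∈ D, (fderiv ℝ (fun p => (τ p, p.2 * ν p)) p).det = 1 / ν p
  vert : ∀ p ∈ D, 0 < fderiv ℝ (fun p : ℝ × ℝ => p.2 * ν p) p (0, 1)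
  mem : ∀ p ∈ D, 0 < p.2 → (p.1, p.2 ^ 2) ∈ V
  invariant : ∀ p ∈ D, 0 < p.2 →
    √(F (p.1, p.2 ^ 2)).2 * ν ((F (p.1, p.2 ^ 2)).1, √(F (p.1, p.2 ^ 2)).2) = p.2 * ν p ∧
    τ ((F (p.1, p.2 ^ 2)).1, √(F (p.1, p.2 ^ 2)).2) = τ p + p.2 * ν p

/-- The time coordinate. -/
noncomputable def timeFun (τ : ℝ × ℝ → ℝ) (p : ℝ × ℝ) : ℝ := τ (p.1, √p.2)

/-- The energy coordinate. -/
noncomputable def energyFun (ν : ℝ × ℝ → ℝ) (p : ℝ × ℝ) : ℝ := p.2 * ν (p.1, √p.2) ^ 2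

namespace IsLiftedNormalForm

theorem smooth_timeFun (h : IsLiftedNormalForm a b x₀ V F D τ ν) :
    SmoothOn (timeFun τ) (sqrtRegion D ∪ Jset a b) := by
  rw [sqrtRegion_union_Jset h.axis h.strip]
  exact h.evenτ.smoothOn_comp_sqrt h.isOpen h.smoothτ

theorem smooth_energyFun (h : IsLiftedNormalForm a b x₀ V F D τ ν) :
    SmoothOn (energyFun ν) (sqrtRegion D ∪ Jset a b) := by
  rw [sqrtRegion_union_Jset h.axis h.strip]
  exact contDiffOn_snd.mul ((h.evenν.smoothOn_comp_sqrt h.isOpen h.smoothν).pow 2)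

theorem mem_of_mem (h : IsLiftedNormalForm a b x₀ V F D τ ν)
    {p : ℝ × ℝ} (hp : p ∈ sqrtRegion D ∪ Jset a b) :
    0 ≤ p.2 ∧ (p.1, √p.2) ∈ D := by
  rwa [sqrtRegion_union_Jset h.axis h.strip] at hp

theorem sqrt_energyFun (h : IsLiftedNormalForm a b x₀ V F D τ ν)
    {p : ℝ × ℝ} (hp : p ∈ sqrtRegion D ∪ Jset a b) :
    √(energyFun ν p) = √p.2 * ν (p.1, √p.2) := by
  obtain ⟨h0, hD⟩ := h.mem_of_mem hp
  rw [energyFun, Real.sqrt_mul h0, Real.sqrt_sq (h.posν _ hD).le]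

theorem energyFun_nonneg (h : IsLiftedNormalForm a b x₀ V F D τ ν)
    {p : ℝ × ℝ} (hp : p ∈ sqrtRegion D ∪ Jset a b) :
    0 ≤ energyFun ν p :=
  mul_nonneg (h.mem_of_mem hp).1 (sq_nonneg _)

theorem hasFDerivAt_pair (h : IsLiftedNormalForm a b x₀ V F D τ ν)
    {p : ℝ × ℝ} (hp : p ∈ sqrtRegion D) :
    HasFDerivAt (fun p => (timeFun τ p, √p.2 * ν (p.1, √p.2)))
      ((fderiv ℝ (fun p => (τ p, p.2 * ν p)) (p.1, √p.2)).comp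
        ((ContinuousLinearMap.fst ℝ ℝ ℝ).prod
          ((1 / (2 * √p.2)) • ContinuousLinearMap.snd ℝ ℝ ℝ))) p := by
  have hs : SmoothOn (fun p : ℝ × ℝ => (τ p, p.2 * ν p)) D :=
    h.smoothτ.prodMk (contDiffOn_snd.mul h.smoothν)
  have h1 := (hs.differentiableAt' h.isOpen hp.2).hasFDerivAt
  have h2 : HasFDerivAt (fun q : ℝ × ℝ => (q.1, √q.2))
      ((ContinuousLinearMap.fst ℝ ℝ ℝ).prod
        ((1 / (2 * √p.2)) • ContinuousLinearMap.snd ℝ ℝ ℝ)) p :=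
    hasFDerivAt_fst.prodMk ((hasFDerivAt_snd (p := p)).sqrt hp.1.ne')
  exact h1.comp p h2

theorem hasFDerivAt_coordinates (h : IsLiftedNormalForm a b x₀ V F D τ ν)
    {p : ℝ × ℝ} (hp : p ∈ sqrtRegion D) :
    ∃ L : ℝ × ℝ →L[ℝ] ℝ × ℝ, HasFDerivAt (fun p => (timeFun τ p, energyFun ν p)) L p ∧
      L.det = 1 ∧ 0 < (L (0, 1)).2 := by
  have hpair := h.hasFDerivAt_pair hp
  set G := fderiv ℝ (fun p => (τ p, p.2 * ν p)) (p.1, √p.2) with hG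
  have hν := h.posν _ hp.2
  have hz : 0 < √p.2 := Real.sqrt_pos.2 hp.1
  have h2 := hpair.snd.pow 2
  have h3 := hpair.fst.prodMk h2
  have hev : (fun p => (timeFun τ p, energyFun ν p)) =ᶠ[𝓝 p]
      fun p => (timeFun τ p, (√p.2 * ν (p.1, √p.2)) ^ 2) := by
    filter_upwards [(isOpen_lt continuous_const continuous_snd).mem_nhds hp.1] with q hq
    have hq' : (0:ℝ) ≤ q.2 := le_of_lt hq
    simp only [energyFun, mul_pow, Real.sq_sqrt hq']
  have h4 := h3.congr_of_eventuallyEq hev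
  refine ⟨_, h4, ?_, ?_⟩
  · have hd := h.det _ hp.2
    rw [← hG, det_eq_of_prod] at hd
    rw [det_eq_of_prod]
    have e : G (0, (√p.2)⁻¹ * 2⁻¹) = ((√p.2)⁻¹ * 2⁻¹) • G (0, 1) := by rw [← map_smul]; simp
    simp [e]
    field_simp at hd ⊢
    linear_combination hd
  · have hv := h.vert _ hp.2
    have hs : SmoothOn (fun p : ℝ × ℝ => (τ p, p.2 * ν p)) D :=
      h.smoothτ.prodMk (contDiffOn_snd.mul h.smoothν)
    have h1 := ((hs.differentiableAt' h.isOpen hp.2).hasFDerivAt).snd.fderiv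
    simp only at h1
    rw [h1] at hv
    have e : G (0, (√p.2)⁻¹ * 2⁻¹) = ((√p.2)⁻¹ * 2⁻¹) • G (0, 1) := by rw [← map_smul]; simp
    simp [e]
    have hv' : 0 < (G (0, 1)).2 := hv
    positivity

theorem energyFun_vert (h : IsLiftedNormalForm a b x₀ V F D τ ν)
    {p : ℝ × ℝ} (hp : p ∈ sqrtRegion D ∪ Jset a b) :
    0 < fderivWithin ℝ (energyFun ν) (sqrtRegion D ∪ Jset a b) p (0, 1) := by
  have hu := uniqueDiffOn_sqrtRegion_union h.isOpen h.axis
  rcases hp with hp' | ⟨hs, hz⟩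
  · obtain ⟨L, hL, -, hL2⟩ := h.hasFDerivAt_coordinates hp'
    have h2 : HasFDerivAt (energyFun ν) _ p := hL.snd
    rw [h2.hasFDerivWithinAt.fderivWithin (hu p (Or.inl hp'))]
    exact hL2
  · obtain ⟨s, z⟩ := p
    obtain rfl : z = 0 := hz
    have hD := h.axis (mem_Jset hs)
    have hc : ContinuousOn (fun p : ℝ × ℝ => ν (p.1, √p.2) ^ 2) (sqrtRegion D ∪ Jset a b) := by
      rw [sqrtRegion_union_Jset h.axis h.strip]
      exact ((h.evenν.smoothOn_comp_sqrt h.isOpen h.smoothν).pow 2).continuousOn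
    have hmem : (s, (0:ℝ)) ∈ sqrtRegion D ∪ Jset a b := Or.inr (mem_Jset hs)
    have hd : HasFDerivWithinAt (energyFun ν) _ (sqrtRegion D ∪ Jset a b) (s, 0) :=
      hasFDerivWithinAt_snd_smul (hc _ hmem)
    rw [hd.fderivWithin (hu _ hmem)]
    have := h.posν _ hD
    simp
    positivity

theorem det_coordinates (h : IsLiftedNormalForm a b x₀ V F D τ ν)
    {p : ℝ × ℝ} (hp : p ∈ sqrtRegion D ∪ Jset a b) :
    (fderivWithin ℝ (fun p => (timeFun τ p, energyFun ν p))
      (sqrtRegion D ∪ Jset a b) p).det = 1 := by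
  have hu := uniqueDiffOn_sqrtRegion_union h.isOpen h.axis
  set E := sqrtRegion D ∪ Jset a b with hE
  have hs : SmoothOn (fun p => (timeFun τ p, energyFun ν p)) E :=
    h.smooth_timeFun.prodMk h.smooth_energyFun
  have hcd : ContinuousOn (fderivWithin ℝ (fun p => (timeFun τ p, energyFun ν p)) E) E :=
    hs.continuousOn_fderivWithin hu (by simp)
  have hc : ContinuousOn
      (fun p => (fderivWithin ℝ (fun p => (timeFun τ p, energyFun ν p)) E p).det) E := by
    simp only [det_eq_of_prod]
    have hv : ∀ v : ℝ × ℝ, ContinuousOn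
        (fun p => fderivWithin ℝ (fun p => (timeFun τ p, energyFun ν p)) E p v) E :=
      fun v => hcd.clm_apply continuousOn_const
    exact ((hv _).fst.mul (hv _).snd).sub ((hv _).fst.mul (hv _).snd)
  have hone : ∀ p ∈ sqrtRegion D,
      (fderivWithin ℝ (fun p => (timeFun τ p, energyFun ν p)) E p).det = 1 := by
    intro p hp
    obtain ⟨L, hL, hdet, -⟩ := h.hasFDerivAt_coordinates hp
    rw [hL.hasFDerivWithinAt.fderivWithin (hu p (Or.inl hp)), hdet]
  have hcl : p ∈ closure (sqrtRegion D) := by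
    rcases hp with hp' | hp'
    · exact subset_closure hp'
    · exact Jset_subset_closure_sqrtRegion h.isOpen h.axis hp'
  have hne : (𝓝[sqrtRegion D] p).NeBot := mem_closure_iff_nhdsWithin_neBot.1 hcl
  have ht := (hc p hp).mono subset_union_left
  have ht1 : Tendsto (fun p => (fderivWithin ℝ (fun p => (timeFun τ p, energyFun ν p)) E p).det)
      (𝓝[sqrtRegion D] p) (𝓝 1) := by
    refine tendsto_const_nhds.congr' ?_
    filter_upwards [self_mem_nhdsWithin] with q hq using (hone q hq).symm
  exact tendsto_nhds_unique ht ht1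

theorem injOn_coordinates (h : IsLiftedNormalForm a b x₀ V F D τ ν)
    :
    InjOn (fun p => (timeFun τ p, energyFun ν p)) (sqrtRegion D ∪ Jset a b) := by
  intro p hp q hq he
  simp only [Prod.mk.injEq] at he
  have h1 := congrArg Real.sqrt he.2
  rw [h.sqrt_energyFun hp, h.sqrt_energyFun hq] at h1
  obtain ⟨hp0, hpD⟩ := h.mem_of_mem hp
  obtain ⟨hq0, hqD⟩ := h.mem_of_mem hq
  have := h.inj hpD hqD (Prod.ext he.1 h1)
  simp only [Prod.mk.injEq] at this
  exact Prod.ext this.1 ((Real.sqrt_inj hp0 hq0).1 this.2)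

theorem exists_smooth_inverse (h : IsLiftedNormalForm a b x₀ V F D τ ν) :
    ∃ Ψ : ℝ × ℝ → ℝ × ℝ,
    SmoothOn Ψ ((fun p => (timeFun τ p, energyFun ν p)) '' (sqrtRegion D ∪ Jset a b)) ∧
      ∀ p ∈ sqrtRegion D ∪ Jset a b, Ψ (timeFun τ p, energyFun ν p) = p := by
  set G : ℝ × ℝ → ℝ × ℝ := fun p => (τ p, p.2 * ν p) with hG
  have hs : SmoothOn G D := h.smoothτ.prodMk (contDiffOn_snd.mul h.smoothν)
  obtain ⟨hGo, Γ, hΓ, hΓG⟩ := hs.exists_inverse h.isOpen h.inj fun p hp => by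
    rw [h.det p hp]; exact (one_div_pos.2 (h.posν p hp)).ne'
  have hneg : ∀ r ∈ G '' D, Γ (r.1, -r.2) = ((Γ r).1, -(Γ r).2) := by
    rintro _ ⟨p, hp, rfl⟩
    rw [hΓG p hp, ← hΓG _ (h.star.neg hp)]
    simp only [hG, h.evenτ p hp, h.evenν p hp, neg_mul]
  have hsm : SmoothOn (fun r => ((Γ r).1, (Γ r).2 ^ 2)) (G '' D) :=
    (contDiff_fst.comp_contDiffOn hΓ).prodMk ((contDiff_snd.comp_contDiffOn hΓ).pow 2)
  have hev : EvenOn (fun r => ((Γ r).1, (Γ r).2 ^ 2)) (G '' D) := by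
    intro r hr
    simp only [hneg r hr, neg_sq]
  have hval : ∀ p ∈ sqrtRegion D ∪ Jset a b,
      (timeFun τ p, √(energyFun ν p)) = G (p.1, √p.2) := fun p hp => by
    rw [h.sqrt_energyFun hp]; rfl
  refine ⟨fun q => ((Γ (q.1, √q.2)).1, (Γ (q.1, √q.2)).2 ^ 2),
    (hev.smoothOn_comp_sqrt hGo hsm).mono ?_, fun p hp => ?_⟩
  · rintro _ ⟨p, hp, rfl⟩
    refine ⟨h.energyFun_nonneg hp, ?_⟩
    simp only [hval p hp]
    exact mem_image_of_mem _ (h.mem_of_mem hp).2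
  · obtain ⟨hp0, hpD⟩ := h.mem_of_mem hp
    simp only [hval p hp, hΓG _ hpD, Real.sq_sqrt hp0]

theorem normal_form (h : IsLiftedNormalForm a b x₀ V F D τ ν)
    (hfix : ∀ s ∈ Ioo a b, F (s, 0) = (s, 0)) {p : ℝ × ℝ}
    (hp : p ∈ sqrtRegion D ∪ Jset a b) (hFp : F p ∈ sqrtRegion D ∪ Jset a b) :
    timeFun τ (F p) = timeFun τ p + √(energyFun ν p) ∧
      energyFun ν (F p) = energyFun ν p := by
  have hsp := h.sqrt_energyFun hp
  have hsF := h.sqrt_energyFun hFp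
  rcases hp with hp' | ⟨hs, hz⟩
  · obtain ⟨s, y⟩ := p
    have hy : √y ^ 2 = y := Real.sq_sqrt hp'.1.le
    have hi := h.invariant (s, √y) hp'.2 (Real.sqrt_pos.2 hp'.1)
    simp only [hy] at hi hsp
    rw [← hsF, ← hsp] at hi
    refine ⟨hi.2, ?_⟩
    exact (Real.sqrt_inj (h.energyFun_nonneg hFp) (h.energyFun_nonneg (Or.inl hp'))).1 hi.1
  · obtain ⟨s, z⟩ := p
    obtain rfl : z = 0 := hz
    rw [hfix s hs]
    simp [energyFun]

theorem sqrtRegion_subset (h : IsLiftedNormalForm a b x₀ V F D τ ν) :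
    sqrtRegion D ⊆ V := by
  rintro ⟨s, y⟩ hp
  have := h.mem _ hp.2 (Real.sqrt_pos.2 hp.1)
  simpa only [Real.sq_sqrt hp.1.le] using this

end IsLiftedNormalForm

end Descent

section Lifting

variable {a b x₀ : ℝ} {w : ℝ → ℝ} {V : Set (ℝ × ℝ)} {F : ℝ × ℝ → ℝ × ℝ}

theorem hasDerivAt_mul_self {g : ℝ → ℝ} (hg : ContinuousAt g 0) :
    HasDerivAt (fun t => t * g t) (g 0) 0 := by
  rw [hasDerivAt_iff_tendsto_slope]
  refine (hg.tendsto.mono_left nhdsWithin_le_nhds).congr' ?_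
  filter_upwards [self_mem_nhdsWithin] with t ht
  have ht' : t ≠ 0 := ht
  simp [slope, ht']

theorem HasFDerivAt.hasDerivAt_vertical {G : Type*} [NormedAddCommGroup G] [NormedSpace ℝ G]
    {f : ℝ × ℝ → G} {L : ℝ × ℝ →L[ℝ] G} {s z : ℝ} (h : HasFDerivAt f L (s, z)) :
    HasDerivAt (fun t => f (s, t)) (L (0, 1)) z :=
  h.comp_hasDerivAt z ((hasDerivAt_const z s).prodMk (hasDerivAt_id z))

theorem eq_of_abs_sub_mul_le {g : ℝ → ℝ} {l C δ : ℝ} (hg : ContinuousAt g 0) (hδ : 0 < δ)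
    (h : ∀ᶠ t in 𝓝 (0 : ℝ), |t| < δ → |t * g t - l * t| ≤ C * t ^ 2) : g 0 = l := by
  have h1 : HasDerivAt (fun t => t * g t) (g 0) 0 := hasDerivAt_mul_self hg
  have h2 : HasDerivAt (fun t => t * g t) l 0 := by
    rw [hasDerivAt_iff_isLittleO]
    have hO : (fun t : ℝ => t * g t - 0 * g 0 - (t - 0) • l) =O[𝓝 0] fun t : ℝ => t ^ 2 := by
      refine Asymptotics.IsBigO.of_bound C ?_
      filter_upwards [h, Metric.ball_mem_nhds (0 : ℝ) hδ] with t ht htδ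
      rw [Real.norm_eq_abs, Real.norm_eq_abs, abs_of_nonneg (sq_nonneg t)]
      refine le_trans (le_of_eq ?_) (ht (by simpa using htδ))
      congr 1
      simp
      ring
    refine hO.trans_isLittleO ?_
    simpa using Asymptotics.isLittleO_pow_id (𝕜 := ℝ) one_lt_two
  exact h1.unique h2

/-- The lift of a billiard-like map to the plane of `(s, z)`, `z = √y`. -/
theorem IsBilliardLike.exists_lift (hF : IsBilliardLike a b w V F) (hx₀ : x₀ ∈ Ioo a b) :
    ∃ (D : Set (ℝ × ℝ)) (A B : ℝ × ℝ → ℝ), IsOpen D ∧ Jset a b ⊆ D ∧ (∀ p ∈ D, p.1 ∈ Ioo a b) ∧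
      BoxStar x₀ D ∧ SmoothOn A D ∧ SmoothOn B D ∧ (∀ s ∈ Ioo a b, 0 < A (s, 0)) ∧
      (∀ p ∈ D, billiardMap A B p ∈ D →
        billiardMap A B ((billiardMap A B p).1, -(billiardMap A B p).2) = (p.1, -p.2)) ∧
      ∀ p ∈ D, 0 < p.2 → (p.1, p.2 ^ 2) ∈ V →
        (F (p.1, p.2 ^ 2)).1 = (billiardMap A B p).1 ∧
        √(F (p.1, p.2 ^ 2)).2 = (billiardMap A B p).2 := by
  obtain ⟨N, hN, hJN, β, hβ, hinv, hfix, hasy, hFβ⟩ := hF.lifted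
  set O : Set (ℝ × ℝ) := N ∩ {p | p.1 ∈ Ioo a b} with hO
  have hOo : IsOpen O := hN.inter (isOpen_Ioo.preimage continuous_fst)
  set D := boxHull x₀ O with hDdef
  have hD : IsOpen D := isOpen_boxHull _ hOo
  have hDO : D ⊆ O := boxHull_subset _ _
  have hst : BoxStar x₀ D := boxStar_boxHull _ _
  have hJ : Jset a b ⊆ D := Jset_subset_boxHull hx₀ fun p hp => ⟨hJN hp, hp.1⟩
  have hstrip : ∀ p ∈ D, p.1 ∈ Ioo a b := fun p hp => (hDO hp).2
  have hscale : ∀ p ∈ D, ∀ t ∈ Icc (0 : ℝ) 1, (p.1, t * p.2) ∈ D := fun p hp t ht =>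
    hst.scale hp ⟨by linarith [ht.1], ht.2⟩
  have hβD : SmoothOn β D := hβ.mono (hDO.trans inter_subset_left)
  obtain ⟨A, hA, hAβ, -⟩ := exists_smooth_quotient hD hscale hβD.fst
  obtain ⟨E, hE, hEβ, -⟩ := exists_smooth_quotient hD hscale hβD.snd
  obtain ⟨B, hB, hBE, -⟩ := exists_smooth_quotient hD hscale hE
  have hA' : ∀ p ∈ D, (β p).1 = p.1 + p.2 * A p := fun p hp => by
    have := hAβ p hp
    simp only [hfix _ (hstrip p hp), smul_eq_mul] at this
    exact this
  have hE' : ∀ p ∈ D, (β p).2 = p.2 * E p := fun p hp => by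
    have := hEβ p hp
    simp only [hfix _ (hstrip p hp), smul_eq_mul, zero_add] at this
    exact this
  have haxis : ∀ s ∈ Ioo a b, A (s, 0) = w s ∧ E (s, 0) = -1 := by
    intro s hs
    obtain ⟨C, -, δ, hδ, hb⟩ := hasy {s} isCompact_singleton (singleton_subset_iff.2 hs)
    have hc : Continuous fun t : ℝ => (s, t) := by fun_prop
    have hsD := hD.mem_nhds (hJ (mem_Jset hs))
    have hev : ∀ᶠ t in 𝓝 (0 : ℝ), (s, t) ∈ D := hc.continuousAt.eventually hsD
    have hAc : ContinuousAt (fun t => A (s, t)) 0 :=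
      ContinuousAt.comp (f := fun t : ℝ => (s, t)) (hA.continuousOn.continuousAt hsD)
        hc.continuousAt
    have hEc : ContinuousAt (fun t => E (s, t)) 0 :=
      ContinuousAt.comp (f := fun t : ℝ => (s, t)) (hE.continuousOn.continuousAt hsD)
        hc.continuousAt
    constructor
    · refine eq_of_abs_sub_mul_le (g := fun t => A (s, t)) (C := C) hAc hδ ?_
      filter_upwards [hev] with t ht htδ
      have := (hb (s, t) (hDO ht).1 rfl htδ).1
      rw [hA' _ ht] at this
      simpa using this
    · refine eq_of_abs_sub_mul_le (g := fun t => E (s, t)) (C := C) hEc hδ ?_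
      filter_upwards [hev] with t ht htδ
      have := (hb (s, t) (hDO ht).1 rfl htδ).2
      rw [hE' _ ht] at this
      simpa using this
  have hmap : ∀ p ∈ D, billiardMap A (fun q => -B q) p = ((β p).1, -(β p).2) := by
    intro p hp
    have h1 := hBE p hp
    rw [(haxis _ (hstrip p hp)).2, smul_eq_mul] at h1
    rw [hA' p hp, hE' p hp, h1, billiardMap]
    ext
    · rfl
    · simp only
      ring
  refine ⟨D, A, fun q => -B q, hD, hJ, hstrip, hst, hA, hB.neg,
    fun s hs => (haxis s hs).1 ▸ hF.wPos s hs, ?_, ?_⟩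
  · intro p hp hp'
    have hβp : β p ∈ D := by
      have := hst.neg hp'
      rw [hmap p hp] at this
      simpa using this
    have h2 := hmap _ hβp
    rw [(hinv p (hDO hp).1).2] at h2
    rw [hmap p hp]
    simpa using h2
  · intro p hp h0 hV
    rw [hmap p hp]
    exact hFβ p (hDO hp).1 h0 hV

end Lifting

section Rescaling

variable {a b x₀ : ℝ} {D₀ : Set (ℝ × ℝ)} {A₀ B₀ : ℝ × ℝ → ℝ}

/-- A positive solution of the linear equation `c' = -(B₀ / A₀) c`. -/
theorem exists_conformal_scale (hx₀ : x₀ ∈ Ioo a b) {m : ℝ → ℝ} (hm : SmoothOn m (Ioo a b)) :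
    ∃ c : ℝ → ℝ, SmoothOn c (Ioo a b) ∧ (∀ s, 0 < c s) ∧
      ∀ s ∈ Ioo a b, HasDerivAt c (-(m s * c s)) s := by
  obtain ⟨q, hq, -, hd, -⟩ := exists_smooth_antiderivative hx₀ hm
  refine ⟨fun s => Real.exp (-q s), hq.neg.exp, fun s => Real.exp_pos _, fun s hs => ?_⟩
  refine (hd s hs).fun_neg.exp.congr_deriv ?_
  ring

/-- After rescaling the fibers, a reversible map preserves them to second order. -/
theorem exists_isReversibleMap (hx₀ : x₀ ∈ Ioo a b) (hD₀ : IsOpen D₀) (hJ₀ : Jset a b ⊆ D₀)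
    (hst₀ : BoxStar x₀ D₀) (hA₀ : SmoothOn A₀ D₀) (hB₀ : SmoothOn B₀ D₀)
    (hpos : ∀ s ∈ Ioo a b, 0 < A₀ (s, 0))
    (hrev : ∀ p ∈ D₀, billiardMap A₀ B₀ p ∈ D₀ →
      billiardMap A₀ B₀ ((billiardMap A₀ B₀ p).1, -(billiardMap A₀ B₀ p).2) = (p.1, -p.2))
    {O : Set (ℝ × ℝ)} (hO : IsOpen O) (hJO : Jset a b ⊆ O) :
    ∃ (c : ℝ → ℝ) (D : Set (ℝ × ℝ)) (A B : ℝ × ℝ → ℝ), SmoothOn c (Ioo a b) ∧ (∀ s, 0 < c s) ∧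
      IsReversibleMap a b x₀ D A B ∧ ∀ p ∈ D, (p.1, p.2 / c p.1) ∈ D₀ ∩ O ∧
        (billiardMap A₀ B₀ (p.1, p.2 / c p.1)).1 ∈ Ioo a b ∧
        billiardMap A B p = ((billiardMap A₀ B₀ (p.1, p.2 / c p.1)).1,
          c (billiardMap A₀ B₀ (p.1, p.2 / c p.1)).1 *
            (billiardMap A₀ B₀ (p.1, p.2 / c p.1)).2) := by
  have haxis : SmoothOn (fun s : ℝ => (s, (0 : ℝ))) (Ioo a b) :=
    contDiffOn_id.prodMk contDiffOn_const
  have hm : SmoothOn (fun s => B₀ (s, 0) / A₀ (s, 0)) (Ioo a b) :=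
    (hB₀.comp haxis fun s hs => hJ₀ (mem_Jset hs)).div
      (hA₀.comp haxis fun s hs => hJ₀ (mem_Jset hs)) fun s hs => (hpos s hs).ne'
  obtain ⟨c, hc, hc0, hcd⟩ := exists_conformal_scale hx₀ hm
  set S : Set (ℝ × ℝ) := {p | p.1 ∈ Ioo a b} with hS
  have hSo : IsOpen S := isOpen_Ioo.preimage continuous_fst
  set l : ℝ × ℝ → ℝ × ℝ := fun p => (p.1, p.2 / c p.1) with hl
  have hcS : SmoothOn (fun p : ℝ × ℝ => c p.1) S := hc.comp contDiffOn_fst fun p hp => hp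
  have hlS : SmoothOn l S :=
    contDiffOn_fst.prodMk (contDiffOn_snd.div hcS fun p _ => (hc0 _).ne')
  have hl0 : ∀ s, l (s, 0) = (s, 0) := fun s => by simp [l]
  set M := billiardMap A₀ B₀ with hM
  have hMs : SmoothOn M D₀ := (contDiffOn_fst.add (contDiffOn_snd.mul hA₀)).prodMk
    (contDiffOn_snd.add ((contDiffOn_snd.pow 2).mul hB₀))
  set W₁ := S ∩ l ⁻¹' (D₀ ∩ O) with hW₁
  have hW₁o : IsOpen W₁ := hlS.continuousOn.isOpen_inter_preimage hSo (hD₀.inter hO)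
  have hMl : SmoothOn (fun p => M (l p)) W₁ :=
    hMs.comp (hlS.mono inter_subset_left) fun p hp => hp.2.1
  set W := W₁ ∩ (fun p => M (l p)) ⁻¹' S with hW
  have hWo : IsOpen W := hMl.continuousOn.isOpen_inter_preimage hW₁o hSo
  have hJW : Jset a b ⊆ W := by
    rintro ⟨s, z⟩ ⟨hs, hz⟩
    obtain rfl : z = 0 := hz
    refine ⟨⟨hs, ?_⟩, ?_⟩
    · rw [mem_preimage, hl0]
      exact ⟨hJ₀ (mem_Jset hs), hJO (mem_Jset hs)⟩
    · rw [mem_preimage, hl0, hM, billiardMap_axis]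
      exact hs
  set D₁ := boxHull x₀ W with hD₁def
  have hD₁ : IsOpen D₁ := isOpen_boxHull _ hWo
  have hD₁W : D₁ ⊆ W := boxHull_subset _ _
  have hJD₁ : Jset a b ⊆ D₁ := Jset_subset_boxHull hx₀ hJW
  have hst₁ : BoxStar x₀ D₁ := boxStar_boxHull _ _
  set R : ℝ × ℝ → ℝ := fun p => c (M (l p)).1 / c p.1 * (1 + (l p).2 * B₀ (l p)) with hR
  have hRs : SmoothOn R D₁ := by
    have h1 : SmoothOn (fun p => c (M (l p)).1) D₁ :=
      hc.comp (hMl.fst.mono (hD₁W.trans inter_subset_left)) fun p hp => (hD₁W hp).2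
    have h2 : D₁ ⊆ S := fun p hp => (hD₁W hp).1.1
    have h3 : SmoothOn (fun p => B₀ (l p)) D₁ :=
      hB₀.comp (hlS.mono h2) fun p hp => (hD₁W hp).1.2.1
    exact (h1.div (hcS.mono h2) fun p _ => (hc0 _).ne').mul
      (contDiffOn_const.add ((hlS.mono h2).snd.mul h3))
  have hR0 : ∀ s, R (s, 0) = 1 := fun s => by
    have := (hc0 s).ne'
    simp only [hR, hl0, hM, billiardMap_axis]
    field_simp
    ring
  obtain ⟨B, hB, hRB, hB0⟩ := exists_smooth_quotient hD₁
    (fun p hp t ht => hst₁.scale hp ⟨by linarith [ht.1], ht.2⟩) hRs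
  have hRB' : ∀ p ∈ D₁, 1 + p.2 * B p = R p := fun p hp => by
    rw [hRB p hp, hR0, smul_eq_mul]
  have hzero : ∀ s ∈ Ioo a b, B (s, 0) = 0 := by
    intro s hs
    have hsD₁ := hJD₁ (mem_Jset hs)
    rw [hB0 _ hsD₁]
    have h1 := (hRs.differentiableAt' hD₁ hsD₁).hasFDerivAt.hasDerivAt_vertical
    have hcs := (hc0 s).ne'
    have hAs := (hpos s hs).ne'
    have hlc : ContinuousAt (fun t => l (s, t)) 0 := by
      simp only [hl]
      fun_prop
    have hmem : D₀ ∈ 𝓝 (l (s, 0)) := by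
      rw [hl0]
      exact hD₀.mem_nhds (hJ₀ (mem_Jset hs))
    have hg : ∀ {f : ℝ × ℝ → ℝ}, SmoothOn f D₀ →
        HasDerivAt (fun t => (l (s, t)).2 * f (l (s, t))) (f (s, 0) / c s) 0 := by
      intro f hf
      have hfc : ContinuousAt (fun t => f (l (s, t)) / c s) 0 :=
        (ContinuousAt.comp (f := fun t => l (s, t)) (hf.continuousOn.continuousAt hmem)
          hlc).div_const _
      have h := hasDerivAt_mul_self hfc
      rw [hl0] at h
      refine h.congr_of_eventuallyEq (Eventually.of_forall fun t => ?_)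
      simp only [hl]
      ring
    have h2 : HasDerivAt (fun t => s + (l (s, t)).2 * A₀ (l (s, t))) (A₀ (s, 0) / c s) 0 :=
      (hg hA₀).const_add s
    have h3 : HasDerivAt (fun t => c (s + (l (s, t)).2 * A₀ (l (s, t))))
        (-(B₀ (s, 0) / A₀ (s, 0) * c s) * (A₀ (s, 0) / c s)) 0 := by
      have h4 : HasDerivAt c (-(B₀ (s, 0) / A₀ (s, 0) * c s))
          (s + (l (s, 0)).2 * A₀ (l (s, 0))) := by
        rw [hl0, zero_mul, add_zero]
        exact hcd s hs
      exact h4.comp (0 : ℝ) h2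
    have h5 := (h3.div_const (c s)).mul ((hg hB₀).const_add 1)
    simp only [hl0, zero_mul, add_zero] at h5
    rw [h1.unique h5]
    field_simp
    ring
  set A : ℝ × ℝ → ℝ := fun p => A₀ (l p) / c p.1 with hA
  have hAs : SmoothOn A D₁ :=
    (hA₀.comp (hlS.mono fun p hp => (hD₁W hp).1.1) fun p hp => (hD₁W hp).1.2.1).div
      (hcS.mono fun p hp => (hD₁W hp).1.1) fun p _ => (hc0 _).ne'
  set D := boxHull x₀ (D₁ ∩ (fun p => (A p, 1 + p.2 * B p)) ⁻¹' (Ioi 0 ×ˢ Ioi 0)) with hD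
  have hAB : ContinuousOn (fun p => (A p, 1 + p.2 * B p)) D₁ :=
    hAs.continuousOn.prodMk (continuousOn_const.add (continuousOn_snd.mul hB.continuousOn))
  have hDD₁ : D ⊆ D₁ := (boxHull_subset _ _).trans inter_subset_left
  have hform : ∀ p ∈ D₁, billiardMap A B p = ((M (l p)).1, c (M (l p)).1 * (M (l p)).2) := by
    intro p hp
    have hcp := (hc0 p.1).ne'
    ext
    · simp only [hM, billiardMap, hA, hl]
      ring
    · rw [billiardMap_snd, hRB' p hp]
      simp only
      rw [hM, billiardMap_snd]
      simp only [hR, hM, hl]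
      ring
  refine ⟨c, D, A, B, hc, hc0, ⟨hx₀, isOpen_boxHull _ (hAB.isOpen_inter_preimage hD₁
    (isOpen_Ioi.prod isOpen_Ioi)), Jset_subset_boxHull hx₀ ?_, fun p hp => (hD₁W (hDD₁ hp)).1.1,
    boxStar_boxHull _ _, hAs.mono hDD₁, hB.mono hDD₁, fun p hp => (boxHull_subset _ _ hp).2.1,
    hzero, fun p hp => (boxHull_subset _ _ hp).2.2, ?_⟩, fun p hp =>
    ⟨(hD₁W (hDD₁ hp)).1.2, (hD₁W (hDD₁ hp)).2, hform p (hDD₁ hp)⟩⟩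
  · rintro ⟨s, z⟩ ⟨hs, hz⟩
    obtain rfl : z = 0 := hz
    refine ⟨hJD₁ (mem_Jset hs), ?_, ?_⟩
    · simp only [hA, hl0, mem_Ioi]
      exact div_pos (hpos s hs) (hc0 s)
    · simp
  · intro p hp hp'
    have hneg := (boxStar_boxHull _ _ : BoxStar x₀ D).neg hp'
    rw [hform _ (hDD₁ hneg)]
    have h1 := hform p (hDD₁ hp)
    have hcs := (hc0 (M (l p)).1).ne'
    have hcp := (hc0 p.1).ne'
    have h2 : l ((billiardMap A B p).1, -(billiardMap A B p).2) = ((M (l p)).1, -(M (l p)).2) := by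
      rw [h1]
      ext
      · rfl
      · change -(c (M (l p)).1 * (M (l p)).2) / c (M (l p)).1 = -(M (l p)).2
        rw [neg_div, mul_div_cancel_left₀ _ hcs]
    have h3 : M (l p) ∈ D₀ := by
      have := (hD₁W (hDD₁ hneg)).1.2.1
      rw [h2] at this
      simpa using hst₀.neg this
    rw [h2, hrev _ (hD₁W (hDD₁ hp)).1.2.1 h3]
    simp only [hl]
    ext
    · rfl
    · simp only
      field_simp

end Rescaling

section Assembly

variable {a b x₀ : ℝ} {w : ℝ → ℝ} {V : Set (ℝ × ℝ)} {F : ℝ × ℝ → ℝ × ℝ}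

theorem IsAdjDomain.isOpen_squaring (hV : IsAdjDomain a b V) :
    IsOpen {p : ℝ × ℝ | p.1 ∈ Ioo a b ∧ (p.2 = 0 ∨ (p.1, p.2 ^ 2) ∈ V)} := by
  have hc : Continuous fun p : ℝ × ℝ => (p.1, p.2 ^ 2) := by fun_prop
  have hI : IsOpen {p : ℝ × ℝ | p.1 ∈ Ioo a b} := isOpen_Ioo.preimage continuous_fst
  rw [isOpen_iff_mem_nhds]
  rintro ⟨s, z⟩ ⟨hs, hz⟩
  rcases hz with hz | hz
  · obtain rfl : z = 0 := hz
    obtain ⟨ε, hε, hb⟩ := hV.2.2.2 s hs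
    have hbox : IsOpen (Ioo (s - ε) (s + ε) ×ˢ Ioo (-ε) ε) := isOpen_Ioo.prod isOpen_Ioo
    have hmem : (s, (0 : ℝ)) ∈ (fun p : ℝ × ℝ => (p.1, p.2 ^ 2)) ⁻¹'
        (Ioo (s - ε) (s + ε) ×ˢ Ioo (-ε) ε) := by
      simp [hε]
    filter_upwards [(hbox.preimage hc).mem_nhds hmem, hI.mem_nhds hs] with p hp hpI
    refine ⟨hpI, or_iff_not_imp_left.2 fun h0 => hb ⟨hp.1, ?_, hp.2.2⟩⟩
    exact lt_of_le_of_ne (sq_nonneg _) (Ne.symm (pow_ne_zero 2 h0))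
  · filter_upwards [(hV.1.preimage hc).mem_nhds hz, hI.mem_nhds hs] with p hp hpI
    exact ⟨hpI, Or.inr hp⟩

/-- The map `(s, z) ↦ (s, (z / c s)²)`. -/
noncomputable def fiberSquare (c : ℝ → ℝ) (p : ℝ × ℝ) : ℝ × ℝ := (p.1, (p.2 / c p.1) ^ 2)

theorem smoothOn_fiberSquare {c : ℝ → ℝ} (hc : SmoothOn c (Ioo a b)) (hc0 : ∀ s, 0 < c s) :
    SmoothOn (fiberSquare c) {p : ℝ × ℝ | p.1 ∈ Ioo a b} :=
  contDiffOn_fst.prodMk ((contDiffOn_snd.div (hc.comp contDiffOn_fst fun _ hp => hp)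
    fun _ _ => (hc0 _).ne').pow 2)

theorem det_fiberSquare {c : ℝ → ℝ} (hc : SmoothOn c (Ioo a b)) (hc0 : ∀ s, 0 < c s) {p : ℝ × ℝ}
    (hp : p.1 ∈ Ioo a b) : (fderiv ℝ (fiberSquare c) p).det = 2 * p.2 / c p.1 ^ 2 := by
  have hS : IsOpen {p : ℝ × ℝ | p.1 ∈ Ioo a b} := isOpen_Ioo.preimage continuous_fst
  have h := ((smoothOn_fiberSquare hc hc0).differentiableAt' hS hp).hasFDerivAt
  have h1 : (ContinuousLinearMap.fst ℝ ℝ ℝ).comp (fderiv ℝ (fiberSquare c) p) =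
      ContinuousLinearMap.fst ℝ ℝ ℝ := h.fst.unique hasFDerivAt_fst
  have h1' : ∀ v, (fderiv ℝ (fiberSquare c) p v).1 = v.1 := fun v => congrArg (· v) h1
  have h2 : HasDerivAt (fun t => (fiberSquare c (p.1, t)).2)
      (fderiv ℝ (fiberSquare c) p (0, 1)).2 p.2 := h.snd.hasDerivAt_vertical
  have h3 : HasDerivAt (fun t => (fiberSquare c (p.1, t)).2) (2 * p.2 / c p.1 ^ 2) p.2 := by
    refine (((hasDerivAt_id p.2).div_const (c p.1)).fun_pow 2).congr_deriv ?_
    have := (hc0 p.1).ne'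
    simp
    field_simp
  rw [det_eq_of_prod, h1', h1', h2.unique h3]
  simp

theorem hasFDerivAt_fiberScale {c : ℝ → ℝ} (hc : SmoothOn c (Ioo a b)) {p : ℝ × ℝ}
    (hp : p.1 ∈ Ioo a b) : ∃ L : ℝ × ℝ →L[ℝ] ℝ × ℝ,
      HasFDerivAt (fun q : ℝ × ℝ => (q.1, c q.1 * q.2)) L p ∧ L.det = c p.1 ∧
        L (0, 1) = (0, c p.1) := by
  have hS : IsOpen {p : ℝ × ℝ | p.1 ∈ Ioo a b} := isOpen_Ioo.preimage continuous_fst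
  have hs : SmoothOn (fun q : ℝ × ℝ => (q.1, c q.1 * q.2)) {p : ℝ × ℝ | p.1 ∈ Ioo a b} :=
    contDiffOn_fst.prodMk ((hc.comp contDiffOn_fst fun _ hp => hp).mul contDiffOn_snd)
  have h := (hs.differentiableAt' hS hp).hasFDerivAt
  refine ⟨_, h, ?_⟩
  set L := fderiv ℝ (fun q : ℝ × ℝ => (q.1, c q.1 * q.2)) p
  have h1 : (ContinuousLinearMap.fst ℝ ℝ ℝ).comp L =
      ContinuousLinearMap.fst ℝ ℝ ℝ := h.fst.unique hasFDerivAt_fst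
  have h1' : ∀ v, (L v).1 = v.1 := fun v => congrArg (· v) h1
  have h2 : HasDerivAt (fun t => c p.1 * t) (L (0, 1)).2 p.2 := h.snd.hasDerivAt_vertical
  have h3 := h2.unique (((hasDerivAt_id p.2).const_mul (c p.1)))
  rw [mul_one] at h3
  refine ⟨?_, Prod.ext (h1' _) h3⟩
  rw [det_eq_of_prod, h1', h1', h3]
  simp

theorem det_billiardMap {c : ℝ → ℝ} {D : Set (ℝ × ℝ)} {A B : ℝ × ℝ → ℝ}
    (hc : SmoothOn c (Ioo a b)) (hc0 : ∀ s, 0 < c s) (h : IsReversibleMap a b x₀ D A B)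
    (hV : IsOpen V) (hF : SmoothOn F V) (harea : ∀ p ∈ V, (fderiv ℝ F p).det = 1)
    (hmem : ∀ p ∈ D, 0 < p.2 → fiberSquare c p ∈ V)
    (hconj : ∀ p ∈ D, 0 < p.2 → F (fiberSquare c p) = fiberSquare c (billiardMap A B p))
    {p : ℝ × ℝ} (hp : p ∈ D) (hp0 : 0 < p.2) (hMp : (billiardMap A B p).1 ∈ Ioo a b) :
    (billiardMap A B p).2 * (1 / c (billiardMap A B p).1 ^ 2) * (fderiv ℝ (billiardMap A B) p).det =
      p.2 * (1 / c p.1 ^ 2) := by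
  have hS : IsOpen {p : ℝ × ℝ | p.1 ∈ Ioo a b} := isOpen_Ioo.preimage continuous_fst
  have hQ := smoothOn_fiberSquare hc hc0
  have h1 := ((hF.differentiableAt' hV (hmem p hp hp0)).hasFDerivAt).comp p
    (hQ.differentiableAt' hS (h.strip p hp)).hasFDerivAt
  have h2 := ((hQ.differentiableAt' hS hMp).hasFDerivAt).comp p
    (h.smooth.differentiableAt' h.isOpen hp).hasFDerivAt
  have h3 : F ∘ fiberSquare c =ᶠ[𝓝 p] fiberSquare c ∘ billiardMap A B := by
    filter_upwards [h.isOpen.mem_nhds hp,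
      (isOpen_lt continuous_const continuous_snd).mem_nhds hp0] with q hq hq0
    exact hconj q hq hq0
  have h4 := congrArg ContinuousLinearMap.det (h1.unique (h2.congr_of_eventuallyEq h3))
  have hdet : ∀ L M : ℝ × ℝ →L[ℝ] ℝ × ℝ, (L.comp M).det = L.det * M.det := fun L M =>
    LinearMap.det_comp (L : ℝ × ℝ →ₗ[ℝ] ℝ × ℝ) (M : ℝ × ℝ →ₗ[ℝ] ℝ × ℝ)
  rw [hdet, hdet, harea _ (hmem p hp hp0), det_fiberSquare hc hc0 (h.strip p hp),
    det_fiberSquare hc hc0 hMp] at h4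
  linear_combination -h4 / 2

end Assembly

section NormalForm

variable {a b x₀ : ℝ} {w : ℝ → ℝ} {V : Set (ℝ × ℝ)} {F : ℝ × ℝ → ℝ × ℝ}

theorem IsBilliardLike.exists_isLiftedNormalForm (hF : IsBilliardLike a b w V F)
    (hx₀ : x₀ ∈ Ioo a b) : ∃ D τ ν, IsLiftedNormalForm a b x₀ V F D τ ν := by
  obtain ⟨D₀, A₀, B₀, hD₀, hJ₀, -, hst₀, hA₀, hB₀, hpos, hrev, hFM⟩ := hF.exists_lift hx₀
  obtain ⟨c, D, A, B, hc, hc0, h, hform⟩ := exists_isReversibleMap hx₀ hD₀ hJ₀ hst₀ hA₀ hB₀ hpos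
    hrev hF.adj.isOpen_squaring (fun p hp => And.intro hp.1 (Or.inl hp.2))
  have hmem : ∀ p ∈ D, 0 < p.2 → fiberSquare c p ∈ V := by
    intro p hp h0
    rcases (hform p hp).1.2.2 with hz | hz
    · exact absurd hz (div_pos h0 (hc0 _)).ne'
    · exact hz
  have hlift : ∀ p ∈ D, 0 < p.2 → (F (fiberSquare c p)).1 = (billiardMap A B p).1 ∧
      c (billiardMap A B p).1 * √(F (fiberSquare c p)).2 = (billiardMap A B p).2 := by
    intro p hp h0
    obtain ⟨h1, h2⟩ := hFM _ (hform p hp).1.1 (div_pos h0 (hc0 _)) (hmem p hp h0)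
    rw [(hform p hp).2.2]
    exact ⟨h1, congrArg _ h2⟩
  have hconj : ∀ p ∈ D, 0 < p.2 →
      F (fiberSquare c p) = fiberSquare c (billiardMap A B p) := by
    intro p hp h0
    obtain ⟨h1, h2⟩ := hlift p hp h0
    refine Prod.ext h1 ?_
    change _ = ((billiardMap A B p).2 / c (billiardMap A B p).1) ^ 2
    rw [← h2, mul_div_cancel_left₀ _ (hc0 _).ne',
      Real.sq_sqrt (hF.mapsUpper _ (Or.inl (hmem p hp h0)))]
  have hstrip : ∀ p ∈ D, (billiardMap A B p).1 ∈ Ioo a b := fun p hp => by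
    rw [(hform p hp).2.2]
    exact (hform p hp).2.1
  have hg : SmoothOn (fun s => 1 / c s ^ 2) (Ioo a b) :=
    contDiffOn_const.div (hc.pow 2) fun s _ => (pow_pos (hc0 s) 2).ne'
  obtain ⟨D', τ, μ, hD', hJ', hD'D, hn⟩ := exists_isNormalizing h hg
    (fun s _ => one_div_pos.2 (pow_pos (hc0 s) 2)) fun p hp h0 _ =>
      det_billiardMap hc hc0 h hF.adj.1 hF.smoothV hF.areaPres hmem hconj hp h0 (hstrip p hp)
  set S : Set (ℝ × ℝ) := {p | p.1 ∈ Ioo a b} with hS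
  have hSo : IsOpen S := isOpen_Ioo.preimage continuous_fst
  set l : ℝ × ℝ → ℝ × ℝ := fun p => (p.1, c p.1 * p.2) with hl
  have hcS : SmoothOn (fun p : ℝ × ℝ => c p.1) S := hc.comp contDiffOn_fst fun p hp => hp
  have hlS : SmoothOn l S := contDiffOn_fst.prodMk (hcS.mul contDiffOn_snd)
  set E := boxHull x₀ (S ∩ l ⁻¹' D') with hE
  have hES : E ⊆ S := (boxHull_subset _ _).trans inter_subset_left
  have hEl : ∀ p ∈ E, l p ∈ D' := fun p hp => (boxHull_subset _ _ hp).2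
  have hEo : IsOpen E := isOpen_boxHull _ (hlS.continuousOn.isOpen_inter_preimage hSo hD')
  have hl2 : ∀ p : ℝ × ℝ, 0 < p.2 → 0 < (l p).2 := fun p h0 => mul_pos (hc0 _) h0
  have hsq : ∀ p, fiberSquare c (l p) = (p.1, p.2 ^ 2) := fun p => by
    simp only [fiberSquare, hl, mul_div_cancel_left₀ _ (hc0 p.1).ne']
  have hneg : ∀ p : ℝ × ℝ, l (p.1, -p.2) = ((l p).1, -(l p).2) := fun p => by simp [hl]
  have hpair : (fun p : ℝ × ℝ => (τ (l p), p.2 * (c p.1 * μ (l p)))) =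
      (fun p : ℝ × ℝ => (τ p, p.2 * μ p)) ∘ l := by
    funext p
    simp only [hl, Function.comp_apply]
    ring_nf
  have hvert : (fun p : ℝ × ℝ => p.2 * (c p.1 * μ (l p))) =
      (fun p : ℝ × ℝ => p.2 * μ p) ∘ l := by
    funext p
    simp only [hl, Function.comp_apply]
    ring
  have hsn : SmoothOn (fun p : ℝ × ℝ => p.2 * μ p) D' := contDiffOn_snd.mul hn.smoothμ
  have hsp : SmoothOn (fun p : ℝ × ℝ => (τ p, p.2 * μ p)) D' := hn.smoothτ.prodMk hsn
  refine ⟨E, fun p => τ (l p), fun p => c p.1 * μ (l p), hEo,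
    Jset_subset_boxHull hx₀ ?_, hES, boxStar_boxHull _ _, hn.smoothτ.comp (hlS.mono hES) hEl,
    (hcS.mono hES).mul (hn.smoothμ.comp (hlS.mono hES) hEl), ?_, ?_,
    fun p hp => mul_pos (hc0 _) (hn.posμ _ (hEl p hp)), ?_, ?_, ?_, ?_, ?_⟩
  · rintro ⟨s, z⟩ ⟨hs, hz⟩
    obtain rfl : z = 0 := hz
    refine ⟨hs, ?_⟩
    simp only [mem_preimage, hl, mul_zero]
    exact hJ' (mem_Jset hs)
  · intro p hp
    simp only [hneg]
    exact hn.evenτ _ (hEl p hp)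
  · intro p hp
    simp only [hneg]
    rw [hn.evenμ _ (hEl p hp)]
  · simp only [hpair]
    refine hn.inj.comp ?_ hEl
    intro p _ q _ hpq
    simp only [hl, Prod.mk.injEq] at hpq
    obtain ⟨h1, h2⟩ := hpq
    rw [h1] at h2
    exact Prod.ext h1 (mul_left_cancel₀ (hc0 _).ne' h2)
  · intro p hp
    obtain ⟨L, hL, hLd, -⟩ := hasFDerivAt_fiberScale hc (hES hp)
    have h1 := (hsp.differentiableAt' hD' (hEl p hp)).hasFDerivAt.comp p hL
    have hd : ∀ M : ℝ × ℝ →L[ℝ] ℝ × ℝ, (M.comp L).det = M.det * L.det := fun M =>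
      LinearMap.det_comp (M : ℝ × ℝ →ₗ[ℝ] ℝ × ℝ) (L : ℝ × ℝ →ₗ[ℝ] ℝ × ℝ)
    rw [hpair, h1.fderiv, hd, hLd, hn.det _ (hEl p hp)]
    have hcp := (hc0 p.1).ne'
    have hμ := (hn.posμ _ (hEl p hp)).ne'
    change 1 / c p.1 ^ 2 / μ (l p) * c p.1 = 1 / (c p.1 * μ (l p))
    field_simp
  · intro p hp
    obtain ⟨L, hL, -, hLv⟩ := hasFDerivAt_fiberScale hc (hES hp)
    have h1 := (hsn.differentiableAt' hD' (hEl p hp)).hasFDerivAt.comp p hL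
    rw [hvert, h1.fderiv, ContinuousLinearMap.comp_apply, hLv]
    have h2 : ((0 : ℝ), c p.1) = c p.1 • ((0 : ℝ), (1 : ℝ)) := by simp
    rw [h2, map_smul, smul_eq_mul]
    exact mul_pos (hc0 _) (hn.vert _ (hEl p hp))
  · intro p hp h0
    rw [← hsq]
    exact hmem _ (hD'D (hEl p hp)) (hl2 p h0)
  · intro p hp h0
    obtain ⟨h1, h2⟩ := hlift _ (hD'D (hEl p hp)) (hl2 p h0)
    obtain ⟨h3, h4⟩ := hn.invariant _ (hEl p hp) (hl2 p h0)
    rw [hsq] at h1 h2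
    have h5 : l ((F (p.1, p.2 ^ 2)).1, √(F (p.1, p.2 ^ 2)).2) = billiardMap A B (l p) := by
      refine Prod.ext h1 ?_
      rw [← h2, ← h1]
    have h6 : (l p).2 = p.2 * c p.1 := mul_comm _ _
    simp only [h5]
    constructor
    · rw [h1]
      rw [← h2, h6] at h3
      linear_combination h3
    · rw [h4, h6]
      ring

end NormalForm

end NormalFormConstruction

/-- For every `C^∞`-lifted strongly billiard-like map `F` there exist a
domain `U ⊆ V` adjacent to `J` and `C^∞`-smooth functions `τ(s,y)`, `h̃(s,y)` on `U ∪ J`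
such that `h̃` is `F`-invariant, vanishes on `J`, `∂h̃/∂y > 0`; the map
`Φ = (τ, h̃)` is a `C^∞` diffeomorphism of `U ∪ J` onto its image with Jacobian
determinant identically `1` (so `(τ, h̃)` are symplectic coordinates); and in these
coordinates `F` takes the normal form `(τ, h̃) ↦ (τ + √h̃, h̃)`. -/
theorem statement4 (a b : ℝ) (hab : a < b) (w : ℝ → ℝ) (V : Set (ℝ × ℝ))
    (F : ℝ × ℝ → ℝ × ℝ) (hF : IsBilliardLike a b w V F) :
    ∃ U : Set (ℝ × ℝ), U ⊆ V ∧ IsAdjDomain a b U ∧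
      ∃ τ ht : ℝ × ℝ → ℝ,
        ContDiffOn ℝ (⊤ : ℕ∞) τ (U ∪ Jset a b) ∧
        ContDiffOn ℝ (⊤ : ℕ∞) ht (U ∪ Jset a b) ∧
        -- `h̃` is `F`-invariant, vanishes on `J`, and `∂h̃/∂y > 0`:
        (∀ p ∈ U ∪ Jset a b, 0 ≤ ht p) ∧
        (∀ s ∈ Set.Ioo a b, ht (s, 0) = 0) ∧
        (∀ p ∈ U ∪ Jset a b, F p ∈ U ∪ Jset a b → ht (F p) = ht p) ∧
        (∀ p ∈ U ∪ Jset a b,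
          0 < fderivWithin ℝ ht (U ∪ Jset a b) p (0, 1)) ∧
        -- `(τ, h̃)` is a `C^∞` diffeomorphism onto its image:
        Set.InjOn (fun p => (τ p, ht p)) (U ∪ Jset a b) ∧
        (∃ Ψ : ℝ × ℝ → ℝ × ℝ,
          ContDiffOn ℝ (⊤ : ℕ∞) Ψ ((fun p => (τ p, ht p)) '' (U ∪ Jset a b)) ∧
          ∀ p ∈ U ∪ Jset a b, Ψ (τ p, ht p) = p) ∧
        -- it preserves the standard area form: Jacobian determinant ≡ 1
        (∀ p ∈ U ∪ Jset a b,
          (fderivWithin ℝ (fun p => (τ p, ht p)) (U ∪ Jset a b) p).det = 1) ∧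
        -- normal form `F : (τ, h̃) ↦ (τ + √h̃, h̃)`:
        (∀ p ∈ U ∪ Jset a b, F p ∈ U ∪ Jset a b →
          τ (F p) = τ p + Real.sqrt (ht p) ∧ ht (F p) = ht p) := by
  have hx₀ : (a + b) / 2 ∈ Set.Ioo a b := ⟨by linarith, by linarith⟩
  obtain ⟨D, τ, ν, h⟩ := hF.exists_isLiftedNormalForm hx₀
  exact ⟨sqrtRegion D, h.sqrtRegion_subset, isAdjDomain_sqrtRegion hx₀ h.isOpen h.axis h.star,
    timeFun τ, energyFun ν, h.smooth_timeFun, h.smooth_energyFun, fun p hp => h.energyFun_nonneg hp,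
    fun s _ => by simp [energyFun], fun p hp hFp => (h.normal_form hF.fixJ hp hFp).2,
    fun p hp => h.energyFun_vert hp, h.injOn_coordinates, h.exists_smooth_inverse,
    fun p hp => h.det_coordinates hp, fun p hp hFp => h.normal_form hF.fixJ hp hFp⟩
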